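/- arXiv:1809.04875 — 2 statements merged into one kernel-verified Lean document; each statement's English description precedes it below -/
import Mathlib

section
/- Let N ≥ 3, let B be the open unit ball in ℝ^N, let β ≥ 0, let q be a real number with q ≥ (2β+N+2)/(N−2), and let λ ≥ 0. Then there is no function u that is continuously differentiable on the closed unit ball and twice continuously differentiable on B, with u > 0 in B and u = 0 on the unit sphere, satisfying −Δu(x) = u(x)^((N+2)/(N−2)) + λ·|x|^β·u(x)^q for all x ∈ B. -/
open scoped NNReal
open MeasureTheory Filter Set Metric

noncomputable def laplacian {N : ℕ} (u : EuclideanSpace ℝ (Fin N) → ℝ)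
    (x : EuclideanSpace ℝ (Fin N)) : ℝ :=
  ∑ i, fderiv ℝ (fun y => fderiv ℝ u y (EuclideanSpace.single i (1:ℝ))) x
      (EuclideanSpace.single i (1:ℝ))

lemma hld_mul {E : Type*} [NormedAddCommGroup E] [NormedSpace ℝ E] {f g : E → ℝ} {f' g' : ℝ}
    {x v : E} (hf : HasLineDerivAt ℝ f f' x v) (hg : HasLineDerivAt ℝ g g' x v) :
    HasLineDerivAt ℝ (fun y => f y * g y) (f' * g x + f x * g') x v := by
  have := HasDerivAt.fun_mul hf hg
  simpa [HasLineDerivAt] using this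

lemma hld_add {E : Type*} [NormedAddCommGroup E] [NormedSpace ℝ E] {f g : E → ℝ} {f' g' : ℝ}
    {x v : E} (hf : HasLineDerivAt ℝ f f' x v) (hg : HasLineDerivAt ℝ g g' x v) :
    HasLineDerivAt ℝ (fun y => f y + g y) (f' + g') x v := HasDerivAt.add hf hg

lemma hld_sub {E : Type*} [NormedAddCommGroup E] [NormedSpace ℝ E] {f g : E → ℝ} {f' g' : ℝ}
    {x v : E} (hf : HasLineDerivAt ℝ f f' x v) (hg : HasLineDerivAt ℝ g g' x v) :
    HasLineDerivAt ℝ (fun y => f y - g y) (f' - g') x v := HasDerivAt.sub hf hg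

lemma hld_const_mul {E : Type*} [NormedAddCommGroup E] [NormedSpace ℝ E] {f : E → ℝ} {f' : ℝ}
    {x v : E} (c : ℝ) (hf : HasLineDerivAt ℝ f f' x v)  :
    HasLineDerivAt ℝ (fun y => c * f y) (c * f') x v := HasDerivAt.const_mul c hf

lemma hld_sum {E ι : Type*} [NormedAddCommGroup E] [NormedSpace ℝ E] (s : Finset ι)
    {f : ι → E → ℝ} {f' : ι → ℝ}
    {x v : E} (hf : ∀ i ∈ s, HasLineDerivAt ℝ (f i) (f' i) x v)  :
    HasLineDerivAt ℝ (fun y => ∑ i ∈ s, f i y) (∑ i ∈ s, f' i) x v := by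
  have := HasDerivAt.fun_sum (u := s) (A := fun i t => f i (x + t • v)) (A' := f') (x := 0) hf
  exact this

lemma hld_coord {N : ℕ} (i j : Fin N) (x : EuclideanSpace ℝ (Fin N)) :
    HasLineDerivAt ℝ (fun y : EuclideanSpace ℝ (Fin N) => y j) (if j = i then 1 else 0) x
      (EuclideanSpace.single i (1:ℝ)) := by
  have h : HasFDerivAt (fun y : EuclideanSpace ℝ (Fin N) => y j)
    (EuclideanSpace.proj j : EuclideanSpace ℝ (Fin N) →L[ℝ] ℝ) x :=
    (EuclideanSpace.proj j : EuclideanSpace ℝ (Fin N) →L[ℝ] ℝ).hasFDerivAt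
  have := h.hasLineDerivAt (EuclideanSpace.single i (1:ℝ))
  simpa [Pi.single_apply] using this

lemma hld_normsq {N : ℕ} (i : Fin N) (x : EuclideanSpace ℝ (Fin N)) :
    HasLineDerivAt ℝ (fun y : EuclideanSpace ℝ (Fin N) => ‖y‖ ^ 2) (2 * x i) x
      (EuclideanSpace.single i (1:ℝ)) := by
  have h := (hasStrictFDerivAt_norm_sq x).hasFDerivAt.hasLineDerivAt
    (EuclideanSpace.single i (1:ℝ))
  simpa [EuclideanSpace.inner_single_right] using h

lemma exists_cutoff (N : ℕ) (ε : ℝ) (hε : 0 < ε) :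
    ∃ φ w : EuclideanSpace ℝ (Fin N) → ℝ, Continuous φ ∧ Continuous w ∧
      (∀ x, 0 ≤ φ x) ∧ (∀ x, φ x ≤ 1) ∧ (∀ x, 0 ≤ w x) ∧
      (∀ i x, HasLineDerivAt ℝ φ (-(w x * x i)) x (EuclideanSpace.single i (1:ℝ))) ∧
      (∀ x, ‖x‖ ^ 2 ≤ 1 - 2 * ε → φ x = 1) ∧
      (∀ x, ‖x‖ ^ 2 < 1 - 2 * ε → w x = 0) ∧
      (∀ x, 1 - ε < ‖x‖ ^ 2 → φ x = 0) ∧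
      (∀ x, 1 - ε < ‖x‖ ^ 2 → w x = 0) := by
  have hc : ContDiff ℝ 1 Real.smoothTransition := Real.smoothTransition.contDiff (n := 1)
  have hd : Continuous (deriv Real.smoothTransition) := hc.continuous_deriv le_rfl
  refine ⟨fun x => Real.smoothTransition ((1 - ‖x‖ ^ 2) / ε - 1),
    fun x => 2 / ε * deriv Real.smoothTransition ((1 - ‖x‖ ^ 2) / ε - 1), ?_, ?_, ?_, ?_, ?_, ?_,
    ?_, ?_, ?_, ?_⟩
  · fun_prop
  · fun_prop
  · exact fun x => Real.smoothTransition.nonneg _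
  · exact fun x => Real.smoothTransition.le_one _
  · intro x
    have := Real.smoothTransition.monotone.deriv_nonneg (x := (1 - ‖x‖ ^ 2) / ε - 1)
    positivity
  · intro i x
    have h1 : HasDerivAt Real.smoothTransition
        (deriv Real.smoothTransition ((1 - ‖x‖ ^ 2) / ε - 1)) ((1 - ‖x‖ ^ 2) / ε - 1) :=
      (hc.differentiable (by norm_num) _).hasDerivAt
    have h2 : HasDerivAt (fun t : ℝ => (1 - ‖x + t • EuclideanSpace.single i (1:ℝ)‖ ^ 2) / ε - 1)
      (-(2 * x i) / ε) 0 := by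
      have := hld_normsq i x
      exact ((HasDerivAt.const_sub 1 this).div_const ε).sub_const 1
    have h1' : HasDerivAt Real.smoothTransition
        (deriv Real.smoothTransition ((1 - ‖x‖ ^ 2) / ε - 1))
        ((1 - ‖x + (0:ℝ) • EuclideanSpace.single i (1:ℝ)‖ ^ 2) / ε - 1) := by
      rw [zero_smul, add_zero]; exact h1
    have h3 := HasDerivAt.comp (h₂ := Real.smoothTransition) (x := (0:ℝ)) h1' h2
    unfold HasLineDerivAt
    refine HasDerivAt.congr_deriv h3 ?_
    ring
  · intro x hx
    apply Real.smoothTransition.one_of_one_le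
    have : 2 ≤ (1 - ‖x‖ ^ 2) / ε := by rw [le_div_iff₀ hε]; linarith
    linarith
  · intro x hx
    have h2 : 1 < (1 - ‖x‖ ^ 2) / ε - 1 := by
      have : 2 < (1 - ‖x‖ ^ 2) / ε := by rw [lt_div_iff₀ hε]; linarith
      linarith
    have : Real.smoothTransition =ᶠ[nhds ((1 - ‖x‖ ^ 2) / ε - 1)] fun _ => 1 := by
      filter_upwards [lt_mem_nhds h2] with y hy
      exact Real.smoothTransition.one_of_one_le hy.le
    simp [this.deriv_eq]
  · intro x hx
    apply Real.smoothTransition.zero_of_nonpos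
    have : (1 - ‖x‖ ^ 2) / ε ≤ 1 := by rw [div_le_iff₀ hε]; linarith
    linarith
  · intro x hx
    have h2 : (1 - ‖x‖ ^ 2) / ε - 1 < 0 := by
      have : (1 - ‖x‖ ^ 2) / ε < 1 := by rw [div_lt_iff₀ hε]; linarith
      linarith
    have : Real.smoothTransition =ᶠ[nhds ((1 - ‖x‖ ^ 2) / ε - 1)] fun _ => 0 := by
      filter_upwards [gt_mem_nhds h2] with y hy
      exact Real.smoothTransition.zero_of_nonpos hy.le
    simp [this.deriv_eq]

lemma cut_integrable {N : ℕ} {φ g : EuclideanSpace ℝ (Fin N) → ℝ} {ρ : ℝ}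
    (hφ : Continuous φ) (h0 : ∀ x, x ∉ closedBall (0 : EuclideanSpace ℝ (Fin N)) ρ → φ x = 0)
    (hg : IntegrableOn g (closedBall 0 ρ)) : Integrable (fun x => φ x * g x) := by
  have h1 : IntegrableOn (fun x => φ x * g x) (closedBall 0 ρ) :=
    hg.continuousOn_mul hφ.continuousOn (isCompact_closedBall 0 ρ)
  refine h1.integrable_of_forall_notMem_eq_zero fun x hx => ?_
  simp [h0 x hx]

lemma ibp {N : ℕ} {φ w : EuclideanSpace ℝ (Fin N) → ℝ} {ρ : ℝ} (hρ : ρ < 1)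
    (hφ : Continuous φ) (hw : Continuous w)
    (h0 : ∀ x, x ∉ closedBall (0 : EuclideanSpace ℝ (Fin N)) ρ → φ x = 0)
    (h0w : ∀ x, x ∉ closedBall (0 : EuclideanSpace ℝ (Fin N)) ρ → w x = 0)
    (hd : ∀ i x, HasLineDerivAt ℝ φ (-(w x * x i)) x (EuclideanSpace.single i (1:ℝ)))
    (V D : Fin N → EuclideanSpace ℝ (Fin N) → ℝ)
    (hV : ∀ i, ContinuousOn (V i) (ball 0 1))
    (hD : ∀ i, IntegrableOn (D i) (closedBall 0 ρ))
    (hVD : ∀ i, ∀ x ∈ ball (0 : EuclideanSpace ℝ (Fin N)) 1,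
      HasLineDerivAt ℝ (V i) (D i x) x (EuclideanSpace.single i (1:ℝ))) :
    ∫ x, φ x * ∑ i, D i x = ∫ x, w x * ∑ i, x i * V i x := by
  have hsub : closedBall (0 : EuclideanSpace ℝ (Fin N)) ρ ⊆ ball 0 1 := closedBall_subset_ball hρ
  have hts : tsupport φ ⊆ closedBall 0 ρ := by
    apply closure_minimal _ isClosed_closedBall
    intro x hx
    by_contra h
    exact hx (h0 x h)
  have hVi : ∀ i, IntegrableOn (V i) (closedBall 0 ρ) := fun i =>
    ((hV i).mono hsub).integrableOn_compact (isCompact_closedBall 0 ρ)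
  have hxVi : ∀ i, IntegrableOn (fun x : EuclideanSpace ℝ (Fin N) => x i * V i x)
      (closedBall 0 ρ) := fun i => by
    refine ContinuousOn.integrableOn_compact (isCompact_closedBall 0 ρ) ?_
    exact ContinuousOn.mul (by fun_prop) ((hV i).mono hsub)
  simp_rw [Finset.mul_sum]
  rw [integral_finsetSum _ fun i _ => cut_integrable hφ h0 (hD i),
    integral_finsetSum _ fun i _ => cut_integrable hw h0w (hxVi i)]
  refine Finset.sum_congr rfl fun i _ => ?_
  have key := integral_bilinear_hasLineDerivAt_right_eq_neg_left_of_integrable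
    (μ := (volume : Measure (EuclideanSpace ℝ (Fin N))))
    (f := φ) (f' := fun x => -(w x * x i)) (g := V i) (g' := D i)
    (v := EuclideanSpace.single i (1:ℝ)) (B := ContinuousLinearMap.mul ℝ ℝ)
    (by
      have := (cut_integrable hw h0w (hxVi i)).neg
      refine this.congr (Eventually.of_forall fun x => ?_)
      simp; ring)
    (by simpa using cut_integrable hφ h0 (hD i))
    (by simpa using cut_integrable hφ h0 (hVi i))
    (fun x _ => hd i x) (fun x hx => hVD i x (hsub (hts hx)))
  simp only [ContinuousLinearMap.mul_apply'] at key
  rw [key, ← integral_neg]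
  congr 1; ext x; ring

lemma tangential {N : ℕ} {u : EuclideanSpace ℝ (Fin N) → ℝ} {x : EuclideanSpace ℝ (Fin N)}
    {L : EuclideanSpace ℝ (Fin N) →L[ℝ] ℝ} (hx : ‖x‖ = 1)
    (hu : ∀ x ∈ sphere (0 : EuclideanSpace ℝ (Fin N)) 1, u x = 0)
    (hL : HasFDerivWithinAt u L (closedBall 0 1) x) (v : EuclideanSpace ℝ (Fin N))
    (hv : inner ℝ x v = 0) : L v = 0 := by
  by_cases hv0 : v = 0
  · simp [hv0]
  have hn : ‖v‖ ≠ 0 := by simpa using hv0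
  set e := ‖v‖⁻¹ • v with he
  have hen : ‖e‖ = 1 := by simp [he, norm_smul, hn]
  have hxe : inner ℝ x e = 0 := by simp [he, inner_smul_right, hv]
  have hs : ∀ t : ℝ, ‖Real.cos t • x + Real.sin t • e‖ = 1 := fun t => by
    have : ‖Real.cos t • x + Real.sin t • e‖ ^ 2 = 1 := by
      rw [norm_add_sq_real, norm_smul, norm_smul, inner_smul_left, inner_smul_right, hxe, hx, hen]
      simp
    nlinarith [norm_nonneg (Real.cos t • x + Real.sin t • e)]
  have hγ : HasDerivAt (fun t : ℝ => Real.cos t • x + Real.sin t • e) e 0 := by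
    have := ((Real.hasDerivAt_cos 0).smul_const x).fun_add ((Real.hasDerivAt_sin 0).smul_const e)
    simpa using this
  have h2 : HasDerivWithinAt (u ∘ fun t : ℝ => Real.cos t • x + Real.sin t • e) (L e) univ 0 := by
    refine HasFDerivWithinAt.comp_hasDerivWithinAt (t := closedBall 0 1) (0:ℝ) ?_
      hγ.hasDerivWithinAt ?_
    · simpa using hL
    · intro t _; simp [hs t]
  have h3 : (u ∘ fun t : ℝ => Real.cos t • x + Real.sin t • e) = fun _ => 0 := by
    ext t; exact hu _ (by simp [hs t])
  rw [h3] at h2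
  have h4 : L e = 0 := (hasDerivWithinAt_univ.1 h2).unique (hasDerivAt_const _ _)
  have : v = ‖v‖ • e := by simp [he, smul_smul, hn]
  rw [this]; simp [h4]

lemma boundary_id {N : ℕ} {u : EuclideanSpace ℝ (Fin N) → ℝ} {x : EuclideanSpace ℝ (Fin N)}
    {L : EuclideanSpace ℝ (Fin N) →L[ℝ] ℝ} (hx : ‖x‖ = 1)
    (hu : ∀ x ∈ sphere (0 : EuclideanSpace ℝ (Fin N)) 1, u x = 0)
    (hL : HasFDerivWithinAt u L (closedBall 0 1) x) :
    ∑ i, L (EuclideanSpace.single i 1) ^ 2 = (∑ i, x i * L (EuclideanSpace.single i 1)) ^ 2 := by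
  have hxs : ∑ i, x i ^ 2 = 1 := by
    rw [← EuclideanSpace.real_norm_sq_eq, hx]; norm_num
  have h1 : ∀ i, L (EuclideanSpace.single i 1) = x i * L x := fun i => by
    have := tangential hx hu hL (EuclideanSpace.single i 1 - x i • x) (by
      rw [inner_sub_right, inner_smul_right, real_inner_self_eq_norm_sq, hx,
        EuclideanSpace.inner_single_right]; simp)
    rw [map_sub, map_smul] at this
    simp at this; linarith
  simp_rw [h1]
  have e1 : ∑ i, (x i * L x) ^ 2 = L x ^ 2 := by
    simp_rw [mul_pow]; rw [← Finset.sum_mul, hxs, one_mul]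
  have e2 : ∑ i, x i * (x i * L x) = L x := by
    simp_rw [← mul_assoc, ← pow_two]; rw [← Finset.sum_mul, hxs, one_mul]
  rw [e1, e2]

lemma hld_pow {N : ℕ} {β : ℝ} (hβ : 0 ≤ β) (i : Fin N) (x : EuclideanSpace ℝ (Fin N)) :
    HasLineDerivAt ℝ (fun y : EuclideanSpace ℝ (Fin N) => ‖y‖ ^ β * y i)
      (‖x‖ ^ β + β * (x i ^ 2 * ‖x‖ ^ (β - 2))) x
      (EuclideanSpace.single i (1:ℝ)) := by
  by_cases hx : x = 0
  · subst hx
    unfold HasLineDerivAt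
    rw [hasDerivAt_iff_tendsto_slope]
    have hc : Continuous fun t : ℝ => |t| ^ β := continuous_abs.rpow_const (by simp [hβ])
    have := (hc.tendsto 0).mono_left (nhdsWithin_le_nhds (s := {0}ᶜ))
    simp only [abs_zero] at this
    refine (this.congr' ?_).trans (by simp)
    filter_upwards [self_mem_nhdsWithin] with t ht
    have ht : t ≠ 0 := ht
    simp [slope_def_field, norm_smul]
    field_simp
  · have hpos : 0 < ‖x‖ := norm_pos_iff.2 hx
    have h1 : HasLineDerivAt ℝ (fun y : EuclideanSpace ℝ (Fin N) => ‖y‖ ^ β)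
      (β * x i * ‖x‖ ^ (β - 2)) x (EuclideanSpace.single i (1:ℝ)) := by
      have h2 := hld_normsq i x
      have h3 := HasDerivAt.rpow_const (p := β / 2) h2 (by left; simpa using hx)
      have h4 : ∀ y : EuclideanSpace ℝ (Fin N), ‖y‖ ^ β = (‖y‖ ^ 2) ^ (β / 2) := fun y => by
        rw [← Real.rpow_natCast_mul (norm_nonneg _)]; congr 1; push_cast; ring
      unfold HasLineDerivAt
      simp_rw [h4]
      refine HasDerivAt.congr_deriv h3 ?_
      simp only [zero_smul, add_zero]
      rw [← Real.rpow_natCast_mul (norm_nonneg _), show ((2:ℕ):ℝ) * (β / 2 - 1) = β - 2 by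
        push_cast; ring]
      ring
    have h := hld_mul h1 (hld_coord i i x)
    refine HasDerivAt.congr_deriv h ?_
    simp; ring

lemma near_boundary {N : ℕ} {Z : EuclideanSpace ℝ (Fin N) → ℝ}
    (hZ : ContinuousOn Z (closedBall 0 1))
    (h0 : ∀ x ∈ sphere (0 : EuclideanSpace ℝ (Fin N)) 1, Z x = 0) (δ : ℝ) (hδ : 0 < δ) :
    ∃ r < 1, ∀ x ∈ ball (0 : EuclideanSpace ℝ (Fin N)) 1, r < ‖x‖ → -δ ≤ Z x := by
  have hK : IsCompact (closedBall (0 : EuclideanSpace ℝ (Fin N)) 1 ∩ Z ⁻¹' (Iic (-δ))) :=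
    (isCompact_closedBall 0 1).of_isClosed_subset
      (hZ.preimage_isClosed_of_isClosed isClosed_closedBall isClosed_Iic) inter_subset_left
  rcases (closedBall (0 : EuclideanSpace ℝ (Fin N)) 1 ∩ Z ⁻¹' (Iic (-δ))).eq_empty_or_nonempty
    with he | hne
  · refine ⟨0, one_pos, fun x hx _ => ?_⟩
    by_contra h
    have : x ∈ closedBall (0 : EuclideanSpace ℝ (Fin N)) 1 ∩ Z ⁻¹' (Iic (-δ)) :=
      ⟨ball_subset_closedBall hx, (not_le.1 h).le⟩
    rw [he] at this; exact this
  · obtain ⟨y, hy, hmax⟩ := hK.exists_isMaxOn hne continuous_norm.continuousOn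
    have hy1 : ‖y‖ ≤ 1 := by simpa using hy.1
    refine ⟨‖y‖, lt_of_le_of_ne hy1 fun h => ?_, fun x hx hr => ?_⟩
    · have h1 := h0 y (by simpa using h)
      have h2 : Z y ≤ -δ := hy.2
      linarith
    · by_contra h
      have : ‖x‖ ≤ ‖y‖ := hmax ⟨ball_subset_closedBall hx, (not_le.1 h).le⟩
      linarith

lemma abstract_contra {N : ℕ} (V D G H : Fin N → EuclideanSpace ℝ (Fin N) → ℝ)
    (hV : ∀ i, ContinuousOn (V i) (ball 0 1))
    (hD : ∀ i, ∀ ρ < 1, IntegrableOn (D i) (closedBall 0 ρ))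
    (hVD : ∀ i, ∀ x ∈ ball (0 : EuclideanSpace ℝ (Fin N)) 1,
      HasLineDerivAt ℝ (V i) (D i x) x (EuclideanSpace.single i (1:ℝ)))
    (hG : ∀ i, ContinuousOn (G i) (ball 0 1))
    (hH : ∀ i, ContinuousOn (H i) (ball 0 1))
    (hGH : ∀ i, ∀ x ∈ ball (0 : EuclideanSpace ℝ (Fin N)) 1,
      HasLineDerivAt ℝ (G i) (H i x) x (EuclideanSpace.single i (1:ℝ)))
    (hdV : ∀ x ∈ ball (0 : EuclideanSpace ℝ (Fin N)) 1, ∑ i, D i x ≤ 0)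
    (hdG : ∀ x ∈ ball (0 : EuclideanSpace ℝ (Fin N)) 1, ∑ i, H i x < 0)
    (hZ : ∀ δ > 0, ∃ r < 1, ∀ x ∈ ball (0 : EuclideanSpace ℝ (Fin N)) 1, r < ‖x‖ →
      -δ ≤ ∑ i, x i * V i x - (∑ i, x i * G i x) ^ 2 / 2) : False := by
  have hHs : ContinuousOn (fun x => ∑ i, H i x) (ball (0 : EuclideanSpace ℝ (Fin N)) 1) :=
    continuousOn_finsetSum _ fun i _ => hH i
  have hint : ∀ {ρ : ℝ}, ρ < 1 → ∀ {k : EuclideanSpace ℝ (Fin N) → ℝ},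
      ContinuousOn k (ball 0 1) → IntegrableOn k (closedBall 0 ρ) := fun hρ k hk =>
    (hk.mono (closedBall_subset_ball hρ)).integrableOn_compact (isCompact_closedBall 0 _)
  -- the constant c
  set c := ∫ x in closedBall (0 : EuclideanSpace ℝ (Fin N)) (1/2), -∑ i, H i x with hc
  have hcpos : 0 < c := by
    rw [hc, setIntegral_pos_iff_support_of_nonneg_ae]
    · have : closedBall (0 : EuclideanSpace ℝ (Fin N)) (1/2) ⊆
          Function.support (fun x => -∑ i, H i x) ∩ closedBall 0 (1/2) := fun x hx =>
        ⟨by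
          have := hdG x (closedBall_subset_ball (by norm_num) hx)
          simp only [Function.mem_support]; linarith, hx⟩
      exact lt_of_lt_of_le (measure_closedBall_pos _ _ (by norm_num)) (measure_mono this)
    · refine (ae_restrict_iff' measurableSet_closedBall).2 (Eventually.of_forall fun x hx => ?_)
      have := hdG x (closedBall_subset_ball (by norm_num) hx)
      simp only [Pi.zero_apply]; linarith
    · exact (hint (by norm_num) hHs).neg
  set C := 2 * N * (volume.real (ball (0 : EuclideanSpace ℝ (Fin N)) 1)) with hC
  have hC0 : 0 ≤ C := by positivity
  set s := c / (C + 1) with hs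
  have hspos : 0 < s := by positivity
  have hsC : C * s < c := by
    rw [hs, mul_div_assoc', div_lt_iff₀ (by positivity)]; nlinarith
  obtain ⟨r, hr1, hr⟩ := hZ (s ^ 2 / 2) (by positivity)
  set r' := max r 0 with hr'
  have hr'1 : r' < 1 := max_lt hr1 one_pos
  have hr'0 : 0 ≤ r' := le_max_right _ _
  set ε := min (1/8) ((1 - r' ^ 2) / 4) with hε
  have hr'2 : r' ^ 2 < 1 := by nlinarith
  have hεpos : 0 < ε := lt_min (by norm_num) (by linarith)
  have hε1 : ε ≤ 1/8 := min_le_left _ _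
  have hε2 : ε ≤ (1 - r' ^ 2) / 4 := min_le_right _ _
  obtain ⟨φ, w, hφc, hwc, hφ0, hφ1, hw0, hφw, hφone, hwin, hφout, hwout⟩ :=
    exists_cutoff N ε hεpos
  set ρ := √(1 - ε) with hρd
  have hρ : ρ < 1 := by rw [hρd, Real.sqrt_lt' one_pos]; linarith
  have hout : ∀ x : EuclideanSpace ℝ (Fin N), x ∉ closedBall 0 ρ → 1 - ε < ‖x‖ ^ 2 := fun x hx => by
    rw [mem_closedBall_zero_iff, not_le] at hx
    exact (Real.sqrt_lt' (lt_of_le_of_lt (Real.sqrt_nonneg _) hx)).1 hx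
  have h0 := fun x hx => hφout x (hout x hx)
  have h0w := fun x hx => hwout x (hout x hx)
  have hsub : closedBall (0 : EuclideanSpace ℝ (Fin N)) ρ ⊆ ball 0 1 := closedBall_subset_ball hρ
  have hwb : ∀ x, w x ≠ 0 → x ∈ ball (0 : EuclideanSpace ℝ (Fin N)) 1 ∧ r < ‖x‖ ∧
      1 / 2 ≤ ‖x‖ ^ 2 := fun x hx => by
    have h1 : x ∈ closedBall 0 ρ := by by_contra h; exact hx (h0w x h)
    have h2 : 1 - 2 * ε ≤ ‖x‖ ^ 2 := by by_contra h; exact hx (hwin x (not_le.1 h))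
    refine ⟨hsub h1, lt_of_le_of_lt (le_max_left r 0) ?_, by linarith⟩
    exact lt_of_pow_lt_pow_left₀ 2 (norm_nonneg _) (by rw [← hr']; linarith)
  -- three integrations by parts
  have I1 := ibp hρ hφc hwc h0 h0w hφw (fun i x => x i) (fun i x => 1)
    (fun i => by fun_prop) (fun i => hint hρ continuousOn_const) (fun i x _ => by
      simpa using hld_coord i i x)
  have I2 := ibp hρ hφc hwc h0 h0w hφw G H hG (fun i => hint hρ (hH i)) hGH
  have I3 := ibp hρ hφc hwc h0 h0w hφw V D hV (fun i => hD i ρ hρ) hVD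
  have hgc : ContinuousOn (fun x => ∑ i, x i * G i x) (ball (0 : EuclideanSpace ℝ (Fin N)) 1) :=
    continuousOn_finsetSum _ fun i _ => ContinuousOn.mul (by fun_prop) (hG i)
  have hWc : ContinuousOn (fun x => ∑ i, x i * V i x) (ball (0 : EuclideanSpace ℝ (Fin N)) 1) :=
    continuousOn_finsetSum _ fun i _ => ContinuousOn.mul (by fun_prop) (hV i)
  have iw : Integrable w := by
    simpa using cut_integrable hwc h0w (hint hρ (continuousOn_const (c := (1:ℝ))))
  have iφ : Integrable φ := by
    simpa using cut_integrable hφc h0 (hint hρ (continuousOn_const (c := (1:ℝ))))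
  have iwx : Integrable fun x => w x * ∑ i, x i * x i :=
    cut_integrable hwc h0w (hint hρ (by fun_prop))
  have iwg := cut_integrable hwc h0w (hint hρ hgc)
  have iwW := cut_integrable hwc h0w (hint hρ hWc)
  have iφH := cut_integrable hφc h0 (hint hρ hHs)
  have nsq : ∀ x : EuclideanSpace ℝ (Fin N), ∑ i, x i * x i = ‖x‖ ^ 2 := fun x => by
    rw [EuclideanSpace.real_norm_sq_eq]; simp_rw [pow_two]
  -- bound on ∫ w
  have B1 : ∫ x, w x ≤ C := by
    have h1 : ∫ x, w x ≤ ∫ x, 2 * (w x * ∑ i, x i * x i) := by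
      refine integral_mono iw (iwx.const_mul 2) fun x => ?_
      by_cases hx : w x = 0
      · simp [hx]
      · have := (hwb x hx).2.2
        simp only [nsq]
        nlinarith [hw0 x]
    rw [integral_const_mul, ← I1] at h1
    have h2 : ∫ x, φ x * ∑ i : Fin N, (1:ℝ) = N * ∫ x, φ x := by
      rw [← integral_const_mul]; congr 1; ext x; simp; ring
    have h3 : ∫ x, φ x ≤ volume.real (ball (0 : EuclideanSpace ℝ (Fin N)) 1) := by
      rw [← integral_indicator_one measurableSet_ball]
      refine integral_mono iφ ?_ fun x => ?_
      · exact (integrable_indicator_iff measurableSet_ball).2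
          (integrableOn_const (measure_ball_lt_top.ne))
      · by_cases hx : x ∈ ball (0 : EuclideanSpace ℝ (Fin N)) 1
        · simp [indicator_of_mem hx, hφ1 x]
        · simp only [indicator_of_notMem hx]
          exact (h0 x fun h => hx (hsub h)).le
    rw [h2] at h1
    have h4 : (N:ℝ) * ∫ x, φ x ≤ N * volume.real (ball (0 : EuclideanSpace ℝ (Fin N)) 1) := by
      gcongr
    rw [hC]; linarith
  have B2 : c ≤ -∫ x, w x * ∑ i, x i * G i x := by
    rw [← I2, ← integral_neg, hc, ← integral_indicator measurableSet_closedBall]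
    refine integral_mono ?_ iφH.neg fun x => ?_
    · exact (integrable_indicator_iff measurableSet_closedBall).2 (hint (by norm_num) hHs).neg
    · by_cases hx : x ∈ closedBall (0 : EuclideanSpace ℝ (Fin N)) (1/2)
      · have : φ x = 1 := hφone x (by
          rw [mem_closedBall_zero_iff] at hx
          nlinarith [norm_nonneg x])
        simp only [indicator_of_mem hx, this, one_mul]; exact le_rfl
      · simp only [indicator_of_notMem hx]
        by_cases hx2 : x ∈ closedBall (0 : EuclideanSpace ℝ (Fin N)) ρ
        · have := hdG x (hsub hx2)
          nlinarith [hφ0 x]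
        · simp [h0 x hx2]
  have B3 : ∫ x, w x * ∑ i, x i * V i x ≤ 0 := by
    rw [← I3]
    refine integral_nonpos fun x => ?_
    by_cases hx2 : x ∈ closedBall (0 : EuclideanSpace ℝ (Fin N)) ρ
    · have := hdV x (hsub hx2)
      exact mul_nonpos_of_nonneg_of_nonpos (hφ0 x) this
    · simp [h0 x hx2]
  have B4 : -∫ x, w x * ∑ i, x i * G i x ≤
      ∫ x, (s * w x + s⁻¹ * (w x * ∑ i, x i * V i x)) := by
    rw [← integral_neg]
    refine integral_mono iwg.neg ((iw.const_mul s).add (iwW.const_mul s⁻¹)) fun x => ?_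
    by_cases hx : w x = 0
    · simp [hx]
    · obtain ⟨hxb, hxr, -⟩ := hwb x hx
      have h1 := hr x hxb hxr
      set g := ∑ i, x i * G i x
      set W := ∑ i, x i * V i x
      have h2 : -g ≤ s + s⁻¹ * W := by
        have : -(s * g) ≤ s ^ 2 + W := by nlinarith [sq_nonneg (g + s)]
        have h3 := mul_le_mul_of_nonneg_left this (inv_nonneg.2 hspos.le)
        have e1 : s⁻¹ * -(s * g) = -g := by field_simp
        have e2 : s⁻¹ * (s ^ 2 + W) = s + s⁻¹ * W := by field_simp
        linarith
      have := mul_le_mul_of_nonneg_left h2 (hw0 x)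
      show -(w x * g) ≤ s * w x + s⁻¹ * (w x * W)
      linarith
  rw [integral_add (iw.const_mul s) (iwW.const_mul s⁻¹), integral_const_mul,
    integral_const_mul] at B4
  have B5 : s⁻¹ * ∫ x, w x * ∑ i, x i * V i x ≤ 0 :=
    mul_nonpos_of_nonneg_of_nonpos (inv_nonneg.2 hspos.le) B3
  have B6 : s * ∫ x, w x ≤ s * C := by gcongr
  linarith

lemma div_algebra {N : ℕ} (x G : Fin N → ℝ) (H : Fin N → Fin N → ℝ) (hs : ∀ i j, H i j = H j i)
    (n U P Q R T β lam p q : ℝ) (hn : n = N) (hp : p + 1 ≠ 0) (hq : q + 1 ≠ 0)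
    (hT : β * ((∑ i, x i ^ 2) * T) = β * R)
    (hL : ∑ i, H i i = -(P + lam * R * Q)) :
    ∑ i, (((∑ j, ((if j = i then 1 else 0) * G j + x j * H j i)) * G i
        + (∑ j, x j * G j) * H i i)
      - 1 / 2 * (1 * (∑ j, G j * G j) + x i * ∑ j, (H j i * G j + G j * H j i))
      + 1 / (p + 1) * (1 * (P * U) + x i * ((p + 1) * P * G i))
      + lam / (q + 1) * ((R + β * (x i ^ 2 * T)) * (Q * U) + R * x i * ((q + 1) * Q * G i))
      + (n - 2) / 2 * (G i * G i + U * H i i)) =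
    (n / (p + 1) - (n - 2) / 2) * (P * U)
      + lam * ((n + β) / (q + 1) - (n - 2) / 2) * (R * Q * U) := by
  have a1 : ∀ i, ∑ j, ((if j = i then 1 else 0) * G j + x j * H j i) = G i + ∑ j, x j * H j i := by
    intro i; rw [Finset.sum_add_distrib]; simp
  have a2 : ∀ i, ∑ j, (H j i * G j + G j * H j i) = 2 * ∑ j, G j * H j i := by
    intro i; rw [Finset.mul_sum]; refine Finset.sum_congr rfl fun j _ => by ring
  simp_rw [a1, a2]
  have a3 : ∑ i, (∑ j, x j * H j i) * G i = ∑ i, x i * ∑ j, G j * H j i := by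
    simp_rw [Finset.sum_mul, Finset.mul_sum]
    rw [Finset.sum_comm]
    refine Finset.sum_congr rfl fun i _ => Finset.sum_congr rfl fun j _ => ?_
    rw [hs i j]; ring
  set S := ∑ j, G j * G j
  set g := ∑ j, x j * G j with hg
  set M := ∑ i, x i * ∑ j, G j * H j i
  have key : ∀ i, (((G i + ∑ j, x j * H j i) * G i + g * H i i)
      - 1 / 2 * (1 * S + x i * (2 * ∑ j, G j * H j i))
      + 1 / (p + 1) * (1 * (P * U) + x i * ((p + 1) * P * G i))
      + lam / (q + 1) * ((R + β * (x i ^ 2 * T)) * (Q * U) + R * x i * ((q + 1) * Q * G i))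
      + (n - 2) / 2 * (G i * G i + U * H i i)) =
      (G i * G i) * (1 + (n - 2) / 2) + (∑ j, x j * H j i) * G i + (H i i) * (g + (n - 2) / 2 * U)
      + (- 1 / 2 * S + 1 / (p + 1) * (P * U) + lam / (q + 1) * (R * (Q * U)))
      - x i * (∑ j, G j * H j i)
      + (x i * G i) * (P + lam * R * Q)
      + x i ^ 2 * (lam / (q + 1) * β * T * (Q * U)) := by
    intro i; field_simp; ring
  simp_rw [key]
  simp only [Finset.sum_add_distrib, Finset.sum_sub_distrib, ← Finset.sum_mul, a3, hL]
  simp only [Finset.sum_const, Finset.card_univ, Fintype.card_fin, nsmul_eq_mul, ← hn]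
  have e : (∑ i, x i ^ 2) * (lam / (q + 1) * β * T * (Q * U)) =
      lam / (q + 1) * (Q * U) * (β * R) := by rw [← hT]; ring
  rw [e]
  change S * _ + M + _ + _ - M + g * _ + _ = _
  field_simp
  ring

lemma sing_integrable {N : ℕ} {β : ℝ} (hβ : 0 ≤ β) (i : Fin N) (ρ : ℝ) (hρ : ρ < 1) :
    IntegrableOn (fun x : EuclideanSpace ℝ (Fin N) => x i ^ 2 * ‖x‖ ^ (β - 2))
      (closedBall 0 ρ) := by
  refine Measure.integrableOn_of_bounded (M := 1) (measure_closedBall_lt_top.ne) ?_ ?_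
  · refine Measurable.aestronglyMeasurable ?_
    exact Measurable.mul (by fun_prop) (measurable_norm.pow_const _)
  · refine (ae_restrict_iff' measurableSet_closedBall).2 (Eventually.of_forall fun x hx => ?_)
    rw [mem_closedBall_zero_iff] at hx
    by_cases h0 : x = 0
    · simp [h0]
    have hpos : 0 < ‖x‖ := norm_pos_iff.2 h0
    have h1 : x i ^ 2 ≤ ‖x‖ ^ 2 := by
      rw [EuclideanSpace.real_norm_sq_eq]
      exact Finset.single_le_sum (f := fun i => x i ^ 2) (fun j _ => sq_nonneg _)
        (Finset.mem_univ i)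
    rw [Real.norm_of_nonneg (by positivity)]
    calc x i ^ 2 * ‖x‖ ^ (β - 2) ≤ ‖x‖ ^ 2 * ‖x‖ ^ (β - 2) := by gcongr
      _ = ‖x‖ ^ β := by
        rw [← Real.rpow_natCast, ← Real.rpow_add hpos]; congr 1; push_cast; ring
      _ ≤ 1 := Real.rpow_le_one hpos.le (by linarith) hβ

lemma hld_rpow {E : Type*} [NormedAddCommGroup E] [NormedSpace ℝ E] {f : E → ℝ} {f' : ℝ}
    {x v : E} (hf : HasLineDerivAt ℝ f f' x v) (hx : 0 < f x) (p : ℝ) :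
    HasLineDerivAt ℝ (fun y => f y ^ (p + 1)) ((p + 1) * f x ^ p * f') x v := by
  have h := HasDerivAt.rpow_const (p := p + 1) hf (by left; simpa using hx.ne')
  refine HasDerivAt.congr_deriv h ?_
  simp; ring

theorem stmt_3 (N : ℕ) (hN : 3 ≤ N) (β q lam : ℝ) (hβ : 0 ≤ β)
    (hq : (2 * β + (N : ℝ) + 2) / ((N : ℝ) - 2) ≤ q) (hlam : 0 ≤ lam) :
    ¬ ∃ u : EuclideanSpace ℝ (Fin N) → ℝ,
      ContDiffOn ℝ 1 u (closedBall 0 1) ∧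
      ContDiffOn ℝ 2 u (ball 0 1) ∧
      (∀ x ∈ ball (0 : EuclideanSpace ℝ (Fin N)) 1, 0 < u x) ∧
      (∀ x ∈ sphere (0 : EuclideanSpace ℝ (Fin N)) 1, u x = 0) ∧
      (∀ x ∈ ball (0 : EuclideanSpace ℝ (Fin N)) 1,
        -laplacian u x = u x ^ (((N : ℝ) + 2) / ((N : ℝ) - 2)) + lam * ‖x‖ ^ β * u x ^ q) := by
  rintro ⟨u, hu1, hu2, hpos, hzero, hpde⟩
  have hN3 : (3:ℝ) ≤ N := by exact_mod_cast hN
  have hN2 : (0:ℝ) < N - 2 := by linarith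
  set p := ((N : ℝ) + 2) / ((N : ℝ) - 2) with hp
  have hp0 : 0 < p := by positivity
  have hq0 : 0 < q := lt_of_lt_of_le (by positivity) hq
  have hpN : (N : ℝ) / (p + 1) - ((N : ℝ) - 2) / 2 = 0 := by
    rw [hp]; field_simp; ring
  have hqN : ((N : ℝ) + β) / (q + 1) - ((N : ℝ) - 2) / 2 ≤ 0 := by
    rw [div_le_iff₀ hN2] at hq
    rw [sub_nonpos, div_le_iff₀ (by linarith)]
    nlinarith
  have huniq : UniqueDiffOn ℝ (closedBall (0 : EuclideanSpace ℝ (Fin N)) 1) :=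
    uniqueDiffOn_convex (convex_closedBall 0 1) (by
      rw [interior_closedBall _ one_ne_zero]; exact ⟨0, by simp⟩)
  have hbc : ball (0 : EuclideanSpace ℝ (Fin N)) 1 ⊆ closedBall 0 1 := ball_subset_closedBall
  let e : Fin N → EuclideanSpace ℝ (Fin N) := fun i => EuclideanSpace.single i (1:ℝ)
  let G : Fin N → EuclideanSpace ℝ (Fin N) → ℝ := fun i x =>
    fderivWithin ℝ u (closedBall 0 1) x (e i)
  let H : Fin N → Fin N → EuclideanSpace ℝ (Fin N) → ℝ := fun i j x =>
    fderiv ℝ (fun y => fderiv ℝ u y (e i)) x (e j)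
  have hGc : ∀ i, ContinuousOn (G i) (closedBall 0 1) := fun i =>
    (hu1.continuousOn_fderivWithin huniq le_rfl).clm_apply continuousOn_const
  have hGf : ∀ i, ∀ x ∈ ball (0 : EuclideanSpace ℝ (Fin N)) 1, G i x = fderiv ℝ u x (e i) := by
    intro i x hx
    simp only [G]
    rw [fderivWithin_of_mem_nhds (mem_of_superset (isOpen_ball.mem_nhds hx) hbc)]
  have hca : ∀ x ∈ ball (0 : EuclideanSpace ℝ (Fin N)) 1, ContDiffAt ℝ 2 u x := fun x hx =>
    hu2.contDiffAt (isOpen_ball.mem_nhds hx)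
  have hfd : ContDiffOn ℝ 1 (fderiv ℝ u) (ball 0 1) :=
    hu2.fderiv_of_isOpen isOpen_ball (by norm_num)
  have hfi : ∀ i, ContDiffOn ℝ 1 (fun y => fderiv ℝ u y (e i)) (ball 0 1) := fun i =>
    hfd.clm_apply contDiffOn_const
  have hHc : ∀ i j, ContinuousOn (H i j) (ball 0 1) := fun i j =>
    ((hfi i).continuousOn_fderiv_of_isOpen isOpen_ball le_rfl).clm_apply continuousOn_const
  have hul : ∀ i, ∀ x ∈ ball (0 : EuclideanSpace ℝ (Fin N)) 1,
      HasLineDerivAt ℝ u (G i x) x (e i) := fun i x hx => by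
    rw [hGf i x hx]
    exact ((hca x hx).differentiableAt (by norm_num)).hasFDerivAt.hasLineDerivAt _
  have hGl : ∀ i j, ∀ x ∈ ball (0 : EuclideanSpace ℝ (Fin N)) 1,
      HasLineDerivAt ℝ (G i) (H i j x) x (e j) := fun i j x hx => by
    have h1 : HasFDerivAt (fun y => fderiv ℝ u y (e i))
      (fderiv ℝ (fun y => fderiv ℝ u y (e i)) x) x :=
      (((hfi i).contDiffAt (isOpen_ball.mem_nhds hx)).differentiableAt (by norm_num)).hasFDerivAt
    refine (h1.hasLineDerivAt (e j)).congr_of_eventuallyEq ?_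
    filter_upwards [isOpen_ball.mem_nhds hx] with y hy using hGf i y hy
  have hHs : ∀ x ∈ ball (0 : EuclideanSpace ℝ (Fin N)) 1, ∀ i j, H i j x = H j i x := by
    intro x hx
    have hsym := (hca x hx).isSymmSndFDerivAt (by simp)
    have h2 : HasFDerivAt (fderiv ℝ u) (fderiv ℝ (fderiv ℝ u) x) x :=
      ((hfd.contDiffAt (isOpen_ball.mem_nhds hx)).differentiableAt (by norm_num)).hasFDerivAt
    have h3 : ∀ i j, H i j x = fderiv ℝ (fderiv ℝ u) x (e j) (e i) := fun i j => by
      have := h2.clm_apply (hasFDerivAt_const (e i) x)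
      simp only [H]
      rw [this.fderiv]
      simp
    intro i j
    rw [h3, h3, hsym.eq]
  have hlap : ∀ x ∈ ball (0 : EuclideanSpace ℝ (Fin N)) 1,
      ∑ i, H i i x = -(u x ^ p + lam * ‖x‖ ^ β * u x ^ q) := fun x hx => by
    rw [← hpde x hx, neg_neg]; rfl
  have hunn : ∀ x ∈ closedBall (0 : EuclideanSpace ℝ (Fin N)) 1, 0 ≤ u x := fun x hx => by
    rcases (mem_closedBall_zero_iff.1 hx).lt_or_eq with h | h
    · exact (hpos x (mem_ball_zero_iff.2 h)).le
    · exact (hzero x (mem_sphere_zero_iff_norm.2 h)).ge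
  have huc := hu1.continuousOn
  have hrc : ∀ a : ℝ, 0 ≤ a → ContinuousOn (fun x => u x ^ a) (closedBall 0 1) := fun a ha =>
    huc.rpow_const fun x _ => Or.inr ha
  have hnc : Continuous fun x : EuclideanSpace ℝ (Fin N) => ‖x‖ ^ β :=
    continuous_norm.rpow_const fun x => Or.inr hβ
  have hxc : ∀ i, Continuous fun x : EuclideanSpace ℝ (Fin N) => x i := fun i => by fun_prop
  let V : Fin N → EuclideanSpace ℝ (Fin N) → ℝ := fun i x =>
    (∑ j, x j * G j x) * G i x - 1 / 2 * (x i * ∑ j, G j x * G j x)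
      + 1 / (p + 1) * (x i * u x ^ (p + 1))
      + lam / (q + 1) * ((‖x‖ ^ β * x i) * u x ^ (q + 1))
      + ((N : ℝ) - 2) / 2 * (u x * G i x)
  let D : Fin N → EuclideanSpace ℝ (Fin N) → ℝ := fun i x =>
    (((∑ j, ((if j = i then 1 else 0) * G j x + x j * H j i x)) * G i x
        + (∑ j, x j * G j x) * H i i x)
      - 1 / 2 * (1 * (∑ j, G j x * G j x) + x i * ∑ j, (H j i x * G j x + G j x * H j i x))
      + 1 / (p + 1) * (1 * (u x ^ p * u x) + x i * ((p + 1) * u x ^ p * G i x))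
      + lam / (q + 1) * ((‖x‖ ^ β + β * (x i ^ 2 * ‖x‖ ^ (β - 2))) * (u x ^ q * u x)
        + ‖x‖ ^ β * x i * ((q + 1) * u x ^ q * G i x))
      + ((N : ℝ) - 2) / 2 * (G i x * G i x + u x * H i i x))
  have hgc : ContinuousOn (fun x => ∑ j, x j * G j x)
      (closedBall (0 : EuclideanSpace ℝ (Fin N)) 1) :=
    continuousOn_finsetSum _ fun i _ => (hxc i).continuousOn.mul (hGc i)
  have hSc : ContinuousOn (fun x => ∑ j, G j x * G j x)
      (closedBall (0 : EuclideanSpace ℝ (Fin N)) 1) :=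
    continuousOn_finsetSum _ fun i _ => (hGc i).mul (hGc i)
  have hVc : ∀ i, ContinuousOn (V i) (closedBall 0 1) := fun i =>
    ((((hgc.mul (hGc i)).sub (continuousOn_const.mul ((hxc i).continuousOn.mul hSc))).add
      (continuousOn_const.mul ((hxc i).continuousOn.mul (hrc _ (by linarith))))).add
      (continuousOn_const.mul ((hnc.mul (hxc i)).continuousOn.mul (hrc _ (by linarith))))).add
      (continuousOn_const.mul (huc.mul (hGc i)))
  refine abstract_contra V D G (fun i => H i i) (fun i => (hVc i).mono hbc) ?_ ?_
    (fun i => (hGc i).mono hbc) (fun i => hHc i i) (fun i x hx => hGl i i x hx) ?_ ?_ ?_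
  · intro i ρ hρ
    have hb : closedBall (0 : EuclideanSpace ℝ (Fin N)) ρ ⊆ ball 0 1 := closedBall_subset_ball hρ
    have hb' := hb.trans hbc
    have hcomp := isCompact_closedBall (0 : EuclideanSpace ℝ (Fin N)) ρ
    have c1 : ContinuousOn (fun x =>
      (((∑ j, ((if j = i then 1 else 0) * G j x + x j * H j i x)) * G i x
        + (∑ j, x j * G j x) * H i i x)
      - 1 / 2 * (1 * (∑ j, G j x * G j x) + x i * ∑ j, (H j i x * G j x + G j x * H j i x))
      + 1 / (p + 1) * (1 * (u x ^ p * u x) + x i * ((p + 1) * u x ^ p * G i x))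
      + lam / (q + 1) * ((‖x‖ ^ β) * (u x ^ q * u x)
        + ‖x‖ ^ β * x i * ((q + 1) * u x ^ q * G i x))
      + ((N : ℝ) - 2) / 2 * (G i x * G i x + u x * H i i x)))
      (closedBall (0 : EuclideanSpace ℝ (Fin N)) ρ) := by
      have g1 := fun i => (hGc i).mono hb'
      have g2 := fun i j => (hHc i j).mono hb
      have g3 := huc.mono hb'
      have g4 := (hrc p hp0.le).mono hb'
      have g5 := (hrc q hq0.le).mono hb'
      have g6 := hnc.continuousOn (s := closedBall (0 : EuclideanSpace ℝ (Fin N)) ρ)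
      fun_prop
    have c2 : IntegrableOn (fun x => (lam / (q + 1) * β * (u x ^ q * u x)) *
        (x i ^ 2 * ‖x‖ ^ (β - 2))) (closedBall (0 : EuclideanSpace ℝ (Fin N)) ρ) := by
      refine (sing_integrable hβ i ρ hρ).continuousOn_mul ?_ hcomp
      exact continuousOn_const.mul (((hrc q hq0.le).mono hb').mul (huc.mono hb'))
    refine ((c1.integrableOn_compact hcomp).add c2).congr (Eventually.of_forall fun x => ?_)
    simp only [D, Pi.add_apply]
    ring
  · intro i x hx
    have hux := hpos x hx
    have t1 := hld_mul (hld_sum Finset.univ fun j _ => hld_mul (hld_coord i j x) (hGl j i x hx))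
      (hGl i i x hx)
    have t2 := hld_const_mul (1 / 2) (hld_mul (hld_coord i i x)
      (hld_sum Finset.univ fun j _ => hld_mul (hGl j i x hx) (hGl j i x hx)))
    have t3 := hld_const_mul (1 / (p + 1)) (hld_mul (hld_coord i i x)
      (hld_rpow (hul i x hx) hux p))
    have t4 := hld_const_mul (lam / (q + 1)) (hld_mul (hld_pow hβ i x)
      (hld_rpow (hul i x hx) hux q))
    have t5 := hld_const_mul (((N:ℝ) - 2) / 2) (hld_mul (hul i x hx) (hGl i i x hx))
    have t := hld_add (hld_add (hld_add (hld_sub t1 t2) t3) t4) t5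
    refine HasDerivAt.congr_deriv t ?_
    simp only [D, if_true, Real.rpow_add_one hux.ne']
  · intro x hx
    have hux := hpos x hx
    have h1 : β * ((∑ i, x i ^ 2) * ‖x‖ ^ (β - 2)) = β * ‖x‖ ^ β := by
      rw [← EuclideanSpace.real_norm_sq_eq]
      by_cases h0 : x = 0
      · subst h0
        by_cases hb : β = 0
        · simp [hb]
        · simp [Real.zero_rpow hb]
      · rw [← Real.rpow_natCast, ← Real.rpow_add (norm_pos_iff.2 h0)]
        congr 2; push_cast; ring
    have := div_algebra (fun i => x i) (fun i => G i x) (fun i j => H i j x) (hHs x hx)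
      (N : ℝ) (u x) (u x ^ p) (u x ^ q) (‖x‖ ^ β) (‖x‖ ^ (β - 2)) β lam p q rfl
      (by linarith) (by linarith) h1 (hlap x hx)
    refine this.le.trans ?_
    rw [hpN, zero_mul, zero_add]
    exact mul_nonpos_of_nonpos_of_nonneg (mul_nonpos_of_nonneg_of_nonpos hlam hqN) (by positivity)
  · intro x hx
    have hux := hpos x hx
    rw [hlap x hx]
    have : 0 < u x ^ p := by positivity
    have : 0 ≤ lam * ‖x‖ ^ β * u x ^ q := by positivity
    linarith
  · refine near_boundary (Z := fun x => ∑ i, x i * V i x - (∑ i, x i * G i x) ^ 2 / 2) ?_ ?_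
    · exact (continuousOn_finsetSum _ fun i _ => (hxc i).continuousOn.mul (hVc i)).sub
        ((hgc.pow 2).div_const 2)
    · intro x hx
      have hx1 : ‖x‖ = 1 := mem_sphere_zero_iff_norm.1 hx
      have hd : HasFDerivWithinAt u (fderivWithin ℝ u (closedBall 0 1) x) (closedBall 0 1) x :=
        (hu1.differentiableOn (by norm_num) x (sphere_subset_closedBall hx)).hasFDerivWithinAt
      have hb : ∑ i, G i x ^ 2 = (∑ i, x i * G i x) ^ 2 := boundary_id hx1 hzero hd
      have hxs : ∑ i, x i ^ 2 = 1 := by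
        rw [← EuclideanSpace.real_norm_sq_eq, hx1]; norm_num
      have hV0 : ∀ i, x i * V i x = (x i * G i x) * (∑ j, x j * G j x)
          - x i ^ 2 * (1 / 2 * ∑ i, G i x ^ 2) := fun i => by
        have a1 : u x ^ (p + 1) = 0 := by
          rw [hzero x hx, Real.zero_rpow (by linarith)]
        have a2 : u x ^ (q + 1) = 0 := by
          rw [hzero x hx, Real.zero_rpow (by linarith)]
        simp only [V, a1, a2]
        rw [hzero x hx]
        simp only [pow_two]
        ring
      simp only [hV0, Finset.sum_sub_distrib, ← Finset.sum_mul, hxs, hb]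
      ring
end

section
/- Let N ≥ 3 and let B be the open unit ball in ℝ^N. Suppose g : ℝ^N → ℝ satisfies: (g1) g is α-Hölder continuous on the closed unit ball for some α ∈ (0,1], g(x) ≥ −1 on the closed unit ball, and g is radial; (g2) g(0) = 0; (g3) there exist constants γ ∈ (0, N−2), δ ∈ (0,1] and C > 0 such that g(x) ≥ C|x|^γ for all 0 < |x| < δ. Then there exists a radial function u, continuous on the closed unit ball and twice continuously differentiable on B, with u > 0 in B, u = 0 on the unit sphere, satisfying −Δu(x) = (1 + g(x))·u(x)^((N+2)/(N−2)) for all x ∈ B. -/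
open scoped NNReal
open MeasureTheory Filter Set Metric

open Topology

theorem weak_seq {H : Type*} [NormedAddCommGroup H] [InnerProductSpace ℝ H] [CompleteSpace H]
    [TopologicalSpace.SeparableSpace H] (f : ℕ → H) (hf : ∀ n, ‖f n‖ ≤ 1) :
    ∃ g : H, ‖g‖ ≤ 1 ∧ ∃ σ : ℕ → ℕ, StrictMono σ ∧
      ∀ v : H, Tendsto (fun n => inner ℝ (f (σ n)) v) atTop (𝓝 (inner ℝ g v)) := by
  have hc := WeakDual.isSeqCompact_closedBall (𝕜 := ℝ) (E := H) 0 1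
  have h1 : ∀ n, StrongDual.toWeakDual (InnerProductSpace.toDual ℝ H (f n)) ∈
      (WeakDual.toStrongDual ⁻¹' closedBall (0 : StrongDual ℝ H) 1) := by
    intro n
    simp [hf n]
  obtain ⟨g, hg, σ, hσ, ht⟩ := hc h1
  refine ⟨(InnerProductSpace.toDual ℝ H).symm (WeakDual.toStrongDual g), ?_, σ, hσ, ?_⟩
  · simpa using hg
  · intro v
    have := ((WeakDual.eval_continuous v).tendsto g).comp ht
    simpa [Function.comp_def] using this

section
variable {H : Type*} [NormedAddCommGroup H] [InnerProductSpace ℝ H]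

noncomputable def Jfun (κ : ℝ → H) (k : ℝ → ℝ) (q T : ℝ) (f : H) : ℝ :=
  ∫ t in (0:ℝ)..T, k t * (max (inner ℝ f (κ t)) 0) ^ q

theorem Jint_cont {κ : ℝ → H} (hκ : Continuous κ) {k : ℝ → ℝ} (hk : Continuous k) {q : ℝ}
    (hq : 0 ≤ q) (f : H) : Continuous (fun t => k t * (max (inner ℝ f (κ t)) 0) ^ q) := by
  refine hk.mul ?_
  exact (Real.continuous_rpow_const hq).comp ((continuous_const.inner hκ).max continuous_const)

theorem pos_bound {κ : ℝ → H} {D : ℝ} (hD : ∀ t, ‖κ t‖ ≤ D) {f : H} (hf : ‖f‖ ≤ 1) (t : ℝ) :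
    max (inner ℝ f (κ t)) 0 ≤ D := by
  have h1 := real_inner_le_norm f (κ t)
  have h2 := hD t
  have h3 := norm_nonneg (κ t)
  have h4 := norm_nonneg f
  refine max_le ?_ (h3.trans h2)
  nlinarith

theorem J_tendsto {κ : ℝ → H} (hκ : Continuous κ) {D : ℝ} (hD : ∀ t, ‖κ t‖ ≤ D)
    {k : ℝ → ℝ} (hk : Continuous k) {q : ℝ}
    (hq : 0 < q) (T : ℝ) (f : ℕ → H) (hf : ∀ n, ‖f n‖ ≤ 1) (g : H)
    (hfg : ∀ v : H, Tendsto (fun n => inner ℝ (f n) v) atTop (𝓝 (inner ℝ g v))) :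
    Tendsto (fun n => Jfun κ k q T (f n)) atTop (𝓝 (Jfun κ k q T g)) := by
  unfold Jfun
  apply intervalIntegral.tendsto_integral_filter_of_dominated_convergence
    (fun t => |k t| * D ^ q)
  · exact Eventually.of_forall fun n => (Jint_cont hκ hk hq.le _).aestronglyMeasurable
  · refine Eventually.of_forall fun n => Eventually.of_forall fun t _ => ?_
    rw [norm_mul, Real.norm_eq_abs, Real.norm_eq_abs]
    gcongr
    rw [abs_of_nonneg (by positivity)]
    gcongr
    exact pos_bound hD (hf n) t
  · exact (hk.abs.mul continuous_const).intervalIntegrable _ _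
  · refine Eventually.of_forall fun t _ => ?_
    refine Tendsto.const_mul _ ?_
    refine ((Real.continuous_rpow_const hq.le).tendsto _).comp ?_
    exact (hfg (κ t)).max tendsto_const_nhds

theorem J_bdd {κ : ℝ → H} (hκ : Continuous κ) {D : ℝ} (hD : ∀ t, ‖κ t‖ ≤ D)
    {k : ℝ → ℝ} (hk : Continuous k) {q : ℝ} (hq : 0 < q) {T : ℝ} (hT : 0 ≤ T)
    (f : H) (hf : ‖f‖ ≤ 1) : Jfun κ k q T f ≤ ∫ t in (0:ℝ)..T, |k t| * D ^ q := by
  unfold Jfun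
  apply intervalIntegral.integral_mono_on hT
  · exact (Jint_cont hκ hk hq.le _).intervalIntegrable _ _
  · exact (hk.abs.mul continuous_const).intervalIntegrable _ _
  · intro t _
    refine mul_le_mul (le_abs_self _) ?_ (by positivity) (abs_nonneg _)
    gcongr
    exact pos_bound hD hf t

theorem exists_max [CompleteSpace H] [TopologicalSpace.SeparableSpace H]
    {κ : ℝ → H} (hκ : Continuous κ) {D : ℝ} (hD : ∀ t, ‖κ t‖ ≤ D)
    {k : ℝ → ℝ} (hk : Continuous k) {q : ℝ} (hq : 0 < q) {T : ℝ} (hT : 0 ≤ T) :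
    ∃ f : H, ‖f‖ ≤ 1 ∧ ∀ f' : H, ‖f'‖ ≤ 1 → Jfun κ k q T f' ≤ Jfun κ k q T f := by
  set S := (Jfun κ k q T) '' (closedBall (0 : H) 1) with hS
  have hne : S.Nonempty := ⟨_, 0, by simp, rfl⟩
  have hbd : BddAbove S := by
    refine ⟨∫ t in (0:ℝ)..T, |k t| * D ^ q, ?_⟩
    rintro _ ⟨f, hf, rfl⟩
    exact J_bdd hκ hD hk hq hT f (by simpa using hf)
  obtain ⟨u, -, hu, huS⟩ := exists_seq_tendsto_sSup hne hbd
  choose f hf hfu using huS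
  obtain ⟨g, hg, σ, hσ, hw⟩ := weak_seq f (fun n => by simpa using hf n)
  refine ⟨g, hg, fun f' hf' => ?_⟩
  have h1 := J_tendsto hκ hD hk hq T (fun n => f (σ n)) (fun n => by simpa using hf (σ n)) g hw
  have h2 : Tendsto (fun n => Jfun κ k q T (f (σ n))) atTop (𝓝 (sSup S)) := by
    simp only [hfu]
    exact hu.comp hσ.tendsto_atTop
  rw [tendsto_nhds_unique h1 h2]
  exact le_csSup hbd ⟨f', by simpa using hf', rfl⟩

theorem young_pow {p x y : ℝ} (hp : 0 < p) (hx : 0 ≤ x) (hy : 0 ≤ y) :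
    x ^ p * y ≤ p / (p + 1) * x ^ (p + 1) + 1 / (p + 1) * y ^ (p + 1) := by
  have hc : ((p + 1) / p).HolderConjugate (p + 1) := by
    rw [Real.holderConjugate_iff]
    constructor
    · rw [lt_div_iff₀ hp]; linarith
    · field_simp
  have := Real.young_inequality_of_nonneg (a := x ^ p) (b := y) (by positivity) hy hc
  rw [← Real.rpow_mul hx] at this
  have h2 : p * ((p + 1) / p) = p + 1 := by field_simp
  rw [h2] at this
  calc _ ≤ _ := this
    _ = _ := by field_simp

theorem EL_max [CompleteSpace H]
    {κ : ℝ → H} (hκ : Continuous κ)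
    {k : ℝ → ℝ} (hk : Continuous k) (hk0 : ∀ t, 0 ≤ k t) {p : ℝ} (hp : 0 < p) {T : ℝ} (hT : 0 ≤ T)
    {f : H} (hf : ‖f‖ ≤ 1)
    (hmax : ∀ f' : H, ‖f'‖ ≤ 1 → Jfun κ k (p + 1) T f' ≤ Jfun κ k (p + 1) T f) :
    (∫ t in (0:ℝ)..T, (k t * (max (inner ℝ f (κ t)) 0) ^ p) • κ t) = Jfun κ k (p + 1) T f • f := by
  set ψ : ℝ → ℝ := fun t => k t * (max (inner ℝ f (κ t)) 0) ^ p with hψ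
  have hψc : Continuous ψ := Jint_cont hκ hk hp.le f
  set F := ∫ t in (0:ℝ)..T, ψ t • κ t with hF
  set M := Jfun κ k (p + 1) T f with hM
  have hint : IntervalIntegrable (fun t => ψ t • κ t) volume 0 T :=
    (hψc.smul hκ).intervalIntegrable _ _
  have hin : ∀ v : H, inner ℝ v F = ∫ t in (0:ℝ)..T, ψ t * inner ℝ v (κ t) := by
    intro v
    have := (innerSL ℝ v).intervalIntegral_comp_comm hint
    simp only [innerSL_apply_apply, inner_smul_right] at this
    rw [this]
  have hfF : inner ℝ f F = M := by
    rw [hin, hM, Jfun]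
    congr 1
    ext t
    simp only [hψ]
    rcases le_total (inner ℝ f (κ t)) 0 with h | h
    · rw [max_eq_right h, Real.zero_rpow hp.ne', Real.zero_rpow (by linarith)]; ring
    · rw [max_eq_left h, Real.rpow_add_one' h (by linarith)]; ring
  have hle : ∀ f' : H, ‖f'‖ ≤ 1 → inner ℝ f' F ≤ M := by
    intro f' hf'
    have hc1 := Jint_cont hκ hk (q := p + 1) (by linarith) f
    have hc2 := Jint_cont hκ hk (q := p + 1) (by linarith) f'
    calc inner ℝ f' F = ∫ t in (0:ℝ)..T, ψ t * inner ℝ f' (κ t) := hin f'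
      _ ≤ ∫ t in (0:ℝ)..T, (p / (p + 1) * (k t * (max (inner ℝ f (κ t)) 0) ^ (p + 1)) +
            1 / (p + 1) * (k t * (max (inner ℝ f' (κ t)) 0) ^ (p + 1))) := by
          apply intervalIntegral.integral_mono_on hT
          · exact (hψc.mul (continuous_const.inner hκ)).intervalIntegrable _ _
          · exact ((continuous_const.mul hc1).add (continuous_const.mul hc2)).intervalIntegrable _ _
          · intro t _
            have h1 := young_pow hp (le_max_right (inner ℝ f (κ t)) 0)
              (le_max_right (inner ℝ f' (κ t)) 0)
            have h2 : ψ t * inner ℝ f' (κ t) ≤ ψ t * max (inner ℝ f' (κ t)) 0 := by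
              apply mul_le_mul_of_nonneg_left (le_max_left _ _)
              exact mul_nonneg (hk0 t) (by positivity)
            refine h2.trans ?_
            simp only [hψ]
            have h3 := mul_le_mul_of_nonneg_left h1 (hk0 t)
            linarith
      _ = p / (p + 1) * M + 1 / (p + 1) * Jfun κ k (p + 1) T f' := by
          rw [intervalIntegral.integral_add, intervalIntegral.integral_const_mul,
            intervalIntegral.integral_const_mul]
          · rfl
          · exact (continuous_const.mul hc1).intervalIntegrable _ _
          · exact (continuous_const.mul hc2).intervalIntegrable _ _
      _ ≤ p / (p + 1) * M + 1 / (p + 1) * M := by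
          gcongr
          exact hmax f' hf'
      _ = M := by field_simp
  have hM0 : 0 ≤ M := by
    rw [hM, Jfun]
    apply intervalIntegral.integral_nonneg hT
    intro t _
    exact mul_nonneg (hk0 t) (by positivity)
  have hFM : ‖F‖ ≤ M := by
    by_cases h0 : F = 0
    · simpa [h0] using hM0
    have hn : 0 < ‖F‖ := norm_pos_iff.mpr h0
    have := hle (‖F‖⁻¹ • F) (by rw [norm_smul]; simp [hn.ne'])
    rw [real_inner_smul_left, real_inner_self_eq_norm_sq] at this
    calc ‖F‖ = ‖F‖⁻¹ * ‖F‖ ^ 2 := by field_simp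
      _ ≤ M := this
  have hz : ‖F - M • f‖ ^ 2 ≤ 0 := by
    rw [norm_sub_sq_real, real_inner_smul_right, real_inner_comm, hfF, norm_smul, Real.norm_eq_abs,
      abs_of_nonneg hM0]
    have h1 : ‖F‖ ^ 2 ≤ M ^ 2 := by gcongr
    have h2 : (M * ‖f‖) ^ 2 ≤ M ^ 2 := by
      have : M * ‖f‖ ≤ M := by nlinarith [norm_nonneg f]
      gcongr
    nlinarith
  have : ‖F - M • f‖ = 0 := by
    have := norm_nonneg (F - M • f)
    nlinarith
  exact sub_eq_zero.mp (norm_eq_zero.mp this)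

end

noncomputable def Gk (a t τ : ℝ) : ℝ :=
  (Real.exp (-(a * |t - τ|)) - Real.exp (-(a * (t + τ)))) / (2 * a)

noncomputable def PhiC (a : ℝ) (ψ : ℝ → ℝ) (C t : ℝ) : ℝ :=
  (Real.exp (-(a * t)) * (∫ τ in (0:ℝ)..t, Real.exp (a * τ) * ψ τ)
    + Real.exp (a * t) * (C - ∫ τ in (0:ℝ)..t, Real.exp (-(a * τ)) * ψ τ)
    - Real.exp (-(a * t)) * C) / (2 * a)

noncomputable def dPhiC (a : ℝ) (ψ : ℝ → ℝ) (C t : ℝ) : ℝ :=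
  (-Real.exp (-(a * t)) * (∫ τ in (0:ℝ)..t, Real.exp (a * τ) * ψ τ)
    + Real.exp (a * t) * (C - ∫ τ in (0:ℝ)..t, Real.exp (-(a * τ)) * ψ τ)
    + Real.exp (-(a * t)) * C) / 2

theorem hasDerivAt_expm (a t : ℝ) :
    HasDerivAt (fun t => Real.exp (-(a * t))) (-a * Real.exp (-(a * t))) t := by
  have h0 : HasDerivAt (fun t : ℝ => -(a * t)) (-(a * 1)) t := ((hasDerivAt_id t).const_mul a).neg
  convert h0.exp using 1
  ring

theorem hasDerivAt_expp (a t : ℝ) :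
    HasDerivAt (fun t => Real.exp (a * t)) (a * Real.exp (a * t)) t := by
  have := (((hasDerivAt_id t).const_mul a)).exp
  simp only [id, mul_one] at this
  convert this using 1
  ring

theorem ftc_cont {h : ℝ → ℝ} (hh : Continuous h) (c t : ℝ) :
    HasDerivAt (fun t => ∫ τ in c..t, h τ) (h t) t :=
  intervalIntegral.integral_hasDerivAt_right (hh.intervalIntegrable _ _)
    (hh.stronglyMeasurableAtFilter _ _) hh.continuousAt

theorem hasDerivAt_PhiC {a : ℝ} (ha : 0 < a) {ψ : ℝ → ℝ} (hψ : Continuous ψ) (C t : ℝ) :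
    HasDerivAt (PhiC a ψ C) (dPhiC a ψ C t) t := by
  have c1 : Continuous fun τ => Real.exp (a * τ) * ψ τ := by fun_prop
  have c2 : Continuous fun τ => Real.exp (-(a * τ)) * ψ τ := by fun_prop
  have h1 := (hasDerivAt_expm a t).mul (ftc_cont c1 0 t)
  have h2 := (hasDerivAt_expp a t).mul ((ftc_cont c2 0 t).const_sub C)
  have h3 := (hasDerivAt_expm a t).mul_const C
  have h4 := ((h1.add h2).sub h3).div_const (2 * a)
  refine HasDerivAt.congr_deriv (h4.congr_of_eventuallyEq ?_) ?_
  · exact Eventually.of_forall fun s => rfl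
  · have e1 : Real.exp (-(a * t)) * Real.exp (a * t) = 1 := by rw [← Real.exp_add]; simp
    unfold dPhiC
    field_simp
    ring

theorem hasDerivAt_dPhiC {a : ℝ} (ha : 0 < a) {ψ : ℝ → ℝ} (hψ : Continuous ψ) (C t : ℝ) :
    HasDerivAt (dPhiC a ψ C) (a ^ 2 * PhiC a ψ C t - ψ t) t := by
  have c1 : Continuous fun τ => Real.exp (a * τ) * ψ τ := by fun_prop
  have c2 : Continuous fun τ => Real.exp (-(a * τ)) * ψ τ := by fun_prop
  have h1 := (hasDerivAt_expm a t).neg.mul (ftc_cont c1 0 t)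
  have h2 := (hasDerivAt_expp a t).mul ((ftc_cont c2 0 t).const_sub C)
  have h3 := (hasDerivAt_expm a t).mul_const C
  have h4 := ((h1.add h2).add h3).div_const 2
  refine HasDerivAt.congr_deriv (h4.congr_of_eventuallyEq ?_) ?_
  · exact Eventually.of_forall fun s => rfl
  · have e1 : Real.exp (-(a * t)) * Real.exp (a * t) = 1 := by rw [← Real.exp_add]; simp
    unfold PhiC
    field_simp
    simp only [Pi.neg_apply]
    linear_combination (-2 * ψ t) * e1

theorem Gk_eq_left {a t τ : ℝ} (h : τ ≤ t) : Gk a t τ =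
    (Real.exp (-(a * t)) * Real.exp (a * τ) - Real.exp (-(a * t)) * Real.exp (-(a * τ))) / (2 * a) := by
  unfold Gk
  rw [abs_of_nonneg (by linarith), ← Real.exp_add, ← Real.exp_add]
  ring_nf

theorem Gk_eq_right {a t τ : ℝ} (h : t ≤ τ) : Gk a t τ =
    (Real.exp (a * t) * Real.exp (-(a * τ)) - Real.exp (-(a * t)) * Real.exp (-(a * τ))) / (2 * a) := by
  unfold Gk
  rw [abs_of_nonpos (by linarith), ← Real.exp_add, ← Real.exp_add]
  ring_nf

theorem Gk_cont (a t : ℝ) : Continuous (Gk a t) := by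
  unfold Gk
  fun_prop

theorem Gk_int_left {a : ℝ} {ψ : ℝ → ℝ} (hψ : Continuous ψ) {t : ℝ} (ht : 0 ≤ t) :
    (∫ τ in (0:ℝ)..t, Gk a t τ * ψ τ) =
    (Real.exp (-(a * t)) * (∫ τ in (0:ℝ)..t, Real.exp (a * τ) * ψ τ)
      - Real.exp (-(a * t)) * (∫ τ in (0:ℝ)..t, Real.exp (-(a * τ)) * ψ τ)) / (2 * a) := by
  have c1 : Continuous fun τ => Real.exp (a * τ) * ψ τ := by fun_prop
  have c2 : Continuous fun τ => Real.exp (-(a * τ)) * ψ τ := by fun_prop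
  rw [← intervalIntegral.integral_const_mul, ← intervalIntegral.integral_const_mul,
    ← intervalIntegral.integral_sub
      (Continuous.intervalIntegrable (by fun_prop) _ _)
      (Continuous.intervalIntegrable (by fun_prop) _ _), ← intervalIntegral.integral_div]
  apply intervalIntegral.integral_congr
  intro τ hτ
  rw [uIcc_of_le ht] at hτ
  simp only
  rw [Gk_eq_left hτ.2]
  ring

theorem Gk_int_finite {a : ℝ} {ψ : ℝ → ℝ} (hψ : Continuous ψ) {t T : ℝ} (ht : 0 ≤ t)
    (htT : t ≤ T) :
    (∫ τ in (0:ℝ)..T, Gk a t τ * ψ τ) =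
      PhiC a ψ (∫ τ in (0:ℝ)..T, Real.exp (-(a * τ)) * ψ τ) t := by
  have c2 : Continuous fun τ => Real.exp (-(a * τ)) * ψ τ := by fun_prop
  have c3 : Continuous fun τ => Gk a t τ * ψ τ := (Gk_cont a t).mul hψ
  have hr : (∫ τ in t..T, Gk a t τ * ψ τ) =
      (Real.exp (a * t) - Real.exp (-(a * t))) / (2 * a) *
        ∫ τ in t..T, Real.exp (-(a * τ)) * ψ τ := by
    rw [← intervalIntegral.integral_const_mul]
    apply intervalIntegral.integral_congr
    intro τ hτ
    rw [uIcc_of_le htT] at hτ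
    simp only
    rw [Gk_eq_right hτ.1]
    ring
  rw [← intervalIntegral.integral_add_adjacent_intervals (c3.intervalIntegrable 0 t)
    (c3.intervalIntegrable t T), Gk_int_left hψ ht, hr,
    ← intervalIntegral.integral_add_adjacent_intervals (c2.intervalIntegrable 0 t)
    (c2.intervalIntegrable t T)]
  unfold PhiC
  ring

theorem exp_int {a : ℝ} (ha : 0 < a) {ψ : ℝ → ℝ} (hψ : Continuous ψ) {D : ℝ}
    (hD : ∀ t, |ψ t| ≤ D) (c : ℝ) :
    IntegrableOn (fun τ => Real.exp (-(a * τ)) * ψ τ) (Ioi c) := by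
  have h1 : IntegrableOn (fun τ => Real.exp (-a * τ) * D) (Ioi c) :=
    (integrableOn_exp_mul_Ioi (by linarith) c).mul_const D
  refine h1.mono' (by fun_prop) (Eventually.of_forall fun τ => ?_)
  rw [norm_mul, Real.norm_eq_abs, Real.norm_eq_abs, abs_of_pos (Real.exp_pos _), neg_mul]
  gcongr
  exact hD τ

theorem Gk_int_infinite {a : ℝ} (ha : 0 < a) {ψ : ℝ → ℝ} (hψ : Continuous ψ) {D : ℝ}
    (hD : ∀ t, |ψ t| ≤ D) {t : ℝ} (ht : 0 ≤ t) :
    (∫ τ in Ioi (0:ℝ), Gk a t τ * ψ τ) =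
      PhiC a ψ (∫ τ in Ioi (0:ℝ), Real.exp (-(a * τ)) * ψ τ) t := by
  have c2 : Continuous fun τ => Real.exp (-(a * τ)) * ψ τ := by fun_prop
  have c3 : Continuous fun τ => Gk a t τ * ψ τ := (Gk_cont a t).mul hψ
  have hi := exp_int ha hψ hD t
  have he : EqOn (fun τ => Gk a t τ * ψ τ) (fun τ => (Real.exp (a * t) - Real.exp (-(a * t))) / (2 * a) *
      (Real.exp (-(a * τ)) * ψ τ)) (Ioi t) := by
    intro τ hτ
    simp only
    rw [Gk_eq_right (le_of_lt hτ)]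
    ring
  have hr : (∫ τ in Ioi t, Gk a t τ * ψ τ) =
      (Real.exp (a * t) - Real.exp (-(a * t))) / (2 * a) *
        ∫ τ in Ioi t, Real.exp (-(a * τ)) * ψ τ := by
    rw [← integral_const_mul]
    exact setIntegral_congr_fun measurableSet_Ioi he
  have hi2 : IntegrableOn (fun τ => Gk a t τ * ψ τ) (Ioi t) :=
    (integrableOn_congr_fun he measurableSet_Ioi).mpr (hi.const_mul _)
  have hs : ∀ h : ℝ → ℝ, Continuous h → IntegrableOn h (Ioi t) →
      (∫ τ in Ioi (0:ℝ), h τ) = (∫ τ in (0:ℝ)..t, h τ) + ∫ τ in Ioi t, h τ := by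
    intro h hc hh
    rw [intervalIntegral.integral_of_le ht, ← setIntegral_union (Ioc_disjoint_Ioi le_rfl)
      measurableSet_Ioi _ hh, Ioc_union_Ioi_eq_Ioi ht]
    exact (hc.integrableOn_Icc).mono_set Ioc_subset_Icc_self
  rw [hs _ c3 hi2, hs _ c2 hi, Gk_int_left hψ ht, hr]
  unfold PhiC
  ring

theorem PhiC_zero {a : ℝ} (ψ : ℝ → ℝ) (C : ℝ) : PhiC a ψ C 0 = 0 := by
  simp [PhiC]

theorem energy_id {a : ℝ} (ha : 0 < a) {ψ : ℝ → ℝ} (hψ : Continuous ψ) (T : ℝ) {C : ℝ}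
    (hC : C = ∫ τ in (0:ℝ)..T, Real.exp (-(a * τ)) * ψ τ) :
    (∫ t in (0:ℝ)..T, ψ t * PhiC a ψ C t) =
    (∫ t in (0:ℝ)..T, ((dPhiC a ψ C t) ^ 2 + a ^ 2 * (PhiC a ψ C t) ^ 2)) + a * (PhiC a ψ C T) ^ 2 := by
  have d1 := hasDerivAt_PhiC ha hψ C
  have d2 := hasDerivAt_dPhiC ha hψ C
  have c1 : Continuous (PhiC a ψ C) := continuous_iff_continuousAt.mpr fun t => (d1 t).continuousAt
  have c2 : Continuous (dPhiC a ψ C) := continuous_iff_continuousAt.mpr fun t => (d2 t).continuousAt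
  have hT : dPhiC a ψ C T = - a * PhiC a ψ C T := by
    unfold dPhiC PhiC
    rw [← hC]
    field_simp
    ring
  have key := intervalIntegral.integral_eq_sub_of_hasDerivAt (a := 0) (b := T)
    (fun t _ => (d1 t).mul (d2 t)) (by
      apply Continuous.intervalIntegrable
      fun_prop)
  have e : (∫ t in (0:ℝ)..T, (dPhiC a ψ C t * dPhiC a ψ C t + PhiC a ψ C t * (a ^ 2 * PhiC a ψ C t - ψ t)))
      = (∫ t in (0:ℝ)..T, ((dPhiC a ψ C t) ^ 2 + a ^ 2 * (PhiC a ψ C t) ^ 2)) -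
        ∫ t in (0:ℝ)..T, ψ t * PhiC a ψ C t := by
    rw [← intervalIntegral.integral_sub]
    · congr 1; ext t; ring
    · apply Continuous.intervalIntegrable
      fun_prop
    · apply Continuous.intervalIntegrable
      fun_prop
  rw [e] at key
  simp only [Pi.mul_apply, PhiC_zero, hT] at key
  linarith

noncomputable def wS (a y : ℝ) : ℝ := y * Real.sqrt (1 - y ^ (2 / a))
noncomputable def W1 (a y : ℝ) : ℝ := ∫ x in (0:ℝ)..y, wS a x
noncomputable def cS (a : ℝ) : ℝ := W1 a 1
noncomputable def QS (a : ℝ) : ℝ := 4 * a * (a + 1) * cS a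
noncomputable def MS (a : ℝ) : ℝ := 4 * cS a / (QS a) ^ (1 + 1 / a)

theorem wS_cont {a : ℝ} (ha : 0 < a) : Continuous (wS a) := by
  unfold wS
  have := Real.continuous_rpow_const (q := 2 / a) (by positivity)
  fun_prop

theorem pow_q {a y : ℝ} (ha : 0 < a) (hy : 0 ≤ y) : y ^ (2 + 2 / a) = y ^ 2 * y ^ (2 / a) := by
  rw [Real.rpow_add' hy (by positivity)]
  norm_cast

theorem wS_sq {a y : ℝ} (ha : 0 < a) (hy : 0 ≤ y) (hy1 : y ≤ 1) :
    (wS a y) ^ 2 = y ^ 2 - y ^ (2 + 2 / a) := by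
  have h : y ^ (2 / a) ≤ 1 := Real.rpow_le_one hy hy1 (by positivity)
  rw [wS, mul_pow, Real.sq_sqrt (by linarith), pow_q ha hy]
  ring

theorem wS_nonneg {a y : ℝ} (hy : 0 ≤ y) : 0 ≤ wS a y := mul_nonneg hy (Real.sqrt_nonneg _)

theorem W1_le {a y : ℝ} (ha : 0 < a) (hy : 0 ≤ y) : W1 a y ≤ y ^ 2 / 2 := by
  have : W1 a y ≤ ∫ x in (0:ℝ)..y, x := by
    apply intervalIntegral.integral_mono_on hy ((wS_cont ha).intervalIntegrable _ _)
      (continuous_id.intervalIntegrable _ _)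
    intro x hx
    have : Real.sqrt (1 - x ^ (2 / a)) ≤ 1 := by
      apply Real.sqrt_le_iff.mpr ⟨zero_le_one, ?_⟩
      have := Real.rpow_nonneg hx.1 (2 / a)
      linarith
    calc wS a x ≤ x * 1 := mul_le_mul_of_nonneg_left this hx.1
      _ = x := mul_one x
  rw [integral_id] at this
  linarith

theorem W1_ge {a y : ℝ} (ha : 0 < a) (hy : 0 ≤ y) :
    Real.sqrt (1 - y ^ (2 / a)) * (y ^ 2 / 2) ≤ W1 a y := by
  have : (∫ x in (0:ℝ)..y, x * Real.sqrt (1 - y ^ (2 / a))) ≤ W1 a y := by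
    apply intervalIntegral.integral_mono_on hy
      (Continuous.intervalIntegrable (by fun_prop) _ _) ((wS_cont ha).intervalIntegrable _ _)
    intro x hx
    refine mul_le_mul_of_nonneg_left ?_ hx.1
    apply Real.sqrt_le_sqrt
    have := Real.rpow_le_rpow hx.1 hx.2 (z := 2 / a) (by positivity)
    linarith
  rw [intervalIntegral.integral_mul_const, integral_id] at this
  linarith

theorem cS_pos {a : ℝ} (ha : 0 < a) : 0 < cS a := by
  have h1 : W1 a (1/2) ≤ cS a := by
    have i1 := (wS_cont ha).intervalIntegrable (μ := volume) 0 (1/2)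
    have i2 := (wS_cont ha).intervalIntegrable (μ := volume) (1/2) 1
    unfold cS W1
    rw [← intervalIntegral.integral_add_adjacent_intervals i1 i2]
    have : 0 ≤ ∫ x in (1/2:ℝ)..1, wS a x := by
      apply intervalIntegral.integral_nonneg (by norm_num)
      intro x hx
      exact wS_nonneg (by linarith [hx.1])
    linarith
  have h2 := W1_ge ha (y := 1/2) (by norm_num)
  have h3 : (1/2:ℝ) ^ (2 / a) < 1 := Real.rpow_lt_one (by norm_num) (by norm_num) (by positivity)
  have h4 : 0 < Real.sqrt (1 - (1/2:ℝ) ^ (2 / a)) := Real.sqrt_pos.mpr (by linarith)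
  have h5 : 0 < Real.sqrt (1 - (1/2:ℝ) ^ (2 / a)) * ((1/2) ^ 2 / 2) := by positivity
  linarith

theorem QS_pos {a : ℝ} (ha : 0 < a) : 0 < QS a := by
  have := cS_pos ha
  unfold QS; positivity

theorem MS_pos {a : ℝ} (ha : 0 < a) : 0 < MS a := by
  have := cS_pos ha
  have := QS_pos ha
  unfold MS; positivity

theorem bern {a z : ℝ} (ha : 0 < a) (hz : 0 ≤ z) : z * (a + 1) - z ^ (a + 1) ≤ a := by
  have := one_add_mul_self_le_rpow_one_add (s := z - 1) (by linarith) (p := a + 1) (by linarith)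
  have e : 1 + (z - 1) = z := by ring
  rw [e] at this
  linarith

theorem sharp_num {a m Y : ℝ} (ha : 0 < a) (hm : 0 < m)
    (h : m ^ 2 * (a ^ 2 * Y + 4 * a * cS a) ≤ 1) : m ^ (2 + 2 / a) * Y ≤ MS a := by
  have hc := cS_pos ha
  have hQ := QS_pos ha
  set z := m ^ (2 / a) * QS a ^ (1 / a) with hz
  have hz0 : 0 ≤ z := by positivity
  have hm2 : m ^ (2 / a) = (m ^ 2) ^ (1 / a) := by
    rw [← Real.rpow_natCast, ← Real.rpow_mul hm.le]; congr 1; push_cast; ring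
  have hzy : z ^ a = m ^ 2 * QS a := by
    rw [hz, hm2, ← Real.mul_rpow (by positivity) (by positivity), ← Real.rpow_mul (by positivity)]
    rw [one_div_mul_cancel ha.ne', Real.rpow_one]
  have hb := bern ha hz0
  rw [Real.rpow_add_one' hz0 (by linarith), hzy] at hb
  rw [pow_q ha hm.le]
  have hQ1 : QS a ^ (1 + 1 / a) = QS a * QS a ^ (1 / a) := by
    rw [Real.rpow_add hQ, Real.rpow_one]
  have hP : 0 < QS a ^ (1 / a) := by positivity
  rw [MS, hQ1, le_div_iff₀ (by positivity)]
  have e1 : m ^ 2 * m ^ (2 / a) * Y * (QS a * QS a ^ (1 / a)) = m ^ 2 * Y * QS a * z := by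
    rw [hz]; ring
  rw [e1]
  -- m^2 a^2 Y ≤ 1 - m^2 4 a c
  have e2 : QS a = 4 * a * (a + 1) * cS a := rfl
  have h1 : a ^ 2 * (m ^ 2 * Y * z) ≤ (1 - m ^ 2 * (4 * a * cS a)) * z := by nlinarith
  have h2 : (1 - m ^ 2 * (4 * a * cS a)) * z * (a + 1) ≤ a := by
    have : (1 - m ^ 2 * (4 * a * cS a)) * z * (a + 1) = z * (a + 1) - m ^ 2 * QS a * z := by
      rw [e2]; ring
    linarith
  have h3 : a ^ 2 * (m ^ 2 * Y * z) * (a + 1) ≤ a := by nlinarith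
  have h4 : a * (a + 1) * (m ^ 2 * Y * z) ≤ 1 := by
    have : a * (a * (a + 1) * (m ^ 2 * Y * z)) ≤ a * 1 := by nlinarith
    exact le_of_mul_le_mul_left this ha
  calc m ^ 2 * Y * QS a * z = 4 * cS a * (a * (a + 1) * (m ^ 2 * Y * z)) := by rw [e2]; ring
    _ ≤ 4 * cS a * 1 := by gcongr
    _ = 4 * cS a := by ring

theorem sharp_ineq {a : ℝ} (ha : 0 < a) {T : ℝ} (hT : 0 ≤ T) {φ φ' : ℝ → ℝ}
    (hd : ∀ t, HasDerivAt φ (φ' t) t) (hc' : Continuous φ') (h0 : φ 0 = 0)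
    (hpos : ∀ t ∈ Icc 0 T, 0 ≤ φ t)
    (hE : (∫ t in (0:ℝ)..T, ((φ' t) ^ 2 + a ^ 2 * (φ t) ^ 2)) + a * (φ T) ^ 2 ≤ 1) :
    (∫ t in (0:ℝ)..T, (φ t) ^ (2 + 2 / a)) ≤ MS a := by
  have hc : Continuous φ := continuous_iff_continuousAt.mpr fun t => (hd t).continuousAt
  obtain ⟨t1, ht1, hmax⟩ := isCompact_Icc.exists_isMaxOn (nonempty_Icc.mpr hT) hc.continuousOn
  set m := φ t1 with hm
  have hmle : ∀ t ∈ Icc 0 T, φ t ≤ m := fun t ht => hmax ht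
  rcases (hpos t1 ht1).eq_or_lt with hm0 | hm0
  · have : (∫ t in (0:ℝ)..T, (φ t) ^ (2 + 2 / a)) = ∫ t in (0:ℝ)..T, (0:ℝ) := by
      apply intervalIntegral.integral_congr
      intro t ht
      rw [uIcc_of_le hT] at ht
      have : φ t = 0 := le_antisymm ((hmle t ht).trans_eq hm0.symm) (hpos t ht)
      simp only [this]
      exact Real.zero_rpow (by positivity)
    rw [this]; simpa using (MS_pos ha).le
  replace hm0 : 0 < m := hm0
  set η : ℝ → ℝ := fun t => φ t / m with hη
  have hηd : ∀ t, HasDerivAt η (φ' t / m) t := fun t => (hd t).div_const m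
  have hηc : Continuous η := hc.div_const m
  have hη0 : ∀ t ∈ Icc 0 T, 0 ≤ η t := fun t ht => div_nonneg (hpos t ht) hm0.le
  have hη1 : ∀ t ∈ Icc 0 T, η t ≤ 1 := fun t ht => (div_le_one hm0).mpr (hmle t ht)
  have hWd : ∀ t, HasDerivAt (fun t => W1 a (η t)) (wS a (η t) * (φ' t / m)) t := fun t =>
    (ftc_cont (wS_cont ha) 0 (η t)).comp t (hηd t)
  have hq0 : (0:ℝ) ≤ 2 + 2 / a := by positivity
  have hηq : Continuous fun t => η t ^ (2 + 2 / a) := (Real.continuous_rpow_const hq0).comp hηc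
  set e : ℝ → ℝ := fun t => (φ' t / m) ^ 2 + a ^ 2 * (η t) ^ 2 - a ^ 2 * η t ^ (2 + 2 / a) with he
  have hec : Continuous e := by
    simp only [he]; fun_prop
  have hwc : Continuous fun t => wS a (η t) * (φ' t / m) :=
    ((wS_cont ha).comp hηc).mul (hc'.div_const m)
  have hpt : ∀ t ∈ Icc 0 T, e t = (φ' t / m) ^ 2 + a ^ 2 * (wS a (η t)) ^ 2 := by
    intro t ht
    rw [wS_sq ha (hη0 t ht) (hη1 t ht)]; simp only [he]; ring
  have hA : 2 * a * cS a ≤ ∫ t in (0:ℝ)..t1, e t := by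
    have k1 := intervalIntegral.integral_eq_sub_of_hasDerivAt (a := 0) (b := t1)
      (fun t _ => hWd t) (hwc.intervalIntegrable _ _)
    have k2 : (∫ t in (0:ℝ)..t1, 2 * a * (wS a (η t) * (φ' t / m))) ≤ ∫ t in (0:ℝ)..t1, e t := by
      apply intervalIntegral.integral_mono_on ht1.1
        ((continuous_const.mul hwc).intervalIntegrable _ _) (hec.intervalIntegrable _ _)
      intro t ht
      rw [hpt t ⟨ht.1, ht.2.trans ht1.2⟩]
      change 2 * a * (wS a (η t) * (φ' t / m)) ≤ _
      nlinarith [sq_nonneg (φ' t / m - a * wS a (η t))]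
    rw [intervalIntegral.integral_const_mul, k1] at k2
    have e1 : η t1 = 1 := div_self hm0.ne'
    have e0 : η 0 = 0 := by simp [hη, h0]
    rw [e1, e0] at k2
    have : W1 a 0 = 0 := by simp [W1]
    rw [this] at k2
    simpa [cS] using k2
  have hB : 2 * a * cS a - a * (η T) ^ 2 ≤ ∫ t in t1..T, e t := by
    have k1 := intervalIntegral.integral_eq_sub_of_hasDerivAt (a := t1) (b := T)
      (fun t _ => hWd t) (hwc.intervalIntegrable _ _)
    have k2 : (∫ t in t1..T, (-(2 * a)) * (wS a (η t) * (φ' t / m))) ≤ ∫ t in t1..T, e t := by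
      apply intervalIntegral.integral_mono_on ht1.2
        ((continuous_const.mul hwc).intervalIntegrable _ _) (hec.intervalIntegrable _ _)
      intro t ht
      rw [hpt t ⟨ht1.1.trans ht.1, ht.2⟩]
      change -(2 * a) * (wS a (η t) * (φ' t / m)) ≤ _
      nlinarith [sq_nonneg (φ' t / m + a * wS a (η t))]
    rw [intervalIntegral.integral_const_mul, k1] at k2
    have e1 : η t1 = 1 := div_self hm0.ne'
    rw [e1] at k2
    have := W1_le ha (hη0 T ⟨hT, le_rfl⟩)
    have e3 : W1 a 1 = cS a := rfl
    rw [e3] at k2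
    nlinarith
  set Y := ∫ t in (0:ℝ)..T, η t ^ (2 + 2 / a) with hY
  have hAB : (∫ t in (0:ℝ)..T, e t) = (∫ t in (0:ℝ)..T, ((φ' t / m) ^ 2 + a ^ 2 * (η t) ^ 2)) - a ^ 2 * Y := by
    rw [hY, ← intervalIntegral.integral_const_mul, ← intervalIntegral.integral_sub]
    · apply Continuous.intervalIntegrable; fun_prop
    · apply Continuous.intervalIntegrable; fun_prop
  have hadd := intervalIntegral.integral_add_adjacent_intervals (hec.intervalIntegrable (μ := volume) 0 t1)
    (hec.intervalIntegrable t1 T)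
  have hsc : (∫ t in (0:ℝ)..T, ((φ' t) ^ 2 + a ^ 2 * (φ t) ^ 2)) =
      m ^ 2 * ∫ t in (0:ℝ)..T, ((φ' t / m) ^ 2 + a ^ 2 * (η t) ^ 2) := by
    rw [← intervalIntegral.integral_const_mul]
    congr 1; ext t
    simp only [hη]
    field_simp
  have hT2 : φ T = m * η T := by simp only [hη]; field_simp
  have hfin : m ^ 2 * (a ^ 2 * Y + 4 * a * cS a) ≤ 1 := by
    rw [hsc, hT2] at hE
    have : a ^ 2 * Y + 4 * a * cS a ≤
      (∫ t in (0:ℝ)..T, ((φ' t / m) ^ 2 + a ^ 2 * (η t) ^ 2)) + a * (η T) ^ 2 := by linarith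
    have := mul_le_mul_of_nonneg_left this (sq_nonneg m)
    nlinarith
  have hX : (∫ t in (0:ℝ)..T, (φ t) ^ (2 + 2 / a)) = m ^ (2 + 2 / a) * Y := by
    rw [hY, ← intervalIntegral.integral_const_mul]
    apply intervalIntegral.integral_congr
    intro t ht
    rw [uIcc_of_le hT] at ht
    simp only [hη]
    rw [← Real.mul_rpow hm0.le (div_nonneg (hpos t ht) hm0.le)]
    congr 1
    field_simp
  rw [hX]
  exact sharp_num ha hm0 hfin

noncomputable abbrev Hsp := Lp ℝ 2 (volume : Measure ℝ)

theorem emb_memLp (T : ℝ) {f : ℝ → ℝ} (hf : Continuous f) :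
    MemLp ((Ioc 0 T).indicator f) 2 (volume : Measure ℝ) := by
  rw [memLp_indicator_iff_restrict measurableSet_Ioc]
  obtain ⟨C, hC⟩ := isCompact_Icc.exists_bound_of_continuousOn (s := Icc 0 T) hf.continuousOn
  refine MemLp.of_bound hf.aestronglyMeasurable C ?_
  rw [ae_restrict_iff' measurableSet_Ioc]
  exact Eventually.of_forall fun x hx => hC x (Ioc_subset_Icc_self hx)

noncomputable def emb (T : ℝ) {f : ℝ → ℝ} (hf : Continuous f) : Hsp := (emb_memLp T hf).toLp

theorem emb_inner {T S : ℝ} (hT : 0 ≤ T) (hTS : T ≤ S) {f g : ℝ → ℝ} (hf : Continuous f)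
    (hg : Continuous g) : inner ℝ (emb T hf) (emb S hg) = ∫ t in (0:ℝ)..T, f t * g t := by
  rw [L2.inner_def, intervalIntegral.integral_of_le hT, ← integral_indicator measurableSet_Ioc]
  apply integral_congr_ae
  filter_upwards [(emb_memLp T hf).coeFn_toLp, (emb_memLp S hg).coeFn_toLp] with x h1 h2
  unfold emb
  rw [h1, h2]
  by_cases hx : x ∈ Ioc 0 T
  · have hx' : x ∈ Ioc 0 S := ⟨hx.1, hx.2.trans hTS⟩
    simp only [indicator_of_mem hx, indicator_of_mem hx']
    simp [mul_comm]
  · simp [indicator_of_notMem hx]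

theorem kap_cont (a t : ℝ) : Continuous fun τ => Real.exp (-(a * (t - τ))) := by fun_prop

noncomputable def kap (a t : ℝ) : Hsp := emb t (kap_cont a t)

theorem kap_inner_le {a : ℝ} (ha : 0 < a) {t s : ℝ} (ht : 0 ≤ t) (hts : t ≤ s) :
    inner ℝ (kap a t) (kap a s) = Gk a t s := by
  unfold kap
  rw [emb_inner ht hts]
  have hd : ∀ τ, HasDerivAt (fun τ => Real.exp (2 * a * τ) * (Real.exp (-(a * (t + s))) / (2 * a)))
      (Real.exp (-(a * (t - τ))) * Real.exp (-(a * (s - τ)))) τ := by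
    intro τ
    have := (hasDerivAt_expp (2 * a) τ).mul_const (Real.exp (-(a * (t + s))) / (2 * a))
    refine this.congr_deriv ?_
    rw [← Real.exp_add]
    have : -(a * (t - τ)) + -(a * (s - τ)) = 2 * a * τ + -(a * (t + s)) := by ring
    rw [this, Real.exp_add]
    field_simp
  rw [intervalIntegral.integral_eq_sub_of_hasDerivAt (fun τ _ => hd τ)
    (Continuous.intervalIntegrable (by fun_prop) _ _), Gk_eq_right hts]
  have e1 : Real.exp (2 * a * t) * (Real.exp (-(a * (t + s))) / (2 * a)) =
      Real.exp (a * t) * Real.exp (-(a * s)) / (2 * a) := by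
    rw [← mul_div_assoc, ← Real.exp_add, ← Real.exp_add]; ring_nf
  rw [e1, ← Real.exp_add (-(a * t))]
  simp
  ring_nf

theorem Gk_symm (a t s : ℝ) : Gk a t s = Gk a s t := by
  unfold Gk; rw [abs_sub_comm, add_comm t s]

theorem kap_inner {a : ℝ} (ha : 0 < a) {t s : ℝ} (ht : 0 ≤ t) (hs : 0 ≤ s) :
    inner ℝ (kap a t) (kap a s) = Gk a t s := by
  rcases le_total t s with h | h
  · exact kap_inner_le ha ht h
  · rw [real_inner_comm, kap_inner_le ha hs h, Gk_symm]

theorem kap_neg {a t : ℝ} (ht : t ≤ 0) : kap a t = 0 := by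
  unfold kap emb
  apply Lp.ext
  filter_upwards [(emb_memLp t (kap_cont a t)).coeFn_toLp, Lp.coeFn_zero ℝ 2 (volume : Measure ℝ)]
    with x h1 h2
  rw [h1, h2]
  simp [Ioc_eq_empty (not_lt.mpr ht)]

theorem kap_continuous {a : ℝ} (ha : 0 < a) : Continuous (kap a) := by
  have e : kap a = fun t => kap a (max t 0) := by
    ext1 t
    rcases le_total t 0 with h | h
    · rw [max_eq_right h, kap_neg h, kap_neg le_rfl]
    · rw [max_eq_left h]
  rw [e, continuous_iff_continuousAt]
  intro t
  rw [ContinuousAt, tendsto_iff_norm_sub_tendsto_zero]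
  have h1 : ∀ s, ‖kap a (max s 0) - kap a (max t 0)‖ = Real.sqrt (Gk a (max s 0) (max s 0)
      - 2 * Gk a (max s 0) (max t 0) + Gk a (max t 0) (max t 0)) := by
    intro s
    have h := norm_sub_sq_real (kap a (max s 0)) (kap a (max t 0))
    rw [← real_inner_self_eq_norm_sq (kap a (max s 0)), ← real_inner_self_eq_norm_sq (kap a (max t 0)),
      kap_inner ha (le_max_right _ _) (le_max_right _ _),
      kap_inner ha (le_max_right _ _) (le_max_right _ _),
      kap_inner ha (le_max_right _ _) (le_max_right _ _)] at h
    rw [← h, Real.sqrt_sq (norm_nonneg _)]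
  simp only [h1]
  have hc : Continuous fun s => Real.sqrt (Gk a (max s 0) (max s 0)
      - 2 * Gk a (max s 0) (max t 0) + Gk a (max t 0) (max t 0)) := by
    unfold Gk; fun_prop
  have := hc.tendsto t
  convert this using 2
  rw [show Gk a (max t 0) (max t 0) - 2 * Gk a (max t 0) (max t 0) + Gk a (max t 0) (max t 0) = 0 by ring]
  simp

theorem kap_norm {a : ℝ} (ha : 0 < a) (t : ℝ) : ‖kap a t‖ ≤ Real.sqrt (1 / (2 * a)) := by
  rcases le_total t 0 with h | h
  · rw [kap_neg h]; simp
  · apply Real.le_sqrt_of_sq_le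
    rw [← real_inner_self_eq_norm_sq, kap_inner ha h h]
    unfold Gk
    gcongr
    have := Real.exp_pos (-(a * (t + t)))
    simp
    linarith

theorem kap_repr {a : ℝ} {T : ℝ} (hT : 0 ≤ T) {φ φ' : ℝ → ℝ}
    (hd : ∀ t, HasDerivAt φ (φ' t) t) (hc' : Continuous φ') (h0 : φ 0 = 0) :
    ∃ f : Hsp, ‖f‖ ^ 2 = (∫ t in (0:ℝ)..T, (φ' t + a * φ t) ^ 2) ∧
      ∀ t ∈ Icc 0 T, inner ℝ f (kap a t) = φ t := by
  have hc : Continuous φ := continuous_iff_continuousAt.mpr fun t => (hd t).continuousAt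
  have hfc : Continuous fun t => φ' t + a * φ t := by fun_prop
  refine ⟨emb T hfc, ?_, ?_⟩
  · rw [← real_inner_self_eq_norm_sq, emb_inner hT le_rfl]
    simp only [sq]
  · intro t ht
    rw [real_inner_comm, kap, emb_inner ht.1 ht.2]
    have hD : ∀ τ, HasDerivAt (fun τ => Real.exp (-(a * (t - τ))) * φ τ)
        (Real.exp (-(a * (t - τ))) * (φ' τ + a * φ τ)) τ := by
      intro τ
      have h1 : HasDerivAt (fun τ => -(a * (t - τ))) a τ := by
        have : HasDerivAt (fun τ => -(a * (t - τ))) (-(a * (-1))) τ :=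
          (((hasDerivAt_id τ).const_sub t).const_mul a).neg
        exact this.congr_deriv (by ring)
      have := h1.exp.mul (hd τ)
      exact this.congr_deriv (by ring)
    rw [intervalIntegral.integral_eq_sub_of_hasDerivAt (fun τ _ => hD τ)
      (Continuous.intervalIntegrable (by fun_prop) _ _)]
    simp [h0]

noncomputable def SS (a t : ℝ) : ℝ := Real.cosh t ^ (-a)
noncomputable def th (t : ℝ) : ℝ := Real.sinh t / Real.cosh t

theorem SS_pos (a t : ℝ) : 0 < SS a t := Real.rpow_pos_of_pos (Real.cosh_pos t) _

theorem SS_le_one {a : ℝ} (ha : 0 < a) (t : ℝ) : SS a t ≤ 1 :=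
  Real.rpow_le_one_of_one_le_of_nonpos (Real.one_le_cosh t) (by linarith)

theorem SS_neg (a t : ℝ) : SS a (-t) = SS a t := by simp [SS]

theorem th_neg (t : ℝ) : th (-t) = -th t := by simp [th, neg_div]

theorem SS_deriv (a t : ℝ) : HasDerivAt (SS a) (-a * th t * SS a t) t := by
  have hc := Real.cosh_pos t
  have := (Real.hasDerivAt_cosh t).rpow_const (p := -a) (Or.inl hc.ne')
  refine this.congr_deriv ?_
  rw [Real.rpow_sub hc, Real.rpow_one, SS, th]
  field_simp

theorem th_sq (t : ℝ) : th t ^ 2 = 1 - 1 / Real.cosh t ^ 2 := by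
  have hc := Real.cosh_pos t
  have := Real.cosh_sq t
  rw [th]
  field_simp
  linarith

theorem th_deriv (t : ℝ) : HasDerivAt th (1 / Real.cosh t ^ 2) t := by
  have hc := Real.cosh_pos t
  have := (Real.hasDerivAt_sinh t).div (Real.hasDerivAt_cosh t) hc.ne'
  refine this.congr_deriv ?_
  have := Real.cosh_sq t
  congr 1
  linarith

theorem th_cont : Continuous th := continuous_iff_continuousAt.mpr fun t => (th_deriv t).continuousAt
theorem SS_cont (a : ℝ) : Continuous (SS a) :=
  continuous_iff_continuousAt.mpr fun t => (SS_deriv a t).continuousAt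
theorem ch_cont : Continuous fun t => 1 / Real.cosh t ^ 2 :=
  continuous_const.div (by fun_prop) (fun t => by have := Real.cosh_pos t; positivity)

theorem th_nonneg {t : ℝ} (ht : 0 ≤ t) : 0 ≤ th t :=
  div_nonneg (Real.sinh_nonneg_iff.mpr ht) (Real.cosh_pos t).le
theorem th_le_one (t : ℝ) : th t ≤ 1 := by
  have hc := Real.cosh_pos t
  have := th_sq t
  have h : 0 < 1 / Real.cosh t ^ 2 := by positivity
  nlinarith

theorem SS_pow {a : ℝ} (ha : 0 < a) (t : ℝ) : SS a t ^ (2 / a) = 1 / Real.cosh t ^ 2 := by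
  have hc := Real.cosh_pos t
  rw [SS, ← Real.rpow_mul hc.le]
  have : -a * (2 / a) = -(2:ℕ) := by push_cast; field_simp
  rw [this, Real.rpow_neg hc.le, Real.rpow_natCast, one_div]

theorem SS_q {a : ℝ} (ha : 0 < a) (t : ℝ) :
    SS a t ^ (2 + 2 / a) = SS a t ^ 2 * (1 / Real.cosh t ^ 2) := by
  rw [pow_q ha (SS_pos a t).le, SS_pow ha]

theorem SS_p {a : ℝ} (ha : 0 < a) (t : ℝ) :
    SS a t ^ (1 + 2 / a) = SS a t * (1 / Real.cosh t ^ 2) := by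
  rw [Real.rpow_add (SS_pos a t), SS_pow ha, Real.rpow_one]

theorem sqrt_SS {a : ℝ} (ha : 0 < a) {t : ℝ} (ht : 0 ≤ t) :
    Real.sqrt (1 - SS a t ^ (2 / a)) = th t := by
  rw [SS_pow ha, ← th_sq, Real.sqrt_sq (th_nonneg ht)]

noncomputable def XS (a t : ℝ) : ℝ := SS a t ^ 2 * (1 / Real.cosh t ^ 2)

theorem XS_cont (a : ℝ) : Continuous (XS a) := by
  have := SS_cont a
  have := ch_cont
  unfold XS; fun_prop

theorem XS_nonneg (a t : ℝ) : 0 ≤ XS a t := by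
  unfold XS; have := Real.cosh_pos t; positivity

theorem XS_half {a : ℝ} (ha : 0 < a) {R : ℝ} (hR : 0 ≤ R) :
    (∫ t in (0:ℝ)..R, XS a t) = th R * SS a R ^ 2 - 2 * W1 a (SS a R) + 2 * cS a := by
  have hd : ∀ t ∈ uIcc 0 R, HasDerivAt (fun t => th t * SS a t ^ 2 - 2 * W1 a (SS a t)) (XS a t) t := by
    intro t ht
    rw [uIcc_of_le hR] at ht
    have h1 := (th_deriv t).mul ((SS_deriv a t).pow 2)
    have h2 := ((ftc_cont (wS_cont ha) 0 (SS a t)).comp t (SS_deriv a t)).const_mul 2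
    refine (h1.sub h2).congr_deriv ?_
    have e : wS a (SS a t) = SS a t * th t := by rw [wS, sqrt_SS ha ht.1]
    rw [e, XS]
    simp only [Pi.pow_apply]
    push_cast
    ring
  rw [intervalIntegral.integral_eq_sub_of_hasDerivAt hd ((XS_cont a).intervalIntegrable _ _)]
  have : th 0 = 0 := by simp [th]
  have h1 : SS a 0 = 1 := by simp [SS]
  rw [this, h1]
  simp only [cS]
  ring

theorem XS_full {a : ℝ} (ha : 0 < a) {R : ℝ} (hR : 0 ≤ R) :
    (∫ t in (-R)..R, XS a t) = 2 * (th R * SS a R ^ 2 - 2 * W1 a (SS a R) + 2 * cS a) := by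
  have h1 := intervalIntegral.integral_comp_neg (a := 0) (b := R) (XS a)
  have h2 : ∀ t, XS a (-t) = XS a t := fun t => by simp [XS, SS_neg]
  simp only [h2, neg_zero] at h1
  rw [← intervalIntegral.integral_add_adjacent_intervals
    ((XS_cont a).intervalIntegrable (-R) 0) ((XS_cont a).intervalIntegrable 0 R), ← h1, XS_half ha hR]
  ring

theorem XS_ge {a : ℝ} (ha : 0 < a) {R : ℝ} (hR : 0 ≤ R) :
    4 * cS a - 2 * SS a R ^ 2 ≤ ∫ t in (-R)..R, XS a t := by
  rw [XS_full ha hR]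
  have h1 := W1_le ha (SS_pos a R).le
  have h2 := mul_nonneg (th_nonneg hR) (sq_nonneg (SS a R))
  linarith

theorem norm_le {a : ℝ} (ha : 0 < a) {s : ℝ} (hs : 0 ≤ s) :
    (∫ t in (-s)..s, (-a * th t * SS a t + a * SS a t) ^ 2) ≤ QS a := by
  have hd : ∀ t, HasDerivAt (fun t => a * SS a t ^ 2 - a * (th t * SS a t ^ 2))
      ((-a * th t * SS a t + a * SS a t) ^ 2 - a * (a + 1) * XS a t) t := by
    intro t
    have h1 := ((SS_deriv a t).pow 2).const_mul a
    have h2 := ((th_deriv t).mul ((SS_deriv a t).pow 2)).const_mul a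
    refine (h1.sub h2).congr_deriv ?_
    have e := th_sq t
    unfold XS
    simp only [Pi.pow_apply]
    push_cast
    linear_combination (SS a t ^ 2 * a ^ 2) * e
  have hX := XS_cont a
  have hS := SS_cont a
  have hth := th_cont
  have h1 := intervalIntegral.integral_eq_sub_of_hasDerivAt (a := -s) (b := s) (fun t _ => hd t)
    (Continuous.intervalIntegrable (by fun_prop) _ _)
  rw [intervalIntegral.integral_sub (Continuous.intervalIntegrable (by fun_prop) _ _)
    (Continuous.intervalIntegrable (by fun_prop) _ _), intervalIntegral.integral_const_mul,
    XS_full ha hs, SS_neg, th_neg] at h1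
  have h2 := W1_ge ha (SS_pos a s).le
  rw [sqrt_SS ha hs] at h2
  have h3 := mul_nonneg (th_nonneg hs) (sq_nonneg (SS a s))
  have h4 : 0 ≤ a * (a + 1) * (W1 a (SS a s) - th s * (SS a s ^ 2 / 2)) := by
    have : 0 ≤ a * (a + 1) := by positivity
    exact mul_nonneg this (by linarith)
  unfold QS
  nlinarith

theorem cosh_ge (t : ℝ) : Real.exp t / 2 ≤ Real.cosh t := by
  rw [Real.cosh_eq]; have := Real.exp_pos (-t); linarith

theorem SS_le {a : ℝ} (ha : 0 < a) (t : ℝ) : SS a t ≤ 2 ^ a * Real.exp (-(a * t)) := by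
  have h1 : (Real.exp t / 2) ^ a ≤ Real.cosh t ^ a :=
    Real.rpow_le_rpow (by positivity) (cosh_ge t) ha.le
  rw [SS, Real.rpow_neg (Real.cosh_pos t).le]
  have h2 : (Real.cosh t ^ a)⁻¹ ≤ ((Real.exp t / 2) ^ a)⁻¹ := by gcongr
  refine h2.trans_eq ?_
  rw [Real.div_rpow (Real.exp_pos t).le (by norm_num), ← Real.exp_mul, inv_div, Real.exp_neg]
  rw [mul_comm t a]; rfl

theorem bern_max {A B q : ℝ} (hA : 0 < A) (hB : 0 ≤ B) (hq : 1 ≤ q) :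
    A ^ q - q * (A ^ (q - 1) * B) ≤ (max (A - B) 0) ^ q := by
  have hAq : A ^ (q - 1) * A = A ^ q := by
    rw [Real.rpow_sub_one hA.ne']; field_simp
  have hA1 : 0 < A ^ (q - 1) := by positivity
  rcases le_total B A with h | h
  · rw [max_eq_left (by linarith)]
    have h1 := one_add_mul_self_le_rpow_one_add (s := -(B / A)) (by
      rw [neg_le_neg_iff]; exact (div_le_one hA).mpr h) hq
    have h2 := mul_le_mul_of_nonneg_left h1 (by positivity : 0 ≤ A ^ q)
    rw [← Real.mul_rpow hA.le (by
      have := (div_le_one hA).mpr h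
      linarith)] at h2
    have e : A * (1 + -(B / A)) = A - B := by field_simp; ring
    rw [e] at h2
    refine le_trans (le_of_eq ?_) h2
    rw [← hAq]; field_simp; ring
  · have : 0 ≤ (max (A - B) 0) ^ q := by positivity
    have h2 : A ^ q ≤ A ^ (q - 1) * B := by rw [← hAq]; gcongr
    have h3 : 0 ≤ A ^ (q - 1) * B := by positivity
    nlinarith

theorem test_lower {a : ℝ} (ha : 0 < a) {k : ℝ → ℝ} (hk : Continuous k) (hk0 : ∀ t, 0 ≤ k t)
    {C0 γ t0 s : ℝ} (hC0 : 0 < C0) (hγ : 0 < γ) (ht0 : 0 ≤ t0)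
    (hkl : ∀ t, t0 ≤ t → 1 + C0 * Real.exp (-(γ * t)) ≤ k t) (hs1 : 1 ≤ s) (hst : t0 ≤ s)
    (hsmall : SS a s ≤ SS a 1 / 2) {φ : ℝ → ℝ}
    (hφ : φ = fun t => SS a (t - s) - SS a s * Real.exp (-(a * t))) :
    4 * cS a + C0 * Real.exp (-(γ * (s + 1))) * (SS a 1 / 2) ^ (2 + 2 / a)
      - (2 * 4 ^ a + t0 * (4 ^ a * Real.exp (2 * a * t0)) + (2 + 2 / a) * (2 * 4 ^ a))
        * Real.exp (-(2 * a * s))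
      ≤ ∫ t in (0:ℝ)..(2 * s), k t * (max (φ t) 0) ^ (2 + 2 / a) := by
  set q := 2 + 2 / a with hq
  have hq1 : 1 ≤ q := by have : 0 < 2 / a := by positivity
                         linarith
  have hSc := SS_cont a
  have hφc : Continuous φ := by rw [hφ]; fun_prop
  have hmc : Continuous fun t => (max (φ t) 0) ^ q :=
    (Real.continuous_rpow_const (by linarith)).comp (hφc.max continuous_const)
  have h4 : (2:ℝ) ^ a * 2 ^ a = 4 ^ a := by
    rw [← Real.mul_rpow (by norm_num) (by norm_num)]; norm_num
  have hSs := SS_le ha s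
  have hSs2 : SS a s ^ 2 ≤ 4 ^ a * Real.exp (-(2 * a * s)) := by
    have : SS a s ^ 2 ≤ (2 ^ a * Real.exp (-(a * s))) ^ 2 := by
      have := (SS_pos a s).le
      gcongr
    refine this.trans_eq ?_
    rw [mul_pow, sq, h4, ← Real.exp_nat_mul]; congr 2; push_cast; ring
  -- drop the initial part
  have s1 : (∫ t in t0..(2 * s), k t * (max (φ t) 0) ^ q) ≤
      ∫ t in (0:ℝ)..(2 * s), k t * (max (φ t) 0) ^ q := by
    have hkm : Continuous fun t => k t * (max (φ t) 0) ^ q := hk.mul hmc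
    have e := intervalIntegral.integral_add_adjacent_intervals
      (hkm.intervalIntegrable (μ := volume) 0 t0) (hkm.intervalIntegrable (μ := volume) t0 (2 * s))
    have : 0 ≤ ∫ t in (0:ℝ)..t0, k t * (max (φ t) 0) ^ q := by
      apply intervalIntegral.integral_nonneg ht0
      intro t _
      exact mul_nonneg (hk0 t) (by positivity)
    linarith
  -- the gain
  have hgc : Continuous fun t => C0 * Real.exp (-(γ * t)) * (max (φ t) 0) ^ q :=
    Continuous.mul (by fun_prop) hmc
  have s2 : (∫ t in t0..(2 * s), (max (φ t) 0) ^ q) +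
      (∫ t in t0..(2 * s), C0 * Real.exp (-(γ * t)) * (max (φ t) 0) ^ q) ≤
      ∫ t in t0..(2 * s), k t * (max (φ t) 0) ^ q := by
    rw [← intervalIntegral.integral_add (hmc.intervalIntegrable _ _) (hgc.intervalIntegrable _ _)]
    apply intervalIntegral.integral_mono_on (by linarith) ((hmc.add hgc).intervalIntegrable _ _)
      ((hk.mul hmc).intervalIntegrable _ _)
    intro t ht
    have h1 := hkl t ht.1
    have h2 : 0 ≤ (max (φ t) 0) ^ q := by positivity
    have h3 := mul_le_mul_of_nonneg_right h1 h2
    change (max (φ t) 0) ^ q + C0 * Real.exp (-(γ * t)) * (max (φ t) 0) ^ q ≤ k t * (max (φ t) 0) ^ q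
    linarith
  have s3 : C0 * Real.exp (-(γ * (s + 1))) * (SS a 1 / 2) ^ q ≤
      ∫ t in t0..(2 * s), C0 * Real.exp (-(γ * t)) * (max (φ t) 0) ^ q := by
    have hnn : ∀ t, 0 ≤ C0 * Real.exp (-(γ * t)) * (max (φ t) 0) ^ q := fun t => by positivity
    have m1 : (∫ t in s..(s+1), C0 * Real.exp (-(γ * t)) * (max (φ t) 0) ^ q) ≤
        ∫ t in t0..(2 * s), C0 * Real.exp (-(γ * t)) * (max (φ t) 0) ^ q := by
      apply intervalIntegral.integral_mono_interval hst (by linarith) (by linarith)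
      · exact Eventually.of_forall hnn
      · exact hgc.intervalIntegrable _ _
    refine le_trans ?_ m1
    have m2 : (∫ t in s..(s+1), C0 * Real.exp (-(γ * (s + 1))) * (SS a 1 / 2) ^ q) ≤
        ∫ t in s..(s+1), C0 * Real.exp (-(γ * t)) * (max (φ t) 0) ^ q := by
      apply intervalIntegral.integral_mono_on (by linarith)
        (continuous_const.intervalIntegrable _ _) (hgc.intervalIntegrable _ _)
      intro t ht
      have p1 := SS_pos a 1
      have hch : SS a 1 ≤ SS a (t - s) := by
        unfold SS
        apply Real.rpow_le_rpow_of_nonpos (Real.cosh_pos _) _ (by linarith)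
        rw [Real.cosh_le_cosh, abs_of_nonneg (by linarith [ht.1]), abs_one]
        linarith [ht.2]
      have he : SS a s * Real.exp (-(a * t)) ≤ SS a s := by
        have : Real.exp (-(a * t)) ≤ 1 := by
          rw [Real.exp_le_one_iff]
          have : 0 ≤ a * t := mul_nonneg ha.le (by linarith [ht.1])
          linarith
        have := mul_le_mul_of_nonneg_left this (SS_pos a s).le
        linarith
      have hφge : SS a 1 / 2 ≤ max (φ t) 0 := by
        refine le_trans ?_ (le_max_left _ _)
        rw [hφ]; simp only; linarith
      gcongr
      exact ht.2
    simpa using m2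
  -- the main term
  have hAc : Continuous fun t => XS a (t - s) := (XS_cont a).comp (by fun_prop)
  have hBc : Continuous fun t => 2 ^ a * SS a s * Real.exp (-(a * s)) * (1 / Real.cosh (t - s) ^ 2) :=
    continuous_const.mul (ch_cont.comp (continuous_id.sub continuous_const))
  have s4 : (∫ t in t0..(2 * s), XS a (t - s)) -
      q * (∫ t in t0..(2 * s), 2 ^ a * SS a s * Real.exp (-(a * s)) * (1 / Real.cosh (t - s) ^ 2)) ≤
      ∫ t in t0..(2 * s), (max (φ t) 0) ^ q := by
    rw [← intervalIntegral.integral_const_mul, ← intervalIntegral.integral_sub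
      (hAc.intervalIntegrable _ _) ((hBc.intervalIntegrable _ _).const_mul q)]
    apply intervalIntegral.integral_mono_on (by linarith)
      ((hAc.intervalIntegrable _ _).sub ((hBc.intervalIntegrable _ _).const_mul q))
      (hmc.intervalIntegrable _ _)
    intro t ht
    have hp := SS_pos a (t - s)
    have hps := SS_pos a s
    have h1 := bern_max hp (B := SS a s * Real.exp (-(a * t))) (by positivity) hq1
    have e1 : q - 1 = 1 + 2 / a := by rw [hq]; ring
    have e2 : SS a (t - s) ^ q = XS a (t - s) := SS_q ha _
    rw [e1, SS_p ha, e2] at h1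
    have e3 : φ t = SS a (t - s) - SS a s * Real.exp (-(a * t)) := by rw [hφ]
    rw [e3]
    refine le_trans ?_ h1
    have hb : SS a (t - s) ≤ 2 ^ a * Real.exp (a * (t - s)) := by
      have := SS_le ha (-(t - s))
      rw [SS_neg] at this
      convert this using 3
      ring
    have hch : 0 < 1 / Real.cosh (t - s) ^ 2 := by have := Real.cosh_pos (t - s); positivity
    have hfin : SS a (t - s) * (1 / Real.cosh (t - s) ^ 2) * (SS a s * Real.exp (-(a * t))) ≤
        2 ^ a * SS a s * Real.exp (-(a * s)) * (1 / Real.cosh (t - s) ^ 2) := by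
      calc _ ≤ 2 ^ a * Real.exp (a * (t - s)) * (1 / Real.cosh (t - s) ^ 2) * (SS a s * Real.exp (-(a * t))) := by
            gcongr
        _ = 2 ^ a * SS a s * (Real.exp (a * (t - s)) * Real.exp (-(a * t))) * (1 / Real.cosh (t - s) ^ 2) := by ring
        _ = _ := by rw [← Real.exp_add]; congr 3; ring
    have := mul_le_mul_of_nonneg_left hfin (by linarith : 0 ≤ q)
    linarith
  have s5 : (∫ t in t0..(2 * s), 2 ^ a * SS a s * Real.exp (-(a * s)) * (1 / Real.cosh (t - s) ^ 2)) ≤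
      2 * 4 ^ a * Real.exp (-(2 * a * s)) := by
    rw [intervalIntegral.integral_const_mul]
    have h1 : (∫ t in t0..(2 * s), 1 / Real.cosh (t - s) ^ 2) ≤ 2 := by
      rw [intervalIntegral.integral_comp_sub_right (fun t => 1 / Real.cosh t ^ 2) s,
        intervalIntegral.integral_eq_sub_of_hasDerivAt (fun t _ => th_deriv t)
        (ch_cont.intervalIntegrable _ _)]
      have h2 := th_le_one (2 * s - s)
      have h3 := th_le_one (-(t0 - s))
      rw [th_neg] at h3
      linarith
    have h0 : 0 ≤ 2 ^ a * SS a s * Real.exp (-(a * s)) := by have := SS_pos a s; positivity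
    calc _ ≤ 2 ^ a * SS a s * Real.exp (-(a * s)) * 2 := mul_le_mul_of_nonneg_left h1 h0
      _ ≤ 2 ^ a * (2 ^ a * Real.exp (-(a * s))) * Real.exp (-(a * s)) * 2 := by gcongr
      _ = 2 * (2 ^ a * 2 ^ a) * (Real.exp (-(a * s)) * Real.exp (-(a * s))) := by ring
      _ = _ := by rw [h4, ← Real.exp_add]; congr 2; ring
  have s6 : 4 * cS a - 2 * SS a s ^ 2 - t0 * (4 ^ a * Real.exp (2 * a * t0)) * Real.exp (-(2 * a * s)) ≤
      ∫ t in t0..(2 * s), XS a (t - s) := by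
    have h1 : (∫ t in (0:ℝ)..(2 * s), XS a (t - s)) = ∫ t in (-s)..s, XS a t := by
      rw [intervalIntegral.integral_comp_sub_right (XS a) s]
      congr 1 <;> ring
    have h2 := XS_ge ha (by linarith : 0 ≤ s)
    have h3 := intervalIntegral.integral_add_adjacent_intervals
      (hAc.intervalIntegrable (μ := volume) 0 t0) (hAc.intervalIntegrable t0 (2 * s))
    have h5 : (∫ t in (0:ℝ)..t0, XS a (t - s)) ≤
        ∫ t in (0:ℝ)..t0, 4 ^ a * Real.exp (2 * a * t0) * Real.exp (-(2 * a * s)) := by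
      apply intervalIntegral.integral_mono_on ht0 (hAc.intervalIntegrable _ _)
        (continuous_const.intervalIntegrable _ _)
      intro t ht
      have hb : SS a (t - s) ≤ 2 ^ a * Real.exp (a * (t - s)) := by
        have := SS_le ha (-(t - s))
        rw [SS_neg] at this
        convert this using 3
        ring
      have hch : 1 / Real.cosh (t - s) ^ 2 ≤ 1 := by
        rw [div_le_one (by have := Real.cosh_pos (t - s); positivity)]
        have := Real.one_le_cosh (t - s)
        nlinarith
      have hp := SS_pos a (t - s)
      calc XS a (t - s) ≤ SS a (t - s) ^ 2 * 1 := by unfold XS; gcongr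
        _ ≤ (2 ^ a * Real.exp (a * (t - s))) ^ 2 * 1 := by gcongr
        _ = (2 ^ a * 2 ^ a) * (Real.exp (a * (t - s)) * Real.exp (a * (t - s))) := by ring
        _ = 4 ^ a * (Real.exp (2 * a * t) * Real.exp (-(2 * a * s))) := by
            rw [h4, ← Real.exp_add, ← Real.exp_add]; congr 2; ring
        _ ≤ 4 ^ a * (Real.exp (2 * a * t0) * Real.exp (-(2 * a * s))) := by
            gcongr
            exact ht.2
        _ = _ := by ring
    rw [intervalIntegral.integral_const, sub_zero, smul_eq_mul] at h5
    rw [h1] at h3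
    linarith
  have s7 := mul_le_mul_of_nonneg_left s5 (by linarith : 0 ≤ q)
  linarith

theorem exists_test {a : ℝ} (ha : 0 < a) {k : ℝ → ℝ} (hk : Continuous k) (hk0 : ∀ t, 0 ≤ k t)
    {C0 γ t0 : ℝ} (hC0 : 0 < C0) (hγ : 0 < γ) (hγ2 : γ < 2 * a) (ht0 : 0 ≤ t0)
    (hkl : ∀ t, t0 ≤ t → 1 + C0 * Real.exp (-(γ * t)) ≤ k t) :
    ∃ T : ℝ, 0 ≤ T ∧ ∃ f : Hsp, ‖f‖ ≤ 1 ∧ MS a < Jfun (kap a) k (2 + 2 / a) T f := by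
  set q := 2 + 2 / a with hq
  set A := C0 * Real.exp (-γ) * (SS a 1 / 2) ^ q with hA
  have hS1 := SS_pos a 1
  have hApos : 0 < A := by positivity
  set B := (2 * 4 ^ a + t0 * (4 ^ a * Real.exp (2 * a * t0)) + q * (2 * 4 ^ a)) with hB
  -- choose s
  have L1 : ∀ᶠ s in atTop, SS a s ≤ SS a 1 / 2 := by
    have : Tendsto (fun s => 2 ^ a * Real.exp (-(a * s))) atTop (𝓝 (2 ^ a * 0)) := by
      apply Tendsto.const_mul
      exact Real.tendsto_exp_neg_atTop_nhds_zero.comp (tendsto_id.const_mul_atTop ha)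
    rw [mul_zero] at this
    filter_upwards [this.eventually (eventually_le_nhds (by positivity : (0:ℝ) < SS a 1 / 2))] with s hs
    exact (SS_le ha s).trans hs
  have L2 : ∀ᶠ s in atTop, B < A * Real.exp ((2 * a - γ) * s) := by
    have : Tendsto (fun s => A * Real.exp ((2 * a - γ) * s)) atTop atTop :=
      (Real.tendsto_exp_atTop.comp (tendsto_id.const_mul_atTop (by linarith))).const_mul_atTop hApos
    exact this.eventually_gt_atTop B
  obtain ⟨s, hsm, hsB, hs1, hst⟩ := (L1.and (L2.and ((eventually_ge_atTop 1).and (eventually_ge_atTop t0)))).exists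
  set φ : ℝ → ℝ := fun t => SS a (t - s) - SS a s * Real.exp (-(a * t)) with hφ
  set φ' : ℝ → ℝ := fun t => -a * th (t - s) * SS a (t - s) + a * (SS a s * Real.exp (-(a * t))) with hφ'
  have hlow := test_lower ha hk hk0 hC0 hγ ht0 hkl hs1 hst hsm hφ
  rw [← hq, ← hB] at hlow
  have hJ : 4 * cS a < ∫ t in (0:ℝ)..(2 * s), k t * (max (φ t) 0) ^ q := by
    refine lt_of_lt_of_le ?_ hlow
    have e1 : C0 * Real.exp (-(γ * (s + 1))) * (SS a 1 / 2) ^ q = A * Real.exp (-(γ * s)) := by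
      rw [hA]
      have : -(γ * (s + 1)) = -γ + -(γ * s) := by ring
      rw [this, Real.exp_add]; ring
    have e2 : A * Real.exp ((2 * a - γ) * s) * Real.exp (-(2 * a * s)) = A * Real.exp (-(γ * s)) := by
      rw [mul_assoc, ← Real.exp_add]; congr 2; ring
    have := mul_lt_mul_of_pos_right hsB (Real.exp_pos (-(2 * a * s)))
    rw [e2] at this
    rw [e1]
    linarith
  have hSc := SS_cont a
  have hthc := th_cont
  have hd : ∀ t, HasDerivAt φ (φ' t) t := by
    intro t
    have h1 : HasDerivAt (fun t => SS a (t - s)) (-a * th (t - s) * SS a (t - s)) t :=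
      (SS_deriv a (t - s)).comp_sub_const t s
    have h2 := (hasDerivAt_expm a t).const_mul (SS a s)
    refine (h1.sub h2).congr_deriv ?_
    simp only [hφ']; ring
  have hφ0 : φ 0 = 0 := by simp [hφ, SS_neg]
  obtain ⟨f, hfn, hfr⟩ := kap_repr (a := a) (T := 2 * s) (by linarith) hd (by simp only [hφ']; fun_prop) hφ0
  have hQ := QS_pos ha
  have hfQ : ‖f‖ ^ 2 ≤ QS a := by
    rw [hfn]
    have : ∀ t, (φ' t + a * φ t) ^ 2 = (fun τ => (-a * th τ * SS a τ + a * SS a τ) ^ 2) (t - s) := by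
      intro t; simp only [hφ, hφ']; ring
    simp only [this]
    rw [intervalIntegral.integral_comp_sub_right (fun τ => (-a * th τ * SS a τ + a * SS a τ) ^ 2) s]
    have e : 2 * s - s = s := by ring
    rw [zero_sub, e]
    exact norm_le ha (by linarith)
  set r := (Real.sqrt (QS a))⁻¹ with hr
  have hrp : 0 < r := by rw [hr]; positivity
  refine ⟨2 * s, by linarith, r • f, ?_, ?_⟩
  · rw [norm_smul, Real.norm_eq_abs, abs_of_pos hrp, hr, inv_mul_le_one₀ (by positivity)]
    exact Real.le_sqrt_of_sq_le hfQ
  · have e1 : Jfun (kap a) k q (2 * s) (r • f) =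
        r ^ q * ∫ t in (0:ℝ)..(2 * s), k t * (max (φ t) 0) ^ q := by
      unfold Jfun
      rw [← intervalIntegral.integral_const_mul]
      apply intervalIntegral.integral_congr
      intro t ht
      rw [uIcc_of_le (by linarith)] at ht
      simp only
      rw [real_inner_smul_left, hfr t ht]
      have : max (r * φ t) 0 = r * max (φ t) 0 := by
        rw [mul_max_of_nonneg _ _ hrp.le, mul_zero]
      rw [this, Real.mul_rpow hrp.le (le_max_right _ _)]
      ring
    have e2 : r ^ q = (QS a ^ (1 + 1 / a))⁻¹ := by
      rw [hr, Real.inv_rpow (Real.sqrt_nonneg _), Real.sqrt_eq_rpow, ← Real.rpow_mul hQ.le]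
      congr 2; rw [hq]; field_simp
    rw [e1, e2, MS, div_eq_inv_mul]
    have : 0 < QS a ^ (1 + 1 / a) := by positivity
    gcongr

theorem Gk_nn {a t τ : ℝ} (ha : 0 < a) (ht : 0 ≤ t) (hτ : 0 ≤ τ) : 0 ≤ Gk a t τ := by
  unfold Gk
  apply div_nonneg _ (by positivity)
  rw [sub_nonneg, Real.exp_le_exp, neg_le_neg_iff]
  gcongr
  rw [abs_le]; constructor <;> linarith

theorem Gk_pos' {a t τ : ℝ} (ha : 0 < a) (ht : 0 < t) (hτ : 0 < τ) : 0 < Gk a t τ := by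
  unfold Gk
  apply div_pos _ (by positivity)
  rw [sub_pos, Real.exp_lt_exp, neg_lt_neg_iff]
  gcongr
  rw [abs_lt]; constructor <;> linarith

theorem Gk_le1 {a : ℝ} (ha : 0 < a) (t τ : ℝ) :
    Gk a t τ ≤ Real.exp (a * t) / (2 * a) * Real.exp (-(a * τ)) := by
  unfold Gk
  rw [div_mul_eq_mul_div, ← Real.exp_add]
  gcongr
  have h1 : Real.exp (-(a * |t - τ|)) ≤ Real.exp (a * t + -(a * τ)) := by
    rw [Real.exp_le_exp]
    have := neg_abs_le (t - τ)
    nlinarith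
  have := Real.exp_pos (-(a * (t + τ)))
  linarith

theorem Gk_le2 {a : ℝ} (ha : 0 < a) (t τ : ℝ) :
    Gk a t τ ≤ Real.exp (a * τ) / (2 * a) * Real.exp (-(a * t)) := by
  rw [Gk_symm]; exact Gk_le1 ha τ t

theorem kap_tendsto {a : ℝ} (ha : 0 < a) (f : Hsp) :
    Tendsto (fun t => inner ℝ f (kap a t)) atTop (𝓝 0) := by
  let S : Submodule ℝ Hsp :=
    { carrier := {f | Tendsto (fun t => inner ℝ f (kap a t)) atTop (𝓝 0)}
      add_mem' := by
        intro x y hx hy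
        have := Tendsto.add hx hy
        simpa [inner_add_left] using this
      zero_mem' := by simp
      smul_mem' := by
        intro c x hx
        have := Tendsto.const_mul c hx
        simpa [inner_smul_left] using this }
  set D := Real.sqrt (1 / (2 * a)) with hD
  have hS : IsClosed (S : Set Hsp) := by
    rw [← isSeqClosed_iff_isClosed]
    intro x y hx hxy
    change Tendsto (fun t => inner ℝ y (kap a t)) atTop (𝓝 0)
    rw [Metric.tendsto_nhds]
    intro ε hε
    have hD0 : 0 ≤ D := Real.sqrt_nonneg _
    obtain ⟨n, hn⟩ := ((Metric.tendsto_nhds.mp hxy) (ε / (2 * (D + 1))) (by positivity)).exists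
    have h2 := (Metric.tendsto_nhds.mp (hx n)) (ε / 2) (by positivity)
    filter_upwards [h2] with t ht
    simp only [dist_zero_right, Real.norm_eq_abs] at ht ⊢
    have e : inner ℝ y (kap a t) = inner ℝ (x n) (kap a t) + inner ℝ (y - x n) (kap a t) := by
      rw [← inner_add_left]; congr 1; abel
    have h3 : |inner ℝ (y - x n) (kap a t)| ≤ ε / (2 * (D + 1)) * D := by
      refine (abs_real_inner_le_norm _ _).trans ?_
      have := kap_norm ha t
      rw [dist_comm, dist_eq_norm] at hn
      gcongr
    have h4 : ε / (2 * (D + 1)) * D ≤ ε / 2 := by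
      rw [div_mul_eq_mul_div, div_le_div_iff₀ (by positivity) (by positivity)]
      nlinarith
    rw [e]
    have := abs_add_le (inner ℝ (x n) (kap a t)) (inner ℝ (y - x n) (kap a t))
    linarith
  set K := (Submodule.span ℝ (range (kap a))).topologicalClosure with hK
  have hKS : K ≤ S := by
    apply Submodule.topologicalClosure_minimal _ _ hS
    rw [Submodule.span_le]
    rintro _ ⟨s, rfl⟩
    change Tendsto (fun t => inner ℝ (kap a s) (kap a t)) atTop (𝓝 0)
    rcases le_total s 0 with h | h
    · rw [kap_neg h]; simp
    have hl : Tendsto (fun t => Real.exp (a * s) / (2 * a) * Real.exp (-(a * t))) atTop (𝓝 0) := by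
      have : Tendsto (fun t : ℝ => Real.exp (-(a * t))) atTop (𝓝 0) :=
        Real.tendsto_exp_neg_atTop_nhds_zero.comp (tendsto_id.const_mul_atTop ha)
      simpa using this.const_mul (Real.exp (a * s) / (2 * a))
    refine tendsto_of_tendsto_of_tendsto_of_le_of_le' tendsto_const_nhds hl ?_ ?_
    · filter_upwards [eventually_ge_atTop 0] with t ht
      rw [kap_inner ha h ht]; exact Gk_nn ha h ht
    · filter_upwards [eventually_ge_atTop 0] with t ht
      rw [kap_inner ha h ht]; exact Gk_le1 ha s t
  have hKo : Kᗮ ≤ S := by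
    intro v hv
    change Tendsto (fun t => inner ℝ v (kap a t)) atTop (𝓝 0)
    have : ∀ t, inner ℝ v (kap a t) = 0 := fun t => by
      rw [real_inner_comm]
      exact hv _ (Submodule.le_topologicalClosure _ (Submodule.subset_span ⟨t, rfl⟩))
    simp [this]
  have hcK : CompleteSpace K := (Submodule.isClosed_topologicalClosure _).completeSpace_coe
  have htop : K ⊔ Kᗮ = ⊤ := Submodule.sup_orthogonal_of_hasOrthogonalProjection
  have : f ∈ K ⊔ Kᗮ := by rw [htop]; trivial
  exact (sup_le hKS hKo) this

theorem max_props {a : ℝ} (ha : 0 < a) {k : ℝ → ℝ} (hk : Continuous k) (hk0 : ∀ t, 0 ≤ k t)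
    {T : ℝ} (hT : 0 ≤ T) {f : Hsp} (hf : ‖f‖ ≤ 1)
    (hmax : ∀ f' : Hsp, ‖f'‖ ≤ 1 → Jfun (kap a) k (2 + 2 / a) T f' ≤ Jfun (kap a) k (2 + 2 / a) T f)
    {M : ℝ} (hM : M = Jfun (kap a) k (2 + 2 / a) T f) (hMp : 0 < M) :
    (∀ t, 0 ≤ t → M * inner ℝ f (kap a t) = ∫ τ in (0:ℝ)..T,
      Gk a t τ * (k τ * (max (inner ℝ f (kap a τ)) 0) ^ (1 + 2 / a))) ∧
    (∀ t, 0 ≤ inner ℝ f (kap a t)) ∧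
    (∫ t in (0:ℝ)..T, (max (inner ℝ f (kap a t)) 0) ^ (2 + 2 / a)) ≤ MS a := by
  set p := 1 + 2 / a with hp
  have hpp : 0 < p := by positivity
  have hq : 2 + 2 / a = p + 1 := by rw [hp]; ring
  rw [hq] at hmax hM
  have hκ := kap_continuous ha
  have EL := EL_max hκ hk hk0 hpp hT hf hmax
  rw [← hM] at EL
  set ψ : ℝ → ℝ := fun τ => k τ * (max (inner ℝ f (kap a τ)) 0) ^ p with hψ
  have hψc : Continuous ψ := Jint_cont hκ hk hpp.le f
  have hψ0 : ∀ t, 0 ≤ ψ t := fun t => mul_nonneg (hk0 t) (by positivity)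
  have h1 : ∀ t, 0 ≤ t → M * inner ℝ f (kap a t) = ∫ τ in (0:ℝ)..T, Gk a t τ * ψ τ := by
    intro t ht
    have hint : IntervalIntegrable (fun t => ψ t • kap a t) volume 0 T :=
      (hψc.smul hκ).intervalIntegrable _ _
    rw [← real_inner_smul_left, ← EL, real_inner_comm]
    have := (innerSL ℝ (kap a t)).intervalIntegral_comp_comm hint
    simp only [innerSL_apply_apply] at this
    rw [← this]
    apply intervalIntegral.integral_congr
    intro τ hτ
    rw [uIcc_of_le hT] at hτ
    simp only [real_inner_smul_right]
    rw [kap_inner ha ht hτ.1, mul_comm]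
  have h2 : ∀ t, 0 ≤ inner ℝ f (kap a t) := by
    intro t
    rcases le_total t 0 with h | h
    · rw [kap_neg h]; simp
    have : 0 ≤ M * inner ℝ f (kap a t) := by
      rw [h1 t h]
      apply intervalIntegral.integral_nonneg hT
      intro τ hτ
      exact mul_nonneg (Gk_nn ha h hτ.1) (hψ0 τ)
    exact (mul_nonneg_iff_of_pos_left hMp).mp this
  refine ⟨h1, h2, ?_⟩
  set ψ' : ℝ → ℝ := fun t => ψ t / M with hψ'
  have hψ'c : Continuous ψ' := hψc.div_const M
  set C := ∫ τ in (0:ℝ)..T, Real.exp (-(a * τ)) * ψ' τ with hC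
  have h3 : ∀ t ∈ Icc 0 T, PhiC a ψ' C t = inner ℝ f (kap a t) := by
    intro t ht
    rw [← Gk_int_finite hψ'c ht.1 ht.2]
    have : (fun τ => Gk a t τ * ψ' τ) = fun τ => (Gk a t τ * ψ τ) / M := by
      ext τ; rw [hψ']; ring
    rw [this, intervalIntegral.integral_div, ← h1 t ht.1]
    field_simp
  have h4 := energy_id ha hψ'c T hC
  have h5 : (∫ t in (0:ℝ)..T, ψ' t * PhiC a ψ' C t) = 1 := by
    have : (∫ t in (0:ℝ)..T, ψ' t * PhiC a ψ' C t) = ∫ t in (0:ℝ)..T, (k t * (max (inner ℝ f (kap a t)) 0) ^ (p + 1)) / M := by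
      apply intervalIntegral.integral_congr
      intro t ht
      rw [uIcc_of_le hT] at ht
      simp only [hψ', hψ]
      rw [h3 t ht]
      have h0 := h2 t
      rw [max_eq_left h0, Real.rpow_add_one' h0 (by positivity)]
      ring
    rw [this, intervalIntegral.integral_div]
    change Jfun (kap a) k (p + 1) T f / M = 1
    rw [← hM]; field_simp
  have h6 := sharp_ineq ha hT (hasDerivAt_PhiC ha hψ'c C)
    (continuous_iff_continuousAt.mpr fun t => (hasDerivAt_dPhiC ha hψ'c C t).continuousAt)
    (PhiC_zero ψ' C) (fun t ht => by rw [h3 t ht]; exact h2 t) (by rw [← h4, h5])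
  refine le_trans (le_of_eq ?_) h6
  apply intervalIntegral.integral_congr
  intro t ht
  rw [uIcc_of_le hT] at ht
  simp only
  rw [h3 t ht, max_eq_left (h2 t)]

theorem exists_1d {a : ℝ} (ha : 0 < a) {k : ℝ → ℝ} (hk : Continuous k) (hk0 : ∀ t, 0 ≤ k t)
    {Kb : ℝ} (hKb : ∀ t, k t ≤ Kb) (hk1 : Tendsto k atTop (𝓝 1))
    {T0 : ℝ} (hT0 : 0 ≤ T0) {f0 : Hsp} (hf0 : ‖f0‖ ≤ 1)
    (hlt : MS a < Jfun (kap a) k (2 + 2 / a) T0 f0) :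
    ∃ M : ℝ, 0 < M ∧ ∃ f : Hsp, ‖f‖ ≤ 1 ∧ (∀ t, 0 ≤ inner ℝ f (kap a t)) ∧
      (∃ t, 0 < inner ℝ f (kap a t)) ∧
      ∀ t, 0 ≤ t → M * inner ℝ f (kap a t) =
        ∫ τ in Ioi (0:ℝ), Gk a t τ * (k τ * (inner ℝ f (kap a τ)) ^ (1 + 2 / a)) := by
  set q := 2 + 2 / a with hq
  set p := 1 + 2 / a with hp
  have hqp : 0 < q := by positivity
  have hpp : 0 < p := by positivity
  set M0 := Jfun (kap a) k q T0 f0 with hM0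
  have hMS := MS_pos ha
  have hM0p : 0 < M0 := hMS.trans hlt
  have : Fact ((2 : ENNReal) ≠ ⊤) := ⟨by norm_num⟩
  have hκ := kap_continuous ha
  set D := Real.sqrt (1 / (2 * a)) with hD
  have hD0 : 0 ≤ D := Real.sqrt_nonneg _
  have hκD : ∀ t, ‖kap a t‖ ≤ D := kap_norm ha
  have hTn : ∀ n : ℕ, 0 ≤ T0 + n := fun n => by positivity
  have hex := fun n : ℕ => exists_max hκ hκD hk hqp (hTn n)
  choose F hF hFmax using hex
  set Mn : ℕ → ℝ := fun n => Jfun (kap a) k q (T0 + n) (F n) with hMn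
  have hJc : ∀ f, Continuous fun t => k t * (max (inner ℝ f (kap a t)) 0) ^ q :=
    fun f => Jint_cont hκ hk hqp.le f
  have hmc : ∀ f, Continuous fun t => (max (inner ℝ f (kap a t)) 0) ^ q := fun f => by
    have := Jint_cont hκ (continuous_const (y := (1:ℝ))) hqp.le f
    simpa using this
  have hMlow : ∀ n, M0 ≤ Mn n := by
    intro n
    refine le_trans ?_ (hFmax n f0 hf0)
    apply intervalIntegral.integral_mono_interval le_rfl hT0 (by simp)
    · exact Eventually.of_forall fun t => mul_nonneg (hk0 t) (by positivity)
    · exact (hJc f0).intervalIntegrable _ _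
  have hprops := fun n => max_props ha hk hk0 (hTn n) (hF n) (hFmax n) (M := Mn n) rfl
    (hM0p.trans_le (hMlow n))
  have hKb0 : 0 ≤ Kb := (hk0 0).trans (hKb 0)
  have hMup : ∀ n, Mn n ≤ Kb * MS a := by
    intro n
    refine le_trans ?_ (mul_le_mul_of_nonneg_left (hprops n).2.2 hKb0)
    rw [← intervalIntegral.integral_const_mul]
    apply intervalIntegral.integral_mono_on (hTn n) ((hJc _).intervalIntegrable _ _)
      (((hmc _).const_mul Kb).intervalIntegrable _ _)
    intro t _
    have : 0 ≤ (max (inner ℝ (F n) (kap a t)) 0) ^ q := by positivity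
    exact mul_le_mul_of_nonneg_right (hKb t) this
  obtain ⟨f, hf, σ, hσ, hw⟩ := weak_seq F hF
  obtain ⟨M, hMI, σ', hσ', hMt⟩ := (isCompact_Icc (a := M0) (b := Kb * MS a)).tendsto_subseq
    (x := fun n => Mn (σ n)) (fun n => ⟨hMlow _, hMup _⟩)
  set ρ := σ ∘ σ' with hρ
  have hρm : StrictMono ρ := hσ.comp hσ'
  have hwρ : ∀ v, Tendsto (fun n => inner ℝ (F (ρ n)) v) atTop (𝓝 (inner ℝ f v)) :=
    fun v => (hw v).comp hσ'.tendsto_atTop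
  have hMρ : Tendsto (fun n => Mn (ρ n)) atTop (𝓝 M) := hMt
  have hTρ : Tendsto (fun n => T0 + (ρ n : ℝ)) atTop atTop :=
    tendsto_atTop_add_const_left _ _ (tendsto_natCast_atTop_atTop.comp hρm.tendsto_atTop)
  have hφ0 : ∀ t, 0 ≤ inner ℝ f (kap a t) := fun t =>
    ge_of_tendsto' (hwρ (kap a t)) fun n => (hprops (ρ n)).2.1 t
  refine ⟨M, hM0p.trans_le hMI.1, f, hf, hφ0, ?_, ?_⟩
  · by_contra hcon
    push Not at hcon
    have hz : ∀ t, inner ℝ f (kap a t) = 0 := fun t => le_antisymm (hcon t) (hφ0 t)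
    set ε := (M0 - MS a) / (2 * MS a) with hε
    have hεp : 0 < ε := div_pos (by linarith) (by linarith)
    have hev : ∀ᶠ t in atTop, k t < 1 + ε := hk1.eventually_lt_const (by linarith)
    obtain ⟨R, hR⟩ := eventually_atTop.mp (hev.and (eventually_ge_atTop 0))
    have hR0 : 0 ≤ R := (hR R le_rfl).2
    have hJ := J_tendsto hκ hκD hk hqp R (fun n => F (ρ n)) (fun n => hF _) f hwρ
    have hJ0 : Jfun (kap a) k q R f = 0 := by
      unfold Jfun
      simp [hz, Real.zero_rpow hqp.ne']
    rw [hJ0] at hJ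
    have hle : ∀ᶠ n in atTop, M0 ≤ Jfun (kap a) k q R (F (ρ n)) + (1 + ε) * MS a := by
      filter_upwards [hTρ.eventually_ge_atTop R] with n hn
      refine (hMlow (ρ n)).trans ?_
      have e := intervalIntegral.integral_add_adjacent_intervals
        ((hJc (F (ρ n))).intervalIntegrable (μ := volume) 0 R)
        ((hJc (F (ρ n))).intervalIntegrable (μ := volume) R (T0 + (ρ n : ℝ)))
      have e2 := intervalIntegral.integral_add_adjacent_intervals
        ((hmc (F (ρ n))).intervalIntegrable (μ := volume) 0 R)
        ((hmc (F (ρ n))).intervalIntegrable (μ := volume) R (T0 + (ρ n : ℝ)))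
      have e3 : 0 ≤ ∫ t in (0:ℝ)..R, (max (inner ℝ (F (ρ n)) (kap a t)) 0) ^ q :=
        intervalIntegral.integral_nonneg hR0 fun t _ => by positivity
      have e4 : (∫ t in R..(T0 + (ρ n : ℝ)), k t * (max (inner ℝ (F (ρ n)) (kap a t)) 0) ^ q) ≤
          (1 + ε) * ∫ t in R..(T0 + (ρ n : ℝ)), (max (inner ℝ (F (ρ n)) (kap a t)) 0) ^ q := by
        rw [← intervalIntegral.integral_const_mul]
        apply intervalIntegral.integral_mono_on hn ((hJc _).intervalIntegrable _ _)
          (((hmc _).const_mul _).intervalIntegrable _ _)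
        intro t ht
        have : 0 ≤ (max (inner ℝ (F (ρ n)) (kap a t)) 0) ^ q := by positivity
        exact mul_le_mul_of_nonneg_right (hR t ht.1).1.le this
      have e5 := (hprops (ρ n)).2.2
      have e6 : (∫ t in R..(T0 + (ρ n : ℝ)), (max (inner ℝ (F (ρ n)) (kap a t)) 0) ^ q) ≤ MS a := by
        linarith
      have e7 := mul_le_mul_of_nonneg_left e6 (by linarith : 0 ≤ 1 + ε)
      change (∫ t in (0:ℝ)..(T0 + (ρ n : ℝ)), k t * (max (inner ℝ (F (ρ n)) (kap a t)) 0) ^ q) ≤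
        (∫ t in (0:ℝ)..R, k t * (max (inner ℝ (F (ρ n)) (kap a t)) 0) ^ q) + _
      linarith
    have hfin := ge_of_tendsto (hJ.add_const ((1 + ε) * MS a)) hle
    have : ε * MS a = (M0 - MS a) / 2 := by rw [hε]; field_simp
    nlinarith
  · intro t ht
    set G : ℕ → ℝ → ℝ := fun n => (Ioc 0 (T0 + (ρ n : ℝ))).indicator
      (fun τ => Gk a t τ * (k τ * (max (inner ℝ (F (ρ n)) (kap a τ)) 0) ^ p)) with hG
    have hpc : ∀ f, Continuous fun τ => Gk a t τ * (k τ * (max (inner ℝ f (kap a τ)) 0) ^ p) :=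
      fun f => (Gk_cont a t).mul (Jint_cont hκ hk hpp.le f)
    have hL : Tendsto (fun n => ∫ τ in Ioi (0:ℝ), G n τ) atTop
        (𝓝 (∫ τ in Ioi (0:ℝ), Gk a t τ * (k τ * (inner ℝ f (kap a τ)) ^ p))) := by
      apply tendsto_integral_of_dominated_convergence
        (fun τ => Real.exp (a * t) / (2 * a) * (Real.exp (-(a * τ)) * (Kb * D ^ p)))
      · intro n
        exact ((hpc _).aestronglyMeasurable).indicator measurableSet_Ioc
      · have := exp_int ha (continuous_const (y := Kb * D ^ p)) (D := |Kb * D ^ p|) (fun _ => le_rfl) 0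
        exact this.const_mul _
      · intro n
        refine (ae_restrict_iff' measurableSet_Ioi).mpr (Eventually.of_forall fun τ hτ => ?_)
        have hb : 0 ≤ Real.exp (a * t) / (2 * a) * (Real.exp (-(a * τ)) * (Kb * D ^ p)) := by
          positivity
        simp only [hG]
        by_cases hmem : τ ∈ Ioc 0 (T0 + (ρ n : ℝ))
        · rw [indicator_of_mem hmem]
          have g0 := Gk_nn ha ht (le_of_lt hτ)
          have g1 := Gk_le1 ha t τ
          have x0 : 0 ≤ (max (inner ℝ (F (ρ n)) (kap a τ)) 0) ^ p := by positivity
          have x1 : (max (inner ℝ (F (ρ n)) (kap a τ)) 0) ^ p ≤ D ^ p := by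
            gcongr
            exact pos_bound hκD (hF _) τ
          rw [Real.norm_of_nonneg (mul_nonneg g0 (mul_nonneg (hk0 τ) x0)), ← mul_assoc (Real.exp (a * t) / (2 * a))]
          exact mul_le_mul g1 (mul_le_mul (hKb τ) x1 x0 hKb0) (mul_nonneg (hk0 τ) x0)
            (by positivity)
        · rw [indicator_of_notMem hmem, norm_zero]; exact hb
      · refine (ae_restrict_iff' measurableSet_Ioi).mpr (Eventually.of_forall fun τ hτ => ?_)
        have l1 : Tendsto (fun n => Gk a t τ * (k τ * (max (inner ℝ (F (ρ n)) (kap a τ)) 0) ^ p))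
            atTop (𝓝 (Gk a t τ * (k τ * (max (inner ℝ f (kap a τ)) 0) ^ p))) := by
          have := ((hwρ (kap a τ)).max (tendsto_const_nhds (x := (0:ℝ)))).rpow_const
            (p := p) (Or.inr hpp.le)
          exact (this.const_mul _).const_mul _
        rw [max_eq_left (hφ0 τ)] at l1
        refine l1.congr' ?_
        filter_upwards [hTρ.eventually_ge_atTop τ] with n hn
        simp only [hG]
        rw [indicator_of_mem (show τ ∈ Ioc 0 (T0 + (ρ n : ℝ)) from ⟨hτ, hn⟩)]
    have hE : ∀ n, (∫ τ in Ioi (0:ℝ), G n τ) = Mn (ρ n) * inner ℝ (F (ρ n)) (kap a t) := by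
      intro n
      rw [(hprops (ρ n)).1 t ht, intervalIntegral.integral_of_le (hTn _)]
      simp only [hG]
      rw [setIntegral_indicator measurableSet_Ioc]
      congr 2
      ext x; simp only [mem_inter_iff, mem_Ioi, mem_Ioc]; tauto
    simp only [hE] at hL
    exact tendsto_nhds_unique (hMρ.mul (hwρ (kap a t))) hL

theorem exists_sol {a : ℝ} (ha : 0 < a) {k : ℝ → ℝ} (hk : Continuous k) (hk0 : ∀ t, 0 ≤ k t)
    {Kb : ℝ} (hKb : ∀ t, k t ≤ Kb) (hk1 : Tendsto k atTop (𝓝 1))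
    {C0 γ t0 : ℝ} (hC0 : 0 < C0) (hγ : 0 < γ) (hγ2 : γ < 2 * a) (ht0 : 0 ≤ t0)
    (hkl : ∀ t, t0 ≤ t → 1 + C0 * Real.exp (-(γ * t)) ≤ k t) :
    ∃ φ : ℝ → ℝ, Continuous φ ∧ (∃ D, ∀ t, φ t ≤ D) ∧ (∀ t, 0 ≤ φ t) ∧ (∃ t, 0 ≤ t ∧ 0 < φ t) ∧
      Tendsto φ atTop (𝓝 0) ∧ ∀ t, 0 ≤ t → φ t = PhiC a (fun τ => k τ * φ τ ^ (1 + 2 / a))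
        (∫ τ in Ioi (0:ℝ), Real.exp (-(a * τ)) * (k τ * φ τ ^ (1 + 2 / a))) t := by
  obtain ⟨T0, hT0, f0, hf0, hlt⟩ := exists_test ha hk hk0 hC0 hγ hγ2 ht0 hkl
  obtain ⟨M, hM, f, hf, h0, ⟨s, hs⟩, hE⟩ := exists_1d ha hk hk0 hKb hk1 hT0 hf0 hlt
  set p := 1 + 2 / a with hp
  have hpp : 0 < p := by positivity
  set c := M ^ (-(a / 2)) with hc
  have hcp : 0 < c := by positivity
  have hcpow : c ^ p = c / M := by
    rw [hp, Real.rpow_add hcp, Real.rpow_one, hc, ← Real.rpow_mul hM.le]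
    have : -(a / 2) * (2 / a) = -1 := by field_simp
    rw [this, Real.rpow_neg_one]; rfl
  have hφc : Continuous fun t => c * inner ℝ f (kap a t) :=
    continuous_const.mul (continuous_const.inner (kap_continuous ha))
  have hbd : ∀ t, c * inner ℝ f (kap a t) ≤ c * Real.sqrt (1 / (2 * a)) := fun t => by
    have := pos_bound (kap_norm ha) hf t
    exact mul_le_mul_of_nonneg_left ((le_max_left _ _).trans this) hcp.le
  have hnn : ∀ t, 0 ≤ c * inner ℝ f (kap a t) := fun t => mul_nonneg hcp.le (h0 t)
  refine ⟨fun t => c * inner ℝ f (kap a t), hφc, ⟨_, hbd⟩, hnn, ⟨s, ?_, by positivity⟩, ?_, ?_⟩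
  · by_contra hcon
    push Not at hcon
    rw [kap_neg hcon.le] at hs
    simp at hs
  · simpa using (kap_tendsto ha f).const_mul c
  · intro t ht
    have hψc : Continuous fun τ => k τ * (c * inner ℝ f (kap a τ)) ^ p :=
      hk.mul ((Real.continuous_rpow_const hpp.le).comp hφc)
    rw [← Gk_int_infinite ha hψc (D := Kb * (c * Real.sqrt (1 / (2 * a))) ^ p) _ ht]
    · have e : (fun τ => Gk a t τ * (k τ * (c * inner ℝ f (kap a τ)) ^ p)) =
          fun τ => c / M * (Gk a t τ * (k τ * (inner ℝ f (kap a τ)) ^ p)) := by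
        ext τ
        rw [Real.mul_rpow hcp.le (h0 τ), hcpow]; ring
      rw [e, integral_const_mul, ← hE t ht]
      field_simp
    · intro τ
      have x0 : 0 ≤ (c * inner ℝ f (kap a τ)) ^ p := Real.rpow_nonneg (hnn τ) _
      rw [abs_of_nonneg (mul_nonneg (hk0 τ) x0)]
      exact mul_le_mul (hKb τ) (Real.rpow_le_rpow (hnn τ) (hbd τ) hpp.le) x0
        ((hk0 τ).trans (hKb τ))

theorem exp_decay {b : ℝ} (hb : 0 < b) {P P' P'' : ℝ → ℝ}
    (hP : ∀ t, HasDerivAt P (P' t) t) (hP' : ∀ t, HasDerivAt P' (P'' t) t)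
    {t1 B : ℝ} (h2 : ∀ t, t1 ≤ t → b ^ 2 * P t ≤ P'' t) (hB : ∀ t, t1 ≤ t → P' t + b * P t ≤ B) :
    ∀ t, t1 ≤ t → P t ≤ P t1 * Real.exp (b * t1) * Real.exp (-(b * t)) := by
  have hq : ∀ t, HasDerivAt (fun t => Real.exp (-(b * t)) * (P' t + b * P t))
      (Real.exp (-(b * t)) * (P'' t - b ^ 2 * P t)) t := fun t => by
    refine ((hasDerivAt_expm b t).mul ((hP' t).add ((hP t).const_mul b))).congr_deriv ?_
    simp only [Pi.add_apply]
    ring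
  have hqm : MonotoneOn (fun t => Real.exp (-(b * t)) * (P' t + b * P t)) (Ici t1) := by
    apply monotoneOn_of_deriv_nonneg (convex_Ici _)
      (fun t _ => (hq t).continuousAt.continuousWithinAt)
      (fun t _ => (hq t).differentiableAt.differentiableWithinAt)
    intro t ht
    rw [interior_Ici, mem_Ioi] at ht
    rw [(hq t).deriv]
    have := h2 t ht.le
    exact mul_nonneg (Real.exp_pos _).le (by linarith)
  have hq0 : ∀ s, t1 ≤ s → P' s + b * P s ≤ 0 := by
    intro s hs
    by_contra hcon
    push Not at hcon
    have hpos : 0 < Real.exp (-(b * s)) * (P' s + b * P s) := by positivity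
    have hl : Tendsto (fun t : ℝ => Real.exp (-(b * t)) * B) atTop (𝓝 0) := by
      have : Tendsto (fun t : ℝ => Real.exp (-(b * t))) atTop (𝓝 0) :=
        Real.tendsto_exp_neg_atTop_nhds_zero.comp (tendsto_id.const_mul_atTop hb)
      simpa using this.mul_const B
    have : Real.exp (-(b * s)) * (P' s + b * P s) ≤ 0 := by
      apply ge_of_tendsto hl
      filter_upwards [eventually_ge_atTop s] with t ht
      refine (hqm (mem_Ici.mpr hs) (mem_Ici.mpr (hs.trans ht)) ht).trans ?_
      exact mul_le_mul_of_nonneg_left (hB t (hs.trans ht)) (Real.exp_pos _).le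
    linarith
  have hr : ∀ t, HasDerivAt (fun t => Real.exp (b * t) * P t)
      (Real.exp (b * t) * (P' t + b * P t)) t := fun t => by
    refine ((hasDerivAt_expp b t).mul (hP t)).congr_deriv ?_
    ring
  have hra : AntitoneOn (fun t => Real.exp (b * t) * P t) (Ici t1) := by
    apply antitoneOn_of_deriv_nonpos (convex_Ici _)
      (fun t _ => (hr t).continuousAt.continuousWithinAt)
      (fun t _ => (hr t).differentiableAt.differentiableWithinAt)
    intro t ht
    rw [interior_Ici, mem_Ioi] at ht
    rw [(hr t).deriv]
    exact mul_nonpos_of_nonneg_of_nonpos (Real.exp_pos _).le (hq0 t ht.le)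
  intro t ht
  have := hra (mem_Ici.mpr le_rfl) (mem_Ici.mpr ht) ht
  simp only at this
  have e : Real.exp (b * t) * Real.exp (-(b * t)) = 1 := by rw [← Real.exp_add]; simp
  have h3 := mul_le_mul_of_nonneg_right this (Real.exp_pos (-(b * t))).le
  calc P t = Real.exp (b * t) * P t * Real.exp (-(b * t)) := by
        rw [mul_right_comm, e, one_mul]
    _ ≤ _ := h3
    _ = _ := by ring

theorem tendsto_expm {c : ℝ} (hc : 0 < c) :
    Tendsto (fun t : ℝ => Real.exp (-(c * t))) atTop (𝓝 0) :=
  Real.tendsto_exp_neg_atTop_nhds_zero.comp (tendsto_id.const_mul_atTop hc)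

theorem int_expm {c : ℝ} (hc : 0 < c) (s : ℝ) :
    IntegrableOn (fun τ : ℝ => Real.exp (-(c * τ))) (Ioi s) ∧
    ∫ τ in Ioi s, Real.exp (-(c * τ)) = Real.exp (-(c * s)) / c := by
  have e : (fun τ : ℝ => Real.exp (-(c * τ))) = fun τ => Real.exp (-c * τ) := by
    ext; rw [neg_mul]
  rw [e]
  refine ⟨integrableOn_exp_mul_Ioi (by linarith) s, ?_⟩
  rw [integral_exp_mul_Ioi (by linarith) s, neg_mul, neg_div_neg_eq]

theorem radial_ode {a : ℝ} (ha : 0 < a) {k : ℝ → ℝ} (hk : Continuous k) (hk0 : ∀ t, 0 ≤ k t)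
    {Kb : ℝ} (hKb : ∀ t, k t ≤ Kb) (hk1 : Tendsto k atTop (𝓝 1))
    {C0 γ t0 : ℝ} (hC0 : 0 < C0) (hγ : 0 < γ) (hγ2 : γ < 2 * a) (ht0 : 0 ≤ t0)
    (hkl : ∀ t, t0 ≤ t → 1 + C0 * Real.exp (-(γ * t)) ≤ k t) :
    ∃ U V : ℝ → ℝ, ∃ L : ℝ, 0 < L ∧ U 0 = 0 ∧ (∀ t, 0 < t → 0 < U t) ∧
      Tendsto U atTop (𝓝 L) ∧ Tendsto V atTop (𝓝 0) ∧
      (∀ t, HasDerivAt U (Real.exp (2 * a * t) * V t) t) ∧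
      (∀ t, 0 ≤ t → HasDerivAt V
        (-(Real.exp (-((2 * a + 2) * t)) * (k t * U t ^ (1 + 2 / a)))) t) := by
  obtain ⟨φ, hφc, ⟨D, hD⟩, hφ0, ⟨s, hs0, hs⟩, hφt, hE⟩ :=
    exists_sol ha hk hk0 hKb hk1 hC0 hγ hγ2 ht0 hkl
  set p := 1 + 2 / a with hp
  have h2a : 0 < 2 / a := by positivity
  have hpp : 0 < p := by positivity
  have hKb0 : 0 ≤ Kb := (hk0 0).trans (hKb 0)
  set ψ : ℝ → ℝ := fun τ => k τ * φ τ ^ p with hψ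
  have hψc : Continuous ψ := hk.mul ((Real.continuous_rpow_const hpp.le).comp hφc)
  have hψ0 : ∀ t, 0 ≤ ψ t := fun t => mul_nonneg (hk0 t) (Real.rpow_nonneg (hφ0 t) _)
  set B := Kb * D ^ p with hB
  have hψB : ∀ t, ψ t ≤ B := fun t =>
    mul_le_mul (hKb t) (Real.rpow_le_rpow (hφ0 t) (hD t) hpp.le) (Real.rpow_nonneg (hφ0 t) _) hKb0
  have hB0 : 0 ≤ B := (hψ0 0).trans (hψB 0)
  have hψabs : ∀ t, |ψ t| ≤ B := fun t => by rw [abs_of_nonneg (hψ0 t)]; exact hψB t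
  set C := ∫ τ in Ioi (0:ℝ), Real.exp (-(a * τ)) * ψ τ with hC
  set P := PhiC a ψ C with hP
  set V : ℝ → ℝ := fun t => C - ∫ τ in (0:ℝ)..t, Real.exp (-(a * τ)) * ψ τ with hV
  have c2 : Continuous fun τ => Real.exp (-(a * τ)) * ψ τ := by fun_prop
  have hdV : ∀ t, HasDerivAt V (-(Real.exp (-(a * t)) * ψ t)) t := fun t =>
    (ftc_cont c2 0 t).const_sub C
  have hVI : ∀ t, 0 ≤ t → V t = ∫ τ in Ioi t, Real.exp (-(a * τ)) * ψ τ := by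
    intro t ht
    have i0 := exp_int ha hψc hψabs 0
    have : C = (∫ τ in (0:ℝ)..t, Real.exp (-(a * τ)) * ψ τ) +
        ∫ τ in Ioi t, Real.exp (-(a * τ)) * ψ τ := by
      rw [hC, intervalIntegral.integral_of_le ht, ← setIntegral_union (Ioc_disjoint_Ioi le_rfl)
        measurableSet_Ioi (i0.mono_set Ioc_subset_Ioi_self) (i0.mono_set (Ioi_subset_Ioi ht)),
        Ioc_union_Ioi_eq_Ioi ht]
    simp only [hV]; linarith
  have hV0 : ∀ t, 0 ≤ t → 0 ≤ V t := by
    intro t ht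
    rw [hVI t ht]
    exact integral_nonneg fun τ => mul_nonneg (Real.exp_pos _).le (hψ0 τ)
  have hVle : ∀ (c K t : ℝ), 0 < c → 0 ≤ t → (∀ τ, t ≤ τ → Real.exp (-(a * τ)) * ψ τ ≤ K * Real.exp (-(c * τ))) →
      V t ≤ K * (Real.exp (-(c * t)) / c) := by
    intro c K t hc ht h
    rw [hVI t ht, ← (int_expm hc t).2, ← integral_const_mul]
    apply setIntegral_mono_on (exp_int ha hψc hψabs t) ((int_expm hc t).1.const_mul K)
      measurableSet_Ioi
    intro τ hτ
    exact h τ (le_of_lt hτ)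
  have hV1 : ∀ t, 0 ≤ t → V t ≤ B * (Real.exp (-(a * t)) / a) := by
    intro t ht
    apply hVle a B t ha ht
    intro τ _
    rw [mul_comm]
    exact mul_le_mul_of_nonneg_right (hψB τ) (Real.exp_pos _).le
  have hVt : Tendsto V atTop (𝓝 0) := by
    have hl : Tendsto (fun t => B * (Real.exp (-(a * t)) / a)) atTop (𝓝 0) := by
      simpa using ((tendsto_expm ha).div_const a).const_mul B
    refine tendsto_of_tendsto_of_tendsto_of_le_of_le' tendsto_const_nhds hl ?_ ?_
    · filter_upwards [eventually_ge_atTop 0] with t ht using hV0 t ht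
    · filter_upwards [eventually_ge_atTop 0] with t ht using hV1 t ht
  have hdP := hasDerivAt_PhiC ha hψc C
  have hdP' := hasDerivAt_dPhiC ha hψc C
  have hPV : ∀ t, dPhiC a ψ C t = -a * P t + Real.exp (a * t) * V t := by
    intro t
    simp only [hP, hV, PhiC, dPhiC]
    field_simp
    ring
  -- U
  set U : ℝ → ℝ := fun t => Real.exp (a * t) * P t with hU
  have hdU : ∀ t, HasDerivAt U (Real.exp (2 * a * t) * V t) t := by
    intro t
    refine ((hasDerivAt_expp a t).mul (hdP t)).congr_deriv ?_
    rw [hPV t, show 2 * a * t = a * t + a * t by ring, Real.exp_add]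
    ring
  have hUφ : ∀ t, 0 ≤ t → φ t = Real.exp (-(a * t)) * U t := by
    intro t ht
    rw [hE t ht]
    simp only [hU]
    rw [← mul_assoc, ← Real.exp_add]; simp
  have hUm : MonotoneOn U (Ici 0) := by
    apply monotoneOn_of_deriv_nonneg (convex_Ici _)
      (fun t _ => (hdU t).continuousAt.continuousWithinAt)
      (fun t _ => (hdU t).differentiableAt.differentiableWithinAt)
    intro t ht
    rw [interior_Ici, mem_Ioi] at ht
    rw [(hdU t).deriv]
    exact mul_nonneg (Real.exp_pos _).le (hV0 t ht.le)
  have hU0 : U 0 = 0 := by simp only [hU, hP, PhiC_zero, mul_zero]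
  have hUs : 0 < U s := by
    have := hUφ s hs0
    rw [this] at hs
    exact (pos_iff_pos_of_mul_pos hs).mp (Real.exp_pos _)
  -- positivity
  have hψpos : ∀ᶠ t in atTop, 0 < ψ t := by
    have : ∀ᶠ t in atTop, 0 < k t := hk1.eventually_const_lt (by norm_num)
    filter_upwards [this, eventually_ge_atTop s] with t h1 h2
    have h3 : U s ≤ U t := hUm (mem_Ici.mpr hs0) (mem_Ici.mpr (hs0.trans h2)) h2
    have h4 : 0 < φ t := by
      rw [hUφ t (hs0.trans h2)]
      exact mul_pos (Real.exp_pos _) (by linarith)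
    exact mul_pos h1 (Real.rpow_pos_of_pos h4 _)
  have hVpos : ∀ t, 0 ≤ t → 0 < V t := by
    obtain ⟨R, hR⟩ := eventually_atTop.mp hψpos
    have hVa : AntitoneOn V (Ici 0) := by
      apply antitoneOn_of_deriv_nonpos (convex_Ici _)
        (fun t _ => (hdV t).continuousAt.continuousWithinAt)
        (fun t _ => (hdV t).differentiableAt.differentiableWithinAt)
      intro t _
      rw [(hdV t).deriv, neg_nonpos]
      exact mul_nonneg (Real.exp_pos _).le (hψ0 t)
    have hVs : StrictAntiOn V (Ici R) := by
      apply strictAntiOn_of_deriv_neg (convex_Ici _)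
        (fun t _ => (hdV t).continuousAt.continuousWithinAt)
      intro t ht
      rw [interior_Ici, mem_Ioi] at ht
      rw [(hdV t).deriv, neg_lt_zero]
      exact mul_pos (Real.exp_pos _) (hR t ht.le)
    intro t ht
    set m := max R t with hm
    have m1 : R ≤ m := le_max_left _ _
    have m2 : t ≤ m := le_max_right _ _
    have h1 : V (m + 1) < V m := hVs (mem_Ici.mpr m1) (mem_Ici.mpr (by linarith)) (by linarith)
    have h2 := hV0 (m + 1) (by linarith)
    have h3 : V m ≤ V t := hVa (mem_Ici.mpr ht) (mem_Ici.mpr (by linarith)) m2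
    linarith
  have hUpos : ∀ t, 0 < t → 0 < U t := by
    have hUs : StrictMonoOn U (Ici 0) := by
      apply strictMonoOn_of_deriv_pos (convex_Ici _)
        (fun t _ => (hdU t).continuousAt.continuousWithinAt)
      intro t ht
      rw [interior_Ici, mem_Ioi] at ht
      rw [(hdU t).deriv]
      exact mul_pos (Real.exp_pos _) (hVpos t ht.le)
    intro t ht
    rw [← hU0]
    exact hUs (mem_Ici.mpr le_rfl) (mem_Ici.mpr ht.le) ht
  -- decay
  set b := a * (1 + 1 / p) / 2 with hb
  have hp1 : 1 < p := by linarith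
  have hb0 : 0 < b := by positivity
  have hba : b < a := by
    have : 1 / p < 1 := by rw [div_lt_one hpp]; exact hp1
    rw [hb]; nlinarith
  have hbp : a < b * p := by
    have : b * p = a * (p + 1) / 2 := by rw [hb]; field_simp
    rw [this]; nlinarith
  have hev : ∀ᶠ t in atTop, ψ t ≤ (a ^ 2 - b ^ 2) * φ t := by
    have l1 : Tendsto (fun t => k t * φ t ^ (2 / a)) atTop (𝓝 0) := by
      have := hk1.mul (hφt.rpow_const (p := 2 / a) (Or.inr h2a.le))
      rwa [Real.zero_rpow h2a.ne', mul_zero] at this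
    have : 0 < a ^ 2 - b ^ 2 := by nlinarith
    filter_upwards [l1.eventually_lt_const this] with t ht
    simp only [hψ]
    rw [hp, Real.rpow_add' (hφ0 t) (by rw [← hp]; exact hpp.ne'), Real.rpow_one]
    have := mul_le_mul_of_nonneg_right ht.le (hφ0 t)
    linarith
  obtain ⟨t1, ht1⟩ := eventually_atTop.mp (hev.and (eventually_ge_atTop 0))
  have ht10 : 0 ≤ t1 := (ht1 t1 le_rfl).2
  have hdec := exp_decay hb0 (t1 := t1) (B := B / a) hdP hdP' (by
      intro t ht
      have h1 := (ht1 t ht).1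
      rw [hE t (ht10.trans ht)] at h1
      change b ^ 2 * P t ≤ a ^ 2 * P t - ψ t
      change ψ t ≤ (a ^ 2 - b ^ 2) * P t at h1
      linarith) (by
      intro t ht
      have ht0 := ht10.trans ht
      rw [hPV t]
      have h1 := hV1 t ht0
      have h2 := mul_le_mul_of_nonneg_left h1 (Real.exp_pos (a * t)).le
      have h3 : Real.exp (a * t) * (B * (Real.exp (-(a * t)) / a)) = B / a := by
        rw [Real.exp_neg]; field_simp
      have h4 : 0 ≤ P t := by
        have := hφ0 t
        rw [hE t ht0] at this; exact this
      change -a * P t + Real.exp (a * t) * V t + b * P t ≤ B / a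
      nlinarith)
  set C1 := PhiC a ψ C t1 * Real.exp (b * t1) with hC1
  have hC10 : 0 ≤ C1 := by
    have := hφ0 t1
    rw [hE t1 ht10] at this
    exact mul_nonneg this (Real.exp_pos _).le
  set K := Kb * C1 ^ p with hK
  have hK0 : 0 ≤ K := by positivity
  set c := b * p - a with hc
  have hcp : 0 < c := by linarith
  have hV2 : ∀ t, t1 ≤ t → V t ≤ K * (Real.exp (-((a + b * p) * t)) / (a + b * p)) := by
    intro t ht
    apply hVle (a + b * p) K t (by positivity) (ht10.trans ht)
    intro τ hτ
    have h1 := hdec τ (ht.trans hτ)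
    have h0 := hφ0 τ
    have e : φ τ = PhiC a ψ C τ := hE τ (ht10.trans (ht.trans hτ))
    rw [← e] at h1
    have h2 : φ τ ^ p ≤ C1 ^ p * Real.exp (-(b * p * τ)) := by
      refine (Real.rpow_le_rpow h0 h1 hpp.le).trans_eq ?_
      rw [Real.mul_rpow hC10 (Real.exp_pos _).le, ← Real.exp_mul]
      ring_nf
    have h3 : ψ τ ≤ Kb * (C1 ^ p * Real.exp (-(b * p * τ))) :=
      mul_le_mul (hKb τ) h2 (Real.rpow_nonneg h0 _) hKb0
    refine (mul_le_mul_of_nonneg_left h3 (Real.exp_pos _).le).trans_eq ?_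
    rw [show -((a + b * p) * τ) = -(a * τ) + -(b * p * τ) by ring, Real.exp_add]
    ring
  set E := K / (a + b * p) / c with hEd
  have hE0 : 0 ≤ E := by positivity
  have hW : AntitoneOn (fun t => U t + E * Real.exp (-(c * t))) (Ici t1) := by
    have hd : ∀ t, HasDerivAt (fun t => U t + E * Real.exp (-(c * t)))
        (Real.exp (2 * a * t) * V t + E * (-c * Real.exp (-(c * t)))) t := fun t =>
      (hdU t).add ((hasDerivAt_expm c t).const_mul E)
    apply antitoneOn_of_deriv_nonpos (convex_Ici _)
      (fun t _ => (hd t).continuousAt.continuousWithinAt)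
      (fun t _ => (hd t).differentiableAt.differentiableWithinAt)
    intro t ht
    rw [interior_Ici, mem_Ioi] at ht
    rw [(hd t).deriv]
    have h1 := mul_le_mul_of_nonneg_left (hV2 t ht.le) (Real.exp_pos (2 * a * t)).le
    have h2 : Real.exp (2 * a * t) * (K * (Real.exp (-((a + b * p) * t)) / (a + b * p))) =
        E * c * Real.exp (-(c * t)) := by
      have : Real.exp (-(c * t)) = Real.exp (2 * a * t) * Real.exp (-((a + b * p) * t)) := by
        rw [← Real.exp_add, hc]; ring_nf
      rw [this, hEd]; field_simp
    linarith
  set Bd := U t1 + E * Real.exp (-(c * t1)) with hBd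
  have hUb : ∀ t, 0 ≤ t → U t ≤ Bd := by
    intro t ht
    set m := max t t1 with hm
    have m1 : t ≤ m := le_max_left _ _
    have m2 : t1 ≤ m := le_max_right _ _
    have h1 : U t ≤ U m := hUm (mem_Ici.mpr ht) (mem_Ici.mpr (ht.trans m1)) m1
    have h2 := hW (mem_Ici.mpr le_rfl) (mem_Ici.mpr m2) m2
    simp only at h2
    have h3 : 0 ≤ E * Real.exp (-(c * m)) := by positivity
    linarith
  -- limit
  have hmono : Monotone fun t => U (max t 0) := by
    intro x y hxy
    exact hUm (mem_Ici.mpr (le_max_right _ _)) (mem_Ici.mpr (le_max_right _ _))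
      (max_le_max_right 0 hxy)
  have hbdd : BddAbove (range fun t => U (max t 0)) := by
    refine ⟨Bd, ?_⟩
    rintro _ ⟨t, rfl⟩
    exact hUb _ (le_max_right _ _)
  have hlim := tendsto_atTop_ciSup hmono hbdd
  set L := ⨆ t, U (max t 0) with hL
  have hLs : U s ≤ L := by
    have := le_ciSup hbdd s
    simp only [max_eq_left hs0] at this
    exact this
  refine ⟨U, V, L, by linarith, hU0, hUpos, ?_, hVt, hdU, ?_⟩
  · refine hlim.congr' ?_
    filter_upwards [eventually_ge_atTop 0] with t ht
    rw [max_eq_left ht]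
  · intro t ht
    refine (hdV t).congr_deriv ?_
    have hUt : 0 ≤ U t := by
      rcases ht.eq_or_lt with h | h
      · rw [← h, hU0]
      · exact (hUpos t h).le
    simp only [hψ]
    rw [hUφ t ht, Real.mul_rpow (Real.exp_pos _).le hUt, ← Real.exp_mul]
    have : Real.exp (-((2 * a + 2) * t)) = Real.exp (-(a * t)) * Real.exp (-(a * t) * p) := by
      rw [← Real.exp_add]; congr 1
      rw [hp]; field_simp; ring
    rw [this]; ring

noncomputable def Aav (N : ℕ) (h : ℝ → ℝ) (r : ℝ) : ℝ :=
  ∫ σ in (0:ℝ)..1, σ ^ (N - 1) * h (σ * r)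

theorem Aav_cont (N : ℕ) {h : ℝ → ℝ} (hh : Continuous h) : Continuous (Aav N h) := by
  apply intervalIntegral.continuous_parametric_intervalIntegral_of_continuous'
  fun_prop

theorem Aav_mul {N : ℕ} (hN : 1 ≤ N) (h : ℝ → ℝ) (r : ℝ) :
    r ^ N * Aav N h r = ∫ ρ in (0:ℝ)..r, ρ ^ (N - 1) * h ρ := by
  have e := intervalIntegral.mul_integral_comp_mul_right (a := 0) (b := 1)
    (f := fun ρ => ρ ^ (N - 1) * h ρ) r
  rw [zero_mul, one_mul] at e
  rw [← e]
  obtain ⟨n, rfl⟩ : ∃ n, N = n + 1 := ⟨N - 1, by omega⟩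
  unfold Aav
  rw [pow_succ', mul_assoc, ← intervalIntegral.integral_const_mul]
  congr 1
  apply intervalIntegral.integral_congr
  intro σ _
  simp only [Nat.add_sub_cancel, mul_pow]
  ring

theorem Aav_zero {N : ℕ} (hN : 1 ≤ N) (h : ℝ → ℝ) : N * Aav N h 0 = h 0 := by
  unfold Aav
  simp only [mul_zero, intervalIntegral.integral_mul_const, integral_pow]
  obtain ⟨n, rfl⟩ : ∃ n, N = n + 1 := ⟨N - 1, by omega⟩
  simp
  field_simp

theorem Aav_deriv {N : ℕ} (hN : 1 ≤ N) {h : ℝ → ℝ} (hh : Continuous h) {r : ℝ} (hr : 0 < r) :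
    HasDerivAt (Aav N h) ((h r - N * Aav N h r) / r) r := by
  have hc : Continuous fun ρ => ρ ^ (N - 1) * h ρ := by fun_prop
  have h1 : HasDerivAt (fun r => (∫ ρ in (0:ℝ)..r, ρ ^ (N - 1) * h ρ) / r ^ N)
      ((r ^ (N - 1) * h r * r ^ N - (∫ ρ in (0:ℝ)..r, ρ ^ (N - 1) * h ρ) * (N * r ^ (N - 1)))
        / (r ^ N) ^ 2) r :=
    (ftc_cont hc 0 r).div (hasDerivAt_pow N r) (by positivity)
  have h2 : HasDerivAt (Aav N h) _ r := h1.congr_of_eventuallyEq (by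
    filter_upwards [eventually_gt_nhds hr] with s hs
    rw [← Aav_mul hN]; field_simp)
  refine h2.congr_deriv ?_
  rw [← Aav_mul hN]
  obtain ⟨n, rfl⟩ : ∃ n, N = n + 1 := ⟨N - 1, by omega⟩
  simp only [Nat.add_sub_cancel]
  field_simp
  push_cast
  ring

section
variable {E : Type*} [NormedAddCommGroup E] [InnerProductSpace ℝ E]

theorem norm_fderiv {x : E} (hx : x ≠ 0) :
    HasFDerivAt (fun y : E => ‖y‖) ((1 / ‖x‖) • innerSL ℝ x) x := by
  have h1 : HasFDerivAt (fun y : E => ‖y‖ ^ 2) (2 • innerSL ℝ x) x :=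
    (hasStrictFDerivAt_norm_sq x).hasFDerivAt
  have hn : 0 < ‖x‖ := norm_pos_iff.mpr hx
  have h2 := h1.sqrt (by positivity)
  have e : (fun y : E => Real.sqrt (‖y‖ ^ 2)) = fun y => ‖y‖ := by
    ext y; rw [Real.sqrt_sq (norm_nonneg _)]
  rw [e, Real.sqrt_sq hn.le] at h2
  refine h2.congr_fderiv ?_
  ext v
  simp
  field_simp

theorem radial_fderiv {w A : ℝ → ℝ} (hw : ∀ r, HasDerivAt w (-(r * A r)) r) (x : E) :
    HasFDerivAt (fun y : E => w ‖y‖) (innerSL ℝ (-(A ‖x‖) • x)) x := by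
  by_cases hx : x = 0
  · subst hx
    have h0 := hw 0
    simp only [zero_mul, neg_zero] at h0
    rw [hasDerivAt_iff_isLittleO] at h0
    rw [hasFDerivAt_iff_isLittleO]
    have ht : Tendsto (fun y : E => ‖y‖) (𝓝 0) (𝓝 0) := by
      simpa using (continuous_norm (E := E)).tendsto 0
    have := h0.comp_tendsto ht
    simp only [smul_zero, map_zero, norm_zero, sub_zero] at this ⊢
    have h2 := Asymptotics.isLittleO_norm_right.mp this
    simpa [Function.comp_def] using h2
  · have hn : 0 < ‖x‖ := norm_pos_iff.mpr hx
    refine ((hw ‖x‖).comp_hasFDerivAt x (norm_fderiv hx)).congr_fderiv ?_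
    ext v
    simp
    field_simp

noncomputable def Dgrad (A h : ℝ → ℝ) (n : ℝ) (x : E) : E →L[ℝ] E :=
  -(A ‖x‖ • ContinuousLinearMap.id ℝ E +
    ((h ‖x‖ - n * A ‖x‖) / ‖x‖ ^ 2) • (innerSL ℝ x).smulRight x)

theorem radial_fderiv2 {A h : ℝ → ℝ} {n : ℝ} (hA : Continuous A)
    (hd : ∀ r, 0 < r → HasDerivAt A ((h r - n * A r) / r) r) (x : E) :
    HasFDerivAt (fun y : E => -(A ‖y‖) • y) (Dgrad A h n x) x := by
  by_cases hx : x = 0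
  · subst hx
    rw [hasFDerivAt_iff_isLittleO]
    have e : (fun y : E => -(A ‖y‖) • y - -(A ‖(0:E)‖) • (0:E) - (Dgrad A h n (0:E)) (y - 0)) =
        fun y => (A 0 - A ‖y‖) • y := by
      ext y
      simp [Dgrad, sub_smul]
      abel
    rw [e]
    have ht : Tendsto (fun y : E => A 0 - A ‖y‖) (𝓝 0) (𝓝 0) := by
      have : Continuous fun y : E => A 0 - A ‖y‖ := by fun_prop
      simpa using this.tendsto 0
    have h1 : (fun y : E => A 0 - A ‖y‖) =o[𝓝 0] (fun _ => (1:ℝ)) :=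
      (Asymptotics.isLittleO_one_iff ℝ).mpr ht
    have := h1.smul_isBigO (Asymptotics.isBigO_refl (fun y : E => y) (𝓝 0))
    simpa using this
  · have hn : 0 < ‖x‖ := norm_pos_iff.mpr hx
    have h1 := ((hd ‖x‖ hn).comp_hasFDerivAt x (norm_fderiv hx)).neg.smul (hasFDerivAt_id x)
    refine h1.congr_fderiv ?_
    ext v
    simp only [Dgrad, Function.comp_apply, Pi.neg_apply, id]
    simp
    have : (h ‖x‖ - n * A ‖x‖) / ‖x‖ * (‖x‖⁻¹ * inner ℝ x v) =
      ((h ‖x‖ - n * A ‖x‖) / ‖x‖ ^ 2) * inner ℝ x v := by field_simp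
    rw [this, mul_smul]
    abel

theorem Dgrad_cont {A h : ℝ → ℝ} {n : ℝ} (hA : Continuous A) (hh : Continuous h)
    (h0 : n * A 0 = h 0) : Continuous (fun x : E => Dgrad A h n x) := by
  unfold Dgrad
  refine Continuous.neg (Continuous.add (by fun_prop) ?_)
  rw [continuous_iff_continuousAt]
  intro x
  have hsm : Continuous fun x : E => (innerSL ℝ x).smulRight x := by
    have : Continuous fun x : E => innerSL ℝ x := (innerSL ℝ).continuous
    fun_prop
  by_cases hx : x = 0
  · subst hx
    unfold ContinuousAt
    have ht : Tendsto (fun y : E => |h ‖y‖ - n * A ‖y‖|) (𝓝 0) (𝓝 0) := by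
      have : Continuous fun y : E => |h ‖y‖ - n * A ‖y‖| := by fun_prop
      simpa [h0] using this.tendsto 0
    simp only [norm_zero, map_zero]
    have e : (((h 0 - n * A 0) / 0 ^ 2) • (0 : E →L[ℝ] ℝ).smulRight (0:E)) = 0 := by
      ext; simp
    rw [e]
    apply squeeze_zero_norm _ ht
    intro y
    rw [norm_smul, ContinuousLinearMap.norm_smulRight_apply, innerSL_apply_norm]
    rw [Real.norm_eq_abs, abs_div, abs_of_nonneg (by positivity : 0 ≤ ‖y‖ ^ 2), ← sq]
    by_cases hy : ‖y‖ = 0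
    · simp [hy]
    · rw [div_mul_cancel₀ _ (by positivity)]
  · have hn : 0 < ‖x‖ := norm_pos_iff.mpr hx
    have hq : ContinuousAt (fun y : E => (h ‖y‖ - n * A ‖y‖) / ‖y‖ ^ 2) x :=
      ContinuousAt.div (by fun_prop) (by fun_prop) (by positivity)
    exact hq.smul hsm.continuousAt

end

theorem radial_main {N : ℕ} (hN : 1 ≤ N) {h : ℝ → ℝ} (hh : Continuous h) (L : ℝ)
    {w : ℝ → ℝ} (hw : w = fun r => L - ∫ ρ in (0:ℝ)..r, ρ * Aav N h ρ) :
    ContDiff ℝ 2 (fun x : EuclideanSpace ℝ (Fin N) => w ‖x‖) ∧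
    ∀ x : EuclideanSpace ℝ (Fin N), -laplacian (fun x => w ‖x‖) x = h ‖x‖ := by
  have hA := Aav_cont N hh
  set A := Aav N h with hAdef
  have hdw : ∀ r, HasDerivAt w (-(r * A r)) r := fun r => by
    rw [hw]
    exact (ftc_cont (continuous_id.mul hA) 0 r).const_sub L
  have hd : ∀ r, 0 < r → HasDerivAt A ((h r - N * A r) / r) r := fun r hr => Aav_deriv hN hh hr
  have f1 := fun x : EuclideanSpace ℝ (Fin N) => radial_fderiv hdw x
  have f2 := fun x : EuclideanSpace ℝ (Fin N) => radial_fderiv2 hA hd x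
  have hz : (N:ℝ) * A 0 = h 0 := Aav_zero hN h
  constructor
  · rw [show (2 : WithTop ℕ∞) = ((1:ℕ) : WithTop ℕ∞) + 1 by norm_num]
    rw [contDiff_succ_iff_hasFDerivAt]
    refine ⟨_, ?_, f1⟩
    have : ContDiff ℝ 1 (fun x : EuclideanSpace ℝ (Fin N) => -(A ‖x‖) • x) :=
      contDiff_one_iff_hasFDerivAt.mpr ⟨_, Dgrad_cont hA hh hz, f2⟩
    exact (innerSL ℝ).contDiff.comp (by simpa using this)
  · intro x
    unfold laplacian
    have e : ∀ i : Fin N, fderiv ℝ (fun y => fderiv ℝ (fun x : EuclideanSpace ℝ (Fin N) => w ‖x‖) y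
        (EuclideanSpace.single i (1:ℝ))) x (EuclideanSpace.single i (1:ℝ)) =
        -(A ‖x‖ + (h ‖x‖ - N * A ‖x‖) / ‖x‖ ^ 2 * x i ^ 2) := by
      intro i
      have e1 : (fun y => fderiv ℝ (fun x : EuclideanSpace ℝ (Fin N) => w ‖x‖) y
        (EuclideanSpace.single i (1:ℝ))) = fun y => inner ℝ (-(A ‖y‖) • y) (EuclideanSpace.single i (1:ℝ)) := by
        ext y
        rw [(f1 y).fderiv]; rfl
      rw [e1]
      have e2 := ((f2 x).inner ℝ (hasFDerivAt_const (EuclideanSpace.single i (1:ℝ)) x)).fderiv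
      rw [e2]
      simp [Dgrad, EuclideanSpace.inner_single_right, fderivInnerCLM_apply]
      left; ring
    simp only [e]
    rw [Finset.sum_neg_distrib, neg_neg, Finset.sum_add_distrib, ← Finset.mul_sum]
    have e3 : ∑ i, x i ^ 2 = ‖x‖ ^ 2 := by
      rw [EuclideanSpace.norm_sq_eq]; simp
    rw [e3]
    simp only [Finset.sum_const, Finset.card_univ, Fintype.card_fin, nsmul_eq_mul]
    by_cases hx : ‖x‖ = 0
    · rw [hx]; simp [hz]
    · rw [div_mul_cancel₀ _ (by positivity)]; ring

theorem eq_of_deriv_lim {f g d : ℝ → ℝ} {l : ℝ} (hf : ∀ t, 0 ≤ t → HasDerivAt f (d t) t)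
    (hg : ∀ t, 0 ≤ t → HasDerivAt g (d t) t) (hfl : Tendsto f atTop (𝓝 l))
    (hgl : Tendsto g atTop (𝓝 l)) {t : ℝ} (ht : 0 ≤ t) : f t = g t := by
  have hc : ∀ s, t ≤ s → (f - g) s = (f - g) t := by
    intro s hs
    refine constant_of_has_deriv_right_zero (f := f - g) (a := t) (b := s) ?_ ?_ s ⟨hs, le_rfl⟩
    · intro x hx
      exact ((hf x (ht.trans hx.1)).sub (hg x (ht.trans hx.1))).continuousAt.continuousWithinAt
    · intro x hx
      have := (hf x (ht.trans hx.1)).sub (hg x (ht.trans hx.1))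
      rw [sub_self] at this
      exact this.hasDerivWithinAt
  have h1 : Tendsto (f - g) atTop (𝓝 ((f - g) t)) := by
    refine tendsto_const_nhds.congr' ?_
    filter_upwards [eventually_ge_atTop t] with s hs using (hc s hs).symm
  have h2 : Tendsto (f - g) atTop (𝓝 0) := by
    have := hfl.sub hgl
    rw [sub_self] at this
    exact this
  have := tendsto_nhds_unique h1 h2
  simp only [Pi.sub_apply] at this
  linarith

theorem u0_cont {U : ℝ → ℝ} (hU : Continuous U) {L : ℝ} (hL : Tendsto U atTop (𝓝 L)) :
    Continuous fun r : ℝ => if r ≤ 0 then L else U (-Real.log r) := by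
  rw [continuous_iff_continuousAt]
  intro r
  rcases lt_trichotomy r 0 with h | h | h
  · refine (continuousAt_const (y := L)).congr ?_
    filter_upwards [eventually_lt_nhds h] with s hs
    rw [if_pos hs.le]
  · subst h
    rw [continuousAt_iff_continuous_left_right]
    constructor
    · refine (continuousWithinAt_const (b := L)).congr ?_ ?_
      · intro y hy; exact if_pos hy
      · rw [if_pos le_rfl]
    · rw [← continuousWithinAt_Ioi_iff_Ici]
      unfold ContinuousWithinAt
      simp only [le_refl, if_true]
      have : Tendsto (fun r => U (-Real.log r)) (𝓝[>] 0) (𝓝 L) :=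
        hL.comp (tendsto_neg_atBot_atTop.comp Real.tendsto_log_nhdsGT_zero)
      refine this.congr' ?_
      filter_upwards [self_mem_nhdsWithin] with s hs
      rw [if_neg (not_le.mpr hs)]
  · have : ContinuousAt (fun r => U (-Real.log r)) r :=
      hU.continuousAt.comp (Real.continuousAt_log h.ne').neg
    refine this.congr ?_
    filter_upwards [eventually_gt_nhds h] with s hs
    rw [if_neg (not_le.mpr hs)]

theorem stmt_5 (N : ℕ) (hN : 3 ≤ N) (g : EuclideanSpace ℝ (Fin N) → ℝ)
    -- (g1)
    (hg_holder : ∃ C α : ℝ≥0, 0 < α ∧ α ≤ 1 ∧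
      HolderOnWith C α g (closedBall (0 : EuclideanSpace ℝ (Fin N)) 1))
    (hg_ge : ∀ x ∈ closedBall (0 : EuclideanSpace ℝ (Fin N)) 1, -1 ≤ g x)
    (hg_radial : ∀ x y : EuclideanSpace ℝ (Fin N), ‖x‖ = ‖y‖ → g x = g y)
    -- (g2)
    (hg0 : g 0 = 0)
    -- (g3)
    (hg3 : ∃ γ δ C : ℝ, 0 < γ ∧ γ < (N : ℝ) - 2 ∧ 0 < δ ∧ δ ≤ 1 ∧ 0 < C ∧
      ∀ x : EuclideanSpace ℝ (Fin N), 0 < ‖x‖ → ‖x‖ < δ → C * ‖x‖ ^ γ ≤ g x) :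
    ∃ u : EuclideanSpace ℝ (Fin N) → ℝ,
      (∀ x y : EuclideanSpace ℝ (Fin N), ‖x‖ = ‖y‖ → u x = u y) ∧
      ContinuousOn u (closedBall 0 1) ∧
      ContDiffOn ℝ 2 u (ball 0 1) ∧
      (∀ x ∈ ball (0 : EuclideanSpace ℝ (Fin N)) 1, 0 < u x) ∧
      (∀ x ∈ sphere (0 : EuclideanSpace ℝ (Fin N)) 1, u x = 0) ∧
      (∀ x ∈ ball (0 : EuclideanSpace ℝ (Fin N)) 1,
        -laplacian u x = (1 + g x) * u x ^ (((N : ℝ) + 2) / ((N : ℝ) - 2))) := by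
  obtain ⟨Ch, α, hα, -, hgH⟩ := hg_holder
  have hgc := hgH.continuousOn hα
  obtain ⟨γ, δ, C, hγ, hγN, hδ, hδ1, hC, hgl⟩ := hg3
  have hN3 : (3:ℝ) ≤ N := by exact_mod_cast hN
  set a : ℝ := ((N:ℝ) - 2) / 2 with ha_def
  have ha : 0 < a := by rw [ha_def]; linarith
  have hNa : (N:ℝ) = 2 * a + 2 := by rw [ha_def]; ring
  have hexp : ((N : ℝ) + 2) / ((N : ℝ) - 2) = 1 + 2 / a := by
    have : (N:ℝ) - 2 = 2 * a := by linarith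
    rw [this, hNa]; field_simp; ring
  rw [hexp]
  set p := 1 + 2 / a with hp
  have hpp : 0 < p := by positivity
  set e : EuclideanSpace ℝ (Fin N) := EuclideanSpace.single ⟨0, by omega⟩ (1:ℝ) with he
  have hne : ‖e‖ = 1 := by simp [he]
  set cl : ℝ → ℝ := fun r => max 0 (min r 1) with hcl
  have hcl01 : ∀ r, cl r ∈ Icc (0:ℝ) 1 := fun r =>
    ⟨le_max_left _ _, max_le zero_le_one (min_le_right _ _)⟩
  have hclid : ∀ r ∈ Icc (0:ℝ) 1, cl r = r := fun r hr => by
    simp only [hcl]; rw [min_eq_left hr.2, max_eq_right hr.1]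
  have hclc : Continuous cl := by simp only [hcl]; fun_prop
  have hnorm : ∀ r ∈ Icc (0:ℝ) 1, ‖r • e‖ = r := fun r hr => by
    rw [norm_smul, hne, mul_one, Real.norm_of_nonneg hr.1]
  set K : ℝ → ℝ := fun r => 1 + g (cl r • e) with hK
  have hmemb : ∀ r, cl r • e ∈ closedBall (0 : EuclideanSpace ℝ (Fin N)) 1 := fun r => by
    rw [mem_closedBall_zero_iff, hnorm _ (hcl01 r)]; exact (hcl01 r).2
  have hKc : Continuous K := by
    refine continuous_const.add (hgc.comp_continuous (by fun_prop) hmemb)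
  have hK0 : ∀ r, 0 ≤ K r := fun r => by
    have := hg_ge _ (hmemb r)
    simp only [hK]; linarith
  have hKx : ∀ x : EuclideanSpace ℝ (Fin N), ‖x‖ ≤ 1 → K ‖x‖ = 1 + g x := by
    intro x hx
    have hm : ‖x‖ ∈ Icc (0:ℝ) 1 := ⟨norm_nonneg _, hx⟩
    simp only [hK]
    rw [hclid _ hm, hg_radial _ x (hnorm _ hm)]
  obtain ⟨Kb, hKb⟩ := (isCompact_Icc (a := (0:ℝ)) (b := 1)).bddAbove_image hKc.continuousOn
  have hKb' : ∀ r, K r ≤ Kb := fun r => by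
    have h1 : K (cl r) = K r := by simp only [hK]; rw [hclid _ (hcl01 r)]
    rw [← h1]
    exact hKb ⟨_, hcl01 r, rfl⟩
  set k : ℝ → ℝ := fun t => K (Real.exp (-t)) with hk
  have hkc : Continuous k := hKc.comp (by fun_prop)
  have hk1 : Tendsto k atTop (𝓝 1) := by
    have h1 : K 0 = 1 := by
      have := hKx 0 (by simp)
      rwa [norm_zero, hg0, add_zero] at this
    have := (hKc.tendsto 0).comp Real.tendsto_exp_neg_atTop_nhds_zero
    rwa [h1] at this
  have hkl : ∀ t, (-Real.log δ + 1) ≤ t → 1 + C * Real.exp (-(γ * t)) ≤ k t := by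
    intro t ht
    have h1 : Real.exp (-t) < δ := by
      rw [← Real.lt_log_iff_exp_lt hδ]; linarith
    have hm : Real.exp (-t) ∈ Icc (0:ℝ) 1 := ⟨(Real.exp_pos _).le, (h1.trans_le hδ1).le⟩
    have h2 := hgl (Real.exp (-t) • e) (by rw [hnorm _ hm]; exact Real.exp_pos _)
      (by rw [hnorm _ hm]; exact h1)
    rw [hnorm _ hm, ← Real.exp_mul] at h2
    simp only [hk, hK]
    rw [hclid _ hm, show -(γ * t) = -t * γ by ring]
    linarith
  have hlogδ : Real.log δ ≤ 0 := Real.log_nonpos hδ.le hδ1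
  obtain ⟨U, V, L, hL, hU0, hUpos, hUL, hV0, hdU, hdV⟩ :=
    radial_ode ha hkc (fun t => hK0 _) (fun t => hKb' _) hk1 hC hγ (by linarith)
      (by linarith) hkl
  have hUc : Continuous U := continuous_iff_continuousAt.mpr fun t => (hdU t).continuousAt
  set u0 : ℝ → ℝ := fun r => if r ≤ 0 then L else U (-Real.log r) with hu0
  have hu0c : Continuous u0 := u0_cont hUc hUL
  have hu0e : ∀ t, u0 (Real.exp (-t)) = U t := fun t => by
    simp only [hu0]
    rw [if_neg (not_le.mpr (Real.exp_pos _)), Real.log_exp, neg_neg]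
  set h : ℝ → ℝ := fun r => K r * u0 r ^ p with hh
  have hhc : Continuous h := hKc.mul ((Real.continuous_rpow_const hpp.le).comp hu0c)
  have hN1 : 1 ≤ N := by omega
  set w : ℝ → ℝ := fun r => L - ∫ ρ in (0:ℝ)..r, ρ * Aav N h ρ with hw
  obtain ⟨hC2, hlap⟩ := radial_main hN1 hhc L hw
  have hAc := Aav_cont N hhc
  have hdw : ∀ r, HasDerivAt w (-(r * Aav N h r)) r := fun r =>
    (ftc_cont (continuous_id.mul hAc) 0 r).const_sub L
  have hwc : Continuous w := continuous_iff_continuousAt.mpr fun t => (hdw t).continuousAt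
  have hw0 : w 0 = L := by simp [hw]
  have hde : ∀ t : ℝ, HasDerivAt (fun t => Real.exp (-t)) (-Real.exp (-t)) t := fun t => by
    simpa using (hasDerivAt_neg t).exp
  -- V
  have hpc : Continuous fun ρ : ℝ => ρ ^ (N - 1) * h ρ := by fun_prop
  have hVH : ∀ t, 0 ≤ t → V t = ∫ ρ in (0:ℝ)..Real.exp (-t), ρ ^ (N - 1) * h ρ := by
    intro t ht
    refine eq_of_deriv_lim (g := fun t => ∫ ρ in (0:ℝ)..Real.exp (-t), ρ ^ (N - 1) * h ρ)
      hdV ?_ hV0 ?_ ht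
    · intro s _
      have h1 := (ftc_cont hpc 0 (Real.exp (-s))).comp s (hde s)
      refine h1.congr_deriv ?_
      simp only [hh]
      rw [hu0e]
      have : Real.exp (-((2 * a + 2) * s)) = Real.exp (-s) ^ (N - 1) * Real.exp (-s) := by
        rw [← pow_succ, Nat.sub_add_cancel hN1, ← Real.exp_nat_mul, hNa]
        ring_nf
      rw [this]; simp only [hk]; ring
    · have hc : Continuous fun r => ∫ ρ in (0:ℝ)..r, ρ ^ (N - 1) * h ρ :=
        continuous_iff_continuousAt.mpr fun t => (ftc_cont hpc 0 t).continuousAt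
      have := (hc.tendsto 0).comp Real.tendsto_exp_neg_atTop_nhds_zero
      simpa [Function.comp_def] using this
  have hUw : ∀ t, 0 ≤ t → U t = w (Real.exp (-t)) := by
    intro t ht
    refine eq_of_deriv_lim (g := fun t => w (Real.exp (-t))) (fun t _ => hdU t) ?_ hUL ?_ ht
    · intro s hs
      have h1 := (hdw (Real.exp (-s))).comp s (hde s)
      refine h1.congr_deriv ?_
      rw [hVH s hs, ← Aav_mul hN1]
      have : Real.exp (2 * a * s) * Real.exp (-s) ^ N = Real.exp (-s) * Real.exp (-s) := by
        rw [← Real.exp_nat_mul, ← Real.exp_add, ← Real.exp_add, hNa]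
        ring_nf
      rw [← mul_assoc, this]; ring
    · have := (hwc.tendsto 0).comp Real.tendsto_exp_neg_atTop_nhds_zero
      rwa [hw0] at this
  have hwlog : ∀ r, 0 < r → r ≤ 1 → w r = U (-Real.log r) := by
    intro r hr hr1
    rw [hUw _ (by have := Real.log_nonpos hr.le hr1; linarith), neg_neg, Real.exp_log hr]
  have hwu : ∀ r ∈ Icc (0:ℝ) 1, w r = u0 r := by
    intro r hr
    simp only [hu0]
    rcases hr.1.eq_or_lt with h0 | h0
    · rw [← h0, if_pos le_rfl, hw0]
    · rw [if_neg (not_le.mpr h0), hwlog r h0 hr.2]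
  refine ⟨fun x => w ‖x‖, fun x y hxy => by simp only [hxy], hC2.continuous.continuousOn,
    hC2.contDiffOn, ?_, ?_, ?_⟩
  · intro x hx
    rw [mem_ball_zero_iff] at hx
    rcases (norm_nonneg x).eq_or_lt with h0 | h0
    · simp only [← h0]; rw [hw0]; exact hL
    · change 0 < w ‖x‖
      rw [hwlog _ h0 hx.le]
      apply hUpos
      have := Real.log_neg h0 hx
      linarith
  · intro x hx
    rw [mem_sphere_zero_iff_norm] at hx
    simp only [hx]
    rw [hwlog 1 one_pos le_rfl]; simp [hU0]
  · intro x hx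
    rw [mem_ball_zero_iff] at hx
    rw [hlap x]
    simp only [hh]
    rw [hKx x hx.le, hwu _ ⟨norm_nonneg x, hx.le⟩]
end
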